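/- arXiv:math/9406207 — 2 statements merged into one kernel-verified Lean document; each statement's English description precedes it below -/
import Mathlib

section
/- Let H̄ be the group with presentation ⟨x, y | x^{31} = 1, y^{31} = 1, (x^2y)^2 = 1, (xy^2)^2 = 1, (x^3y^{-11})^2 = 1, (x^4y^{13})^2 = 1⟩. Then H̄ is isomorphic to SL(2, 32), the special linear group of degree 2 over the field with 32 elements. -/
/-- The relators of ⟨x, y | x³¹ = y³¹ = (x²y)² = (xy²)² = (x³y⁻¹¹)² = (x⁴y¹³)² = 1⟩. -/
def Hrels : Set (FreeGroup (Fin 2)) :=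
  {(FreeGroup.of 0) ^ 31, (FreeGroup.of 1) ^ 31,
   ((FreeGroup.of 0) ^ 2 * FreeGroup.of 1) ^ 2,
   (FreeGroup.of 0 * (FreeGroup.of 1) ^ 2) ^ 2,
   ((FreeGroup.of 0) ^ 3 * (FreeGroup.of 1) ^ (-11 : ℤ)) ^ 2,
   ((FreeGroup.of 0) ^ 4 * (FreeGroup.of 1) ^ 13) ^ 2}

/-- The group H̄ = ⟨x, y | x³¹ = y³¹ = (x²y)² = (xy²)² = (x³y⁻¹¹)² = (x⁴y¹³)² = 1⟩. -/
abbrev Hbar : Type := PresentedGroup Hrels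

namespace CosetEnumeration

/-- The generators `x`, `y` and their formal inverses. -/
inductive Letter
  | x | xInv | y | yInv

namespace Letter

/-- The formal inverse of a letter. -/
def inv : Letter → Letter
  | x => xInv
  | xInv => x
  | y => yInv
  | yInv => y

/-- The letter with a given code. -/
def ofNat : ℕ → Letter
  | 0 => x
  | 1 => xInv
  | 2 => y
  | _ => yInv

end Letter

/-- The partially known images of a coset under the four letters. -/
inductive Row
  | mk (a b c d : Option ℕ)

namespace Row

/-- The row without any known image. -/
def empty : Row := mk none none none none

/-- The image under a letter. -/
def get : Row → Letter → Option ℕ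
  | mk a _ _ _, .x => a
  | mk _ b _ _, .xInv => b
  | mk _ _ c _, .y => c
  | mk _ _ _ d, .yInv => d

/-- Record an image under a letter. -/
def set : Row → Letter → ℕ → Row
  | mk _ b c d, .x, n => mk (some n) b c d
  | mk a _ c d, .xInv, n => mk a (some n) c d
  | mk a b _ d, .y, n => mk a b (some n) d
  | mk a b c _, .yInv, n => mk a b c (some n)

/-- Add to the second row the images known only in the first. -/
def join : Row → Row → Row
  | mk a b c d, mk a' b' c' d' => mk (a'.or a) (b'.or b) (c'.or c) (d'.or d)

/-- Prepend the pair of two known images to a list of pairs. -/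
def pair : Option ℕ → Option ℕ → List (ℕ × ℕ) → List (ℕ × ℕ)
  | some m, some n, p => (m, n) :: p
  | _, _, p => p

/-- Prepend to a list the pairs of images known in both rows. -/
def pairs : Row → Row → List (ℕ × ℕ) → List (ℕ × ℕ)
  | mk a b c d, mk a' b' c' d', p => pair a a' (pair b b' (pair c c' (pair d d' p)))

end Row

/-- The entry of a coset table at a coset number: unused, identified with another number, or live. -/
inductive Entry
  | unused
  | link (m : ℕ)
  | row (r : Row)

/-- A coset table, stored as a binary tree in heap order. -/
inductive Table
  | nil
  | node (e : Entry) (l r : Table)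

/-- Pass a natural number to a function, normalizing it first. -/
def forceNat {α : Type*} (n : ℕ) (k : ℕ → α) : α :=
  match n with
  | 0 => k 0
  | n + 1 => k n.succ

theorem forceNat_eq {α : Type*} (n : ℕ) (k : ℕ → α) : forceNat n k = k n := by
  cases n <;> rfl

namespace Table

/-- Pass a table to a function, normalizing it first. -/
def force {α : Type*} (t : Table) (k : Table → α) : α :=
  match t with
  | nil => k nil
  | node e l r => k (node e l r)

theorem force_eq {α : Type*} (t : Table) (k : Table → α) : t.force k = k t := by
  cases t <;> rfl

/-- The entry at a number. -/
def get : Table → ℕ → Entry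
  | nil, _ => .unused
  | node e _ _, 0 => e
  | node _ l r, n + 1 =>
    match Nat.mod n 2 with
    | 0 => l.get (Nat.div n 2)
    | _ + 1 => r.get (Nat.div n 2)

/-- Change the entry at a number. -/
def set : Table → ℕ → Entry → Table
  | nil, 0, v => node v nil nil
  | nil, _ + 1, _ => nil
  | node _ l r, 0, v => node v l r
  | node e l r, n + 1, v =>
    match Nat.mod n 2 with
    | 0 => (l.set (Nat.div n 2) v).force fun l' => node e l' r
    | _ + 1 => (r.set (Nat.div n 2) v).force fun r' => node e l r'

/-- Make a number live, with a given row. -/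
def setRow (t : Table) (n : ℕ) : Row → Table
  | .mk a b c d => t.set n (.row (.mk a b c d))

/-- The live number a number is identified with, and its row. -/
def find : ℕ → Table → ℕ → Option (ℕ × Row)
  | 0, _, _ => none
  | k + 1, t, n =>
    match t.get n with
    | .unused => none
    | .link m => find k t m
    | .row r => some (n, r)

/-- Identify the two numbers in each pair of a list, and all consequences. -/
def merge : ℕ → Table → List (ℕ × ℕ) → Table
  | 0, t, _ => t
  | _ + 1, t, [] => t
  | k + 1, t, (m, n) :: p =>
    match find 1000 t m, find 1000 t n with
    | some (m', r), some (n', s) =>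
      match Nat.beq m' n', Nat.ble m' n' with
      | true, _ => merge k t p
      | false, true =>
        (t.set n' (.link m')).force fun t =>
          (t.setRow m' (s.join r)).force fun t => merge k t (s.pairs r p)
      | false, false =>
        (t.set m' (.link n')).force fun t =>
          (t.setRow n' (r.join s)).force fun t => merge k t (r.pairs s p)
    | _, _ => t

/-- Record that the letter `l` maps `m` to `n`. -/
def halfEdge (t : Table) (m : ℕ) (l : Letter) (n : ℕ) : Table :=
  match find 1000 t m with
  | none => t
  | some (m', r) =>
    match r.get l with
    | none => t.setRow m' (r.set l n)
    | some n' => merge 10000 t [(n', n)]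

/-- Record that the letter `l` maps `m` to `n`, and its inverse maps `n` to `m`. -/
def edge (t : Table) (m : ℕ) (l : Letter) (n : ℕ) : Table :=
  (t.halfEdge m l n).force fun t => t.halfEdge n l.inv m

/-- Record that a word maps `m` to `n`, if all intermediate images are known. -/
def scan (t : Table) (n : ℕ) : List Letter → ℕ → Table
  | [], _ => t
  | [l], m => t.edge m l n
  | l :: l' :: w, m =>
    match find 1000 t m with
    | none => t
    | some (_, r) =>
      match r.get l with
      | none => t
      | some m' => scan t n (l' :: w) m'

/-- The parent of the number `k` coded by `c` in the spanning tree of definitions. -/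
def parent (k c : ℕ) : ℕ := Nat.sub (Nat.pred k) (Nat.div c 4)

/-- The letter coded by `c`. -/
def letter (c : ℕ) : Letter := Letter.ofNat (Nat.mod c 4)

/-- Define the numbers `k`, `k + 1`, … as images of earlier numbers. -/
def build : List ℕ → ℕ → Table → Table
  | [], _, t => t
  | c :: cs, k, t =>
    forceNat k fun k => forceNat (parent k c) fun m =>
      (t.set k (.row .empty)).force fun t =>
        (t.edge m (letter c) k).force fun t => build cs k.succ t

/-- Scan the given numbers under rotations of the given relators. -/
def run (rels : ℕ → List Letter) : List (ℕ × ℕ × ℕ) → Table → Table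
  | [], t => t
  | (n, i, j) :: ss, t =>
    forceNat n fun n =>
      (t.scan n ((rels i).drop j ++ (rels i).take j) n).force fun t => run rels ss t

/-- A number is identified with a live number below `N`. -/
def inRange (t : Table) (N n : ℕ) : Bool :=
  match find 1000 t n with
  | none => false
  | some (m, _) => Nat.blt m N

/-- An image is known, and is identified with a live number below `N`. -/
def inRangeOpt (t : Table) (N : ℕ) : Option ℕ → Bool
  | none => false
  | some n => t.inRange N n

/-- All images in a row are known and identified with live numbers below `N`. -/
def rowClosed (t : Table) (N : ℕ) : Row → Bool
  | .mk a b c d =>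
    t.inRangeOpt N a && (t.inRangeOpt N b && (t.inRangeOpt N c && t.inRangeOpt N d))

/-- At most `b` numbers below `n` are live, and all have complete rows. -/
def closed (t : Table) (N : ℕ) : ℕ → ℕ → Bool
  | 0, _ => true
  | n + 1, b =>
    match t.get n with
    | .row r =>
      match b with
      | 0 => false
      | b + 1 => t.rowClosed N r && closed t N n b
    | _ => closed t N n b

/-- The table with the base coset only, which is fixed by `x`. -/
def base : Table := node (.row (.mk (some 0) (some 0) none none)) nil nil

/-- The coset enumeration described by `cs` and `ss` closes with at most `b` cosets. -/
def check (rels : ℕ → List Letter) (cs : List ℕ) (ss : List (ℕ × ℕ × ℕ)) (N b : ℕ) : Bool :=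
  (build cs 1 base).force fun t => (run rels ss t).force fun t =>
    t.inRange N 0 && t.closed N N b

end Table

section Soundness

variable {X : Type*}

/-- All information in a row is correct for the images `γ l (f m)`. -/
def Row.Valid (γ : Letter → X → X) (f : ℕ → X) (p : X) (r : Row) : Prop :=
  ∀ l n, r.get l = some n → γ l p = f n

/-- All information in an entry is correct. -/
def Entry.Valid (γ : Letter → X → X) (f : ℕ → X) (p : X) : Entry → Prop
  | .unused => True
  | .link m => p = f m
  | .row r => r.Valid γ f p

/-- All information in a table is correct. -/
def Table.Valid (γ : Letter → X → X) (f : ℕ → X) (t : Table) : Prop :=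
  ∀ n, (t.get n).Valid γ f (f n)

variable {γ : Letter → X → X} {f : ℕ → X}

theorem Row.Valid.set {p : X} {r : Row} (hr : r.Valid γ f p) {l : Letter} {n : ℕ}
    (h : γ l p = f n) : (r.set l n).Valid γ f p := by
  intro l' n' h'
  have := hr l' n'
  cases r; cases l <;> cases l' <;> simp_all [Row.set, Row.get]

theorem Row.Valid.join {p : X} {r s : Row} (hr : r.Valid γ f p) (hs : s.Valid γ f p) :
    (r.join s).Valid γ f p := by
  intro l n h
  have h1 := hr l n
  have h2 := hs l n
  cases r; cases s; cases l <;>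
    simp only [Row.join, Row.get, Option.or_eq_some_iff] at h h1 h2 <;> tauto

theorem Row.pair_valid {q : X} {a b : Option ℕ} {p : List (ℕ × ℕ)}
    (ha : ∀ n, a = some n → q = f n) (hb : ∀ n, b = some n → q = f n)
    (hp : ∀ c ∈ p, f c.1 = f c.2) : ∀ c ∈ Row.pair a b p, f c.1 = f c.2 := by
  cases a with
  | none => exact hp
  | some m =>
    cases b with
    | none => exact hp
    | some n =>
      rintro c hc
      obtain rfl | hc := List.mem_cons.mp hc
      exacts [(ha m rfl).symm.trans (hb n rfl), hp c hc]

theorem Row.Valid.pairs {q : X} {r s : Row} (hr : r.Valid γ f q) (hs : s.Valid γ f q)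
    {p : List (ℕ × ℕ)} (hp : ∀ c ∈ p, f c.1 = f c.2) :
    ∀ c ∈ r.pairs s p, f c.1 = f c.2 := by
  cases r; cases s
  exact pair_valid (hr .x) (hs .x) <| pair_valid (hr .xInv) (hs .xInv) <|
    pair_valid (hr .y) (hs .y) <| pair_valid (hr .yInv) (hs .yInv) hp

namespace Table

theorem get_set (t : Table) (n : ℕ) (v : Entry) (k : ℕ) :
    (t.set n v).get k = v ∧ k = n ∨ (t.set n v).get k = t.get k ∨
      (t.set n v).get k = .unused := by
  induction t generalizing n k with
  | nil =>
    cases n <;> cases k <;> simp [set, get]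
    split <;> simp
  | node e l r hl hr =>
    have hdiv : ∀ a b : ℕ, a % 2 = b % 2 → a / 2 = b / 2 → a = b := by omega
    cases n with
    | zero => cases k <;> simp [set, get]
    | succ n =>
      have hn : Nat.mod n 2 = n % 2 := rfl
      have hn' : Nat.div n 2 = n / 2 := rfl
      cases k with
      | zero =>
        rw [set]
        split <;> simp [force_eq, get]
      | succ k =>
        have hk : Nat.mod k 2 = k % 2 := rfl
        have hk' : Nat.div k 2 = k / 2 := rfl
        have := hl (n / 2) (k / 2)
        have := hr (n / 2) (k / 2)
        have := hdiv k n
        rw [set]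
        split <;> simp only [force_eq, get] <;> split <;> grind

theorem Valid.set {t : Table} (ht : t.Valid γ f) {n : ℕ} {v : Entry}
    (hv : v.Valid γ f (f n)) : (t.set n v).Valid γ f := by
  intro k
  obtain ⟨h, rfl⟩ | h | h := get_set t n v k <;> rw [h]
  exacts [hv, ht k, trivial]

theorem Valid.setRow {t : Table} (ht : t.Valid γ f) {n : ℕ} {r : Row}
    (hr : r.Valid γ f (f n)) : (t.setRow n r).Valid γ f := by
  cases r
  exact ht.set hr

theorem Valid.find {t : Table} (ht : t.Valid γ f) {k n m : ℕ} {r : Row}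
    (h : t.find k n = some (m, r)) : f n = f m ∧ t.get m = .row r := by
  induction k generalizing n with
  | zero => simp [Table.find] at h
  | succ k ih =>
    have := ht n
    rw [Table.find] at h
    split at h
    · simp at h
    · rename_i m' hm
      rw [hm] at this
      obtain ⟨h1, h2⟩ := ih h
      exact ⟨Eq.trans this h1, h2⟩
    · simp only [Option.some.injEq, Prod.mk.injEq] at h
      obtain ⟨rfl, rfl⟩ := h
      exact ⟨rfl, by assumption⟩

theorem Valid.row {t : Table} (ht : t.Valid γ f) {n : ℕ} {r : Row} (h : t.get n = .row r) :
    r.Valid γ f (f n) := by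
  have := ht n
  rwa [h] at this

theorem Valid.merge {t : Table} (ht : t.Valid γ f) {k : ℕ} {p : List (ℕ × ℕ)}
    (hp : ∀ c ∈ p, f c.1 = f c.2) : (t.merge k p).Valid γ f := by
  induction k generalizing t p with
  | zero => exact ht
  | succ k ih =>
    match p with
    | [] => exact ht
    | (m, n) :: p =>
      have hmn : f m = f n := hp (m, n) (by simp)
      replace hp : ∀ c ∈ p, f c.1 = f c.2 := fun c hc => hp c (by simp [hc])
      rw [Table.merge]
      split
      · rename_i m' r n' s hm hn
        obtain ⟨hm, hr⟩ := ht.find hm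
        obtain ⟨hn, hs⟩ := ht.find hn
        replace hr := ht.row hr
        replace hs := ht.row hs
        have h : f m' = f n' := by rw [← hm, ← hn, hmn]
        simp only [force_eq]
        split
        · exact ih ht hp
        · rw [← h] at hs
          exact ih ((ht.set (v := .link m') h.symm).setRow (hs.join hr)) (hs.pairs hr hp)
        · rw [h] at hr
          exact ih ((ht.set (v := .link n') h).setRow (hr.join hs)) (hr.pairs hs hp)
      · exact ht

theorem Valid.halfEdge {t : Table} (ht : t.Valid γ f) {m n : ℕ} {l : Letter}
    (h : γ l (f m) = f n) : (t.halfEdge m l n).Valid γ f := by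
  rw [Table.halfEdge]
  split
  · exact ht
  · rename_i m' r hm
    obtain ⟨hm, hr⟩ := ht.find hm
    replace hr := ht.row hr
    rw [hm] at h
    split
    · exact ht.setRow (hr.set h)
    · rename_i n' hn
      refine ht.merge ?_
      simp [← h, hr l n' hn]

theorem Valid.edge (hγ : ∀ l p, γ l.inv (γ l p) = p) {t : Table} (ht : t.Valid γ f) {m n : ℕ}
    {l : Letter} (h : γ l (f m) = f n) : (t.edge m l n).Valid γ f := by
  rw [Table.edge, force_eq]
  exact (ht.halfEdge h).halfEdge (by rw [← h, hγ])

theorem Valid.scan (hγ : ∀ l p, γ l.inv (γ l p) = p) {t : Table} (ht : t.Valid γ f) {n m : ℕ}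
    {w : List Letter} (h : w.foldl (fun p l => γ l p) (f m) = f n) :
    (t.scan n w m).Valid γ f := by
  fun_induction Table.scan t n w m with
  | case1 => exact ht
  | case2 m l => exact ht.edge hγ h
  | case3 => exact ht
  | case4 => exact ht
  | case5 l l' w m m₁ r hm m' hr ih =>
    obtain ⟨hm, h1⟩ := ht.find hm
    refine ih ?_
    rw [← ht.row h1 l m' hr, ← hm]
    exact h

theorem Valid.build (hγ : ∀ l p, γ l.inv (γ l p) = p) {cs : List ℕ} {k : ℕ} {t : Table}
    (ht : t.Valid γ f)
    (hf : ∀ i (hi : i < cs.length), γ (letter cs[i]) (f (parent (k + i) cs[i])) = f (k + i)) :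
    (build cs k t).Valid γ f := by
  induction cs generalizing k t with
  | nil => exact ht
  | cons c cs ih =>
    simp only [Table.build, forceNat_eq, force_eq]
    refine ih (Valid.edge hγ (ht.set fun l n h => ?_) (hf 0 (by simp))) fun i hi => ?_
    · cases l <;> simp [Row.empty, Row.get] at h
    · have := hf (i + 1) (by simpa using hi)
      rwa [← add_assoc, add_right_comm] at this

theorem Valid.run (hγ : ∀ l p, γ l.inv (γ l p) = p) {rels : ℕ → List Letter}
    (hrels : ∀ i j p, ((rels i).drop j ++ (rels i).take j).foldl (fun p l => γ l p) p = p)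
    {ss : List (ℕ × ℕ × ℕ)} {t : Table} (ht : t.Valid γ f) : (run rels ss t).Valid γ f := by
  induction ss generalizing t with
  | nil => exact ht
  | cons s ss ih =>
    obtain ⟨n, i, j⟩ := s
    simp only [Table.run, forceNat_eq, force_eq]
    exact ih (ht.scan hγ (hrels i j _))

/-- The points numbered by live numbers below `N`. -/
def points (f : ℕ → X) (t : Table) (N : ℕ) : Set X :=
  {p | ∃ n < N, ∃ r, t.get n = .row r ∧ f n = p}

theorem Valid.mem_points {t : Table} (ht : t.Valid γ f) {N n : ℕ} (h : t.inRange N n = true) :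
    f n ∈ t.points f N := by
  rw [inRange] at h
  split at h
  · simp at h
  · rename_i m r hm
    obtain ⟨hm, hr⟩ := ht.find hm
    exact ⟨m, by simpa [Nat.blt_eq] using h, r, hr, hm.symm⟩

theorem Valid.letter_mem_points {t : Table} (ht : t.Valid γ f) {N : ℕ} {p : X} {r : Row}
    (hr : r.Valid γ f p) (h : t.rowClosed N r = true) (l : Letter) : γ l p ∈ t.points f N := by
  have aux : ∀ a : Option ℕ, t.inRangeOpt N a = true → (∀ n, a = some n → γ l p = f n) →
      γ l p ∈ t.points f N := by
    rintro (_ | n) h1 h2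
    · simp [inRangeOpt] at h1
    · rw [h2 n rfl]
      exact ht.mem_points h1
  obtain ⟨a, b, c, d⟩ := r
  simp only [rowClosed, Bool.and_eq_true] at h
  cases l
  exacts [aux a h.1 (hr .x), aux b h.2.1 (hr .xInv), aux c h.2.2.1 (hr .y),
    aux d h.2.2.2 (hr .yInv)]

theorem closed_spec {t : Table} {N n b : ℕ} (h : t.closed N n b = true) (f : ℕ → X) :
    (t.points f n).encard ≤ b ∧ ∀ k < n, ∀ r, t.get k = .row r → t.rowClosed N r = true := by
  induction n generalizing b with
  | zero => simp [points]
  | succ n ih =>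
    have hsub : ∀ p ∈ t.points f (n + 1), p ∈ t.points f n ∨
        ∃ r, t.get n = .row r ∧ f n = p := by
      rintro p ⟨k, hk, r, hr, rfl⟩
      obtain hk | rfl := Nat.lt_succ_iff_lt_or_eq.mp hk
      exacts [.inl ⟨k, hk, r, hr, rfl⟩, .inr ⟨r, hr, rfl⟩]
    rw [closed] at h
    split at h
    · rename_i r hr
      split at h
      · simp at h
      · rename_i b
        rw [Bool.and_eq_true] at h
        obtain ⟨h1, h2⟩ := ih h.2
        refine ⟨?_, fun k hk s hs => ?_⟩
        · calc (t.points f (n + 1)).encard ≤ (insert (f n) (t.points f n)).encard := by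
                refine Set.encard_le_encard fun p hp => ?_
                obtain hp | ⟨_, _, rfl⟩ := hsub p hp
                exacts [.inr hp, .inl rfl]
            _ ≤ (t.points f n).encard + 1 := Set.encard_insert_le _ _
            _ ≤ (b + 1 : ℕ) := by push_cast; gcongr
        · obtain hk | rfl := Nat.lt_succ_iff_lt_or_eq.mp hk
          · exact h2 k hk s hs
          · rw [hr] at hs
            cases hs
            exact h.1
    · rename_i hn
      obtain ⟨h1, h2⟩ := ih h
      refine ⟨(Set.encard_le_encard fun p hp => ?_).trans h1, fun k hk s hs => ?_⟩
      · obtain hp | ⟨r, hr, _⟩ := hsub p hp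
        exacts [hp, (hn r hr).elim]
      · obtain hk | rfl := Nat.lt_succ_iff_lt_or_eq.mp hk
        exacts [h2 k hk s hs, (hn s hs).elim]

/-- The points obtained by following the definitions `cs`. -/
def point (γ : Letter → X → X) (p : X) (cs : List ℕ) (k : ℕ) : X :=
  if h : 0 < k then
    γ (letter (cs.getD (k - 1) 0)) (point γ p cs (parent k (cs.getD (k - 1) 0)))
  else p
termination_by k
decreasing_by
  change k - 1 - _ / 4 < k
  omega

/-- A closed coset enumeration bounds the number of points of a transitive action. -/
theorem exists_invariant_of_check {rels : ℕ → List Letter} {cs : List ℕ}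
    {ss : List (ℕ × ℕ × ℕ)} {N b : ℕ} (h : check rels cs ss N b = true)
    (hγ : ∀ l p, γ l.inv (γ l p) = p)
    (hrels : ∀ i j p, ((rels i).drop j ++ (rels i).take j).foldl (fun p l => γ l p) p = p)
    {p : X} (hp : γ .x p = p) :
    ∃ S : Set X, S.encard ≤ b ∧ p ∈ S ∧ ∀ q ∈ S, ∀ l, γ l q ∈ S := by
  have hp' : γ .xInv p = p := by
    have := hγ .x p
    rwa [hp] at this
  set f := point γ p cs with hf
  have hf0 : f 0 = p := by rw [hf, point]; simp
  have hbase : base.Valid γ f := by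
    rintro (_ | n)
    · rintro (_ | _ | _ | _) n hn <;> simp_all [Row.get]
    · simp only [base, get]
      split <;> trivial
  have hbuild : (build cs 1 base).Valid γ f := by
    refine hbase.build hγ fun i hi => ?_
    conv_rhs => rw [hf, point]
    simp [hi, hf]
  simp only [check, force_eq, Bool.and_eq_true] at h
  have ht := hbuild.run hγ hrels (ss := ss)
  obtain ⟨h1, h2⟩ := closed_spec h.2 f
  refine ⟨_, h1, hf0 ▸ ht.mem_points h.1, ?_⟩
  rintro q ⟨n, hn, r, hr, rfl⟩ l
  exact ht.letter_mem_points (ht.row hr) (h2 n hn r hr) l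

end Table

end Soundness

/-- The relators of `Hbar`. -/
def relator : ℕ → List Letter
  | 0 => [.x, .x, .y, .x, .x, .y]
  | 1 => [.x, .y, .y, .x, .y, .y]
  | 2 => List.replicate 3 .x ++ (List.replicate 11 .yInv ++
      (List.replicate 3 .x ++ List.replicate 11 .yInv))
  | 3 => List.replicate 4 .x ++ (List.replicate 13 .y ++
      (List.replicate 4 .x ++ List.replicate 13 .y))
  | 4 => List.replicate 31 .x
  | _ => List.replicate 31 .y

/-- The definitions of an enumeration of the cosets of `⟨x⟩`. -/
def definitions : List ℕ := [
  2, 0, 2, 10, 2, 2, 0, 0, 0, 3, 4, 0, 0, 27, 3, 3, 3, 3, 3, 3, 3, 62, 0, 3, 3, 3, 3, 0, 0, 0, 28,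
  0, 3, 3, 3, 3, 3, 3, 3, 3, 3, 3, 3, 0, 0, 2, 2, 2, 2, 2, 2, 2, 2, 2, 2, 2, 2, 0, 0, 7, 3, 3,
  120, 2, 2, 2, 2, 2, 2, 2, 2, 2, 2, 2, 2, 2, 0, 0, 0, 64, 0, 0, 0, 0, 0, 0, 0, 0, 0, 0, 0, 0, 0,
  0, 0, 0, 0, 0, 0, 0, 0, 0, 0, 0, 0, 334, 0, 3, 3, 3, 3, 3, 3, 3, 3, 32, 0, 0, 0, 0, 0, 0, 0, 0,
  0, 0, 0, 0, 2, 51, 3, 3, 0, 7, 3, 3, 3, 3, 3, 3, 3, 0, 2, 2, 8, 2, 2, 2, 2, 2, 2, 2, 2, 0, 0,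
  10, 2, 2, 0, 0, 0, 14, 0, 0, 10, 2, 2, 2, 2, 2, 2, 2, 2, 2, 2, 2, 282, 0, 0, 0, 3, 3, 3, 3, 3,
  3, 3, 28, 0, 0, 0, 0, 0, 0, 2, 4, 0, 0, 0, 0, 3, 3, 3, 12, 0, 0, 0, 0, 0, 0, 0, 0, 0, 0, 0, 0,
  0, 0, 14, 2, 2, 166, 2, 2, 2, 2, 2, 2, 2, 2, 2, 2, 2, 2, 2, 2, 2, 2, 0, 0, 0, 2, 2, 2, 2, 2, 2,
  2, 2, 2, 2, 2, 44, 0, 0, 0, 0, 0, 0, 0, 0, 0, 0, 0, 0, 0, 0, 0, 0, 0, 0, 0, 382, 0, 0, 0, 0, 0,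
  0, 0, 0, 0, 0, 0, 0, 39, 3, 3, 3, 3, 3, 3, 3, 3, 3, 78, 2, 2, 2, 2, 2, 2, 24, 0, 0, 10, 2, 2, 2,
  2, 2, 2, 2, 2, 2, 2, 0, 0, 10, 2, 2, 194, 0, 0, 0, 0, 2, 2, 2, 2, 2, 2, 2, 2, 2, 2, 2, 2, 2, 0,
  0, 0, 64, 0, 0, 0, 2, 4, 0, 0, 0, 0, 0, 0, 0, 0, 0, 0, 0, 0, 0, 0, 0, 0, 0, 0, 0, 0, 0, 2, 2, 2,
  2, 2, 2, 2, 218, 0, 0, 0, 0, 0, 0, 0, 0, 0, 2, 2, 2, 2, 2, 2, 2, 2, 2, 2, 2, 44, 0, 0, 0, 0, 0,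
  0, 0, 0, 0, 0, 0, 0, 0, 0, 0, 0, 0, 0, 0, 0, 2, 2, 2, 2, 2, 2, 2, 2, 2, 2, 2, 2, 0, 6, 2, 210,
  2, 2, 2, 2, 2, 2, 2, 2, 2, 2, 2, 2, 0, 0, 0, 6, 2, 2, 2, 2, 2, 2, 2, 2, 2, 0, 0, 0, 0, 0, 0, 0,
  0, 0, 0, 0, 0, 0, 0, 0, 0, 0, 0, 0, 0, 0, 0, 0, 0, 0, 0, 0, 438, 0, 3, 4, 3, 3, 3, 3, 3, 3, 3,
  3, 3, 3, 40, 2, 7, 3, 3, 3, 3, 3, 3, 3, 36, 0, 0, 0, 0, 0, 0, 0, 0, 0, 0, 0, 0, 0, 0, 0, 0, 0,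
  70, 2, 2, 2, 2, 2, 2, 2, 2, 2, 2, 2, 0, 0, 3, 3, 3, 3, 18, 2, 2, 2, 2, 2, 2, 2, 2, 2, 2, 60, 2,
  2, 2, 2, 2, 2, 2, 2, 2, 2, 2, 2, 2, 0, 3, 4, 2, 2, 2, 76, 0, 0, 0, 0, 0, 0, 0, 0, 0, 0, 0, 0, 0,
  0, 0, 0, 0, 0, 0, 0, 0, 0, 0, 458, 0, 0, 0, 0, 0, 0, 10, 2, 2, 2, 2, 2, 2, 2, 2, 2, 2, 59, 3, 3,
  3, 3, 3, 3, 3, 3, 3, 32, 0, 0, 0, 11, 3, 3, 3, 3, 3, 34, 2, 0, 6, 2, 2, 2, 178, 0, 0, 0, 2, 0,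
  11, 3, 3, 3, 38, 0, 0, 0, 3, 3, 3, 3, 3, 3, 3, 3, 32, 2, 2, 2, 2, 0, 0, 0, 0, 0, 0, 0, 0, 0, 0,
  0, 0, 50, 2, 2, 2, 2, 2, 2, 2, 0, 0, 3, 3, 3, 3, 3, 3, 24, 0, 0, 0, 0, 0, 0, 0, 0, 0, 0, 0, 0,
  0, 234, 0, 0, 0, 0, 0, 22, 0, 0, 0, 0, 2, 2, 2, 2, 2, 35, 3, 3, 3, 3, 3, 3, 3, 3, 3, 78, 0, 0,
  0, 0, 0, 0, 0, 0, 0, 0, 0, 0, 50, 0, 3, 3, 3, 3, 3, 3, 3, 24, 3, 3, 3, 3, 3, 3, 3, 3, 3, 3, 3,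
  44, 2, 2, 2, 2, 2, 2, 2, 2, 2, 2, 2, 124, 3, 3, 0, 2, 4, 0, 2, 2, 2, 2, 16, 0, 0, 0, 0, 0, 0,
  68, 3, 3, 3, 3, 3, 3, 3, 3, 3, 3, 40, 2, 2, 2, 2, 16, 0, 3, 3, 3, 3, 3, 3, 3, 28, 2, 2, 2, 2, 2,
  2, 2, 2, 2, 2, 40, 0, 0, 0, 0, 0, 0, 0, 0, 0, 0, 0, 0, 0, 0, 0, 410, 0, 0, 0, 2, 2, 2, 2, 2, 2,
  2, 31, 3, 3, 3, 3, 3, 3, 3, 3, 64, 2, 2, 2, 2, 2, 2, 2, 2, 2, 2, 4, 126, 0, 0, 10, 0, 0, 0, 0,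
  2, 2, 2, 19, 3, 3, 3, 3, 3, 3, 3, 3, 3, 70, 0, 0, 0, 3, 3, 22, 0, 3, 3, 3, 3, 3, 3, 3, 3, 3, 3,
  0, 44, 0, 0, 0, 0, 0, 14, 2, 2, 2, 2, 2, 98, 0, 0, 0, 0, 2, 0, 0, 6, 2, 2, 2, 2, 2, 2, 2, 2, 2,
  0, 0, 0, 82, 0, 0, 0, 3, 3, 8, 2, 2, 2, 2, 2, 2, 2, 2, 2, 2, 2, 0, 0, 3, 3, 3, 3, 3, 3, 3, 3, 3,
  36, 2, 2, 2, 2, 2, 2, 2, 2, 2, 2, 158, 0, 3, 3, 3, 3, 3, 3, 3, 3, 3, 3, 0, 44, 0, 0, 2, 2, 2, 2,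
  2, 2, 2, 2, 2, 2, 2, 2, 110, 2, 0, 0, 10, 0, 0, 0, 0, 2, 2, 2, 2, 2, 2, 2, 2, 2, 39, 3, 3, 3, 3,
  3, 3, 3, 3, 3, 76, 0, 0, 0, 0, 0, 0, 0, 0, 0, 0, 0, 0, 0, 0, 0, 0, 2, 4, 0, 2, 4, 0, 0, 0, 0,
  191, 0, 0, 0, 0, 0, 0, 10, 2, 2, 2, 2, 2, 51, 3, 0, 2, 4, 2, 4, 3, 27, 3, 3, 3, 3, 0, 2, 2, 15,
  3, 3, 0, 0, 2, 52, 0, 0, 3, 4, 2, 2, 2, 12, 0, 0, 0, 0, 0, 0, 0, 0, 0, 0, 0, 0, 0, 0, 0, 0, 0,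
  0, 0, 0, 0, 0, 0, 466, 0, 0, 0, 0, 0, 0, 0, 0, 0, 0, 0, 0, 0, 0, 0, 0, 0, 0, 0, 0, 0, 0, 0, 0,
  0, 0, 0, 0, 106, 2, 2, 2, 2, 2, 0, 0, 0, 3, 3, 3, 12, 0, 0, 0, 0, 0, 0, 0, 0, 0, 0, 0, 0, 0, 0,
  0, 0, 0, 0, 0, 0, 0, 0, 0, 0, 126, 2, 2, 2, 0, 6, 0, 0, 0, 3, 3, 3, 3, 3, 3, 24, 2, 2, 2, 2, 2,
  20, 0, 0, 0, 0, 0, 0, 90, 2, 0, 0, 0, 16, 0, 0, 3, 3, 3, 3, 3, 3, 3, 3, 3, 3, 40, 0, 0, 0, 14,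
  2, 2, 2, 2, 2, 2, 2, 2, 2, 499, 3, 3, 3, 0, 0, 0, 0, 2, 2, 2, 2, 2, 2, 2, 2, 2, 2, 40, 0, 0, 0,
  0, 3, 4, 0, 0, 0, 0, 0, 0, 0, 2, 4, 0, 0, 0, 0, 0, 0, 0, 0, 155, 0, 0, 2, 15, 3, 0, 0, 2, 4, 0,
  2, 2, 2, 2, 39, 0, 7, 3, 3, 0, 0, 6, 2, 2, 2, 84, 0, 0, 3, 3, 8, 0, 0, 0, 0, 0, 0, 26, 0, 0, 10,
  2, 2, 2, 2, 2, 2, 2, 360, 0, 2, 7, 0, 0, 0, 0, 0, 23, 3, 3, 3, 3, 3, 3, 3, 3, 3, 0, 0, 2, 2, 2,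
  2, 2, 2, 2, 2, 2, 2, 2, 2, 124, 2, 2, 2, 2, 2, 2, 2, 2, 2, 2, 2, 2, 2, 0, 0, 0, 2, 2, 2, 76, 2,
  2, 2, 2, 2, 2, 2, 2, 2, 0, 40, 0, 0, 0, 0, 0, 0, 0, 0, 0, 0, 0, 0, 0, 0, 0, 0, 0, 0, 0, 0, 0, 0,
  0, 0, 2, 2, 2, 2, 2, 2, 2, 2, 2, 2, 263, 3, 3, 3, 3, 3, 3, 3, 3, 3, 36, 0, 0, 2, 2, 2, 2, 2, 2,
  2, 2, 2, 2, 2, 2, 48, 0, 0, 0, 0, 0, 0, 0, 0, 0, 0, 0, 0, 0, 0, 0, 0, 0, 0, 0, 0, 0, 0, 0, 0, 0]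

/-- The scans of an enumeration of the cosets of `⟨x⟩`. -/
def scans : List (ℕ × ℕ × ℕ) := [
  (902, 1, 1), (286, 1, 1), (0, 5, 0), (1347, 0, 0), (274, 0, 0), (968, 1, 1), (544, 1, 1),
  (1032, 3, 4), (177, 4, 0), (662, 1, 1), (825, 1, 1), (917, 3, 4), (944, 0, 0), (322, 4, 0),
  (870, 1, 1), (984, 1, 1), (1115, 1, 1), (742, 2, 3), (1255, 1, 1), (1350, 1, 1), (504, 1, 1),
  (448, 0, 0), (34, 1, 1), (1031, 3, 4), (1035, 1, 1), (78, 0, 0), (621, 1, 1), (722, 2, 3),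
  (647, 2, 3), (44, 0, 0), (766, 1, 1), (1152, 0, 2), (377, 4, 0), (341, 0, 0), (1469, 1, 1),
  (858, 3, 4), (1228, 1, 1), (1378, 1, 1), (22, 4, 0), (808, 1, 1), (1279, 1, 1), (1, 4, 0),
  (417, 0, 0), (602, 2, 3), (4, 0, 1), (142, 0, 0), (368, 0, 0), (1248, 2, 0), (1223, 1, 1),
  (487, 2, 3), (758, 1, 1), (1154, 1, 2), (1249, 0, 0), (1182, 0, 1), (755, 3, 4), (104, 0, 0),
  (1340, 0, 0), (1372, 1, 1), (1178, 2, 0), (77, 2, 0), (1181, 4, 0), (2, 1, 0), (653, 1, 2),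
  (143, 0, 1), (1177, 3, 0), (2, 5, 0), (491, 1, 1), (1117, 0, 0), (1179, 0, 0), (654, 0, 0),
  (789, 1, 1), (217, 0, 0), (342, 1, 0), (147, 0, 1), (1184, 0, 1), (1116, 4, 0), (857, 3, 0),
  (1084, 2, 0), (1180, 0, 0), (1036, 3, 16), (420, 0, 1), (1422, 1, 2), (649, 0, 0), (693, 0, 2),
  (74, 1, 1), (449, 1, 0), (1278, 1, 1), (1029, 1, 1), (692, 1, 1), (618, 1, 1), (1178, 0, 0),
  (342, 2, 13), (609, 5, 0), (5, 4, 0), (1083, 3, 0), (449, 2, 13), (1456, 0, 0), (1457, 0, 0),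
  (1084, 0, 0), (1155, 1, 2), (14, 1, 1), (445, 0, 2), (657, 2, 3), (1339, 5, 0), (867, 1, 1),
  (893, 3, 4), (539, 1, 1), (1003, 1, 1), (1033, 3, 16), (619, 1, 1), (105, 0, 0), (540, 0, 2),
  (1371, 4, 0), (1369, 3, 16), (1467, 1, 1), (1085, 1, 1), (459, 1, 1), (815, 0, 1), (1157, 1, 2),
  (1176, 0, 0), (1280, 1, 1), (543, 1, 1), (1109, 5, 0), (876, 0, 1), (790, 1, 1), (1183, 0, 1),
  (1417, 0, 0), (1388, 0, 0), (601, 0, 0), (1049, 1, 1), (218, 0, 0), (1468, 1, 1), (1185, 4, 0),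
  (1518, 0, 0), (1517, 0, 0), (1159, 1, 2), (369, 0, 0), (1161, 1, 2), (892, 0, 0), (1433, 1, 2),
  (605, 0, 0), (1163, 1, 2), (1118, 0, 0), (1249, 2, 11), (1165, 1, 2), (656, 1, 1), (613, 0, 2),
  (187, 0, 1), (1186, 1, 1), (186, 0, 2), (1248, 1, 0), (77, 5, 0), (603, 0, 0), (1162, 1, 0),
  (418, 1, 0), (489, 1, 1), (1160, 0, 0), (1341, 0, 0), (419, 0, 1), (1164, 1, 2), (503, 1, 1),
  (1389, 0, 0), (1166, 1, 2), (45, 0, 0), (1168, 1, 2), (650, 0, 0), (1250, 1, 2), (1171, 1, 2),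
  (1169, 0, 0), (859, 1, 2), (651, 0, 1), (1418, 0, 0), (145, 1, 0), (652, 1, 2), (302, 3, 4),
  (757, 1, 1), (658, 5, 0), (1173, 1, 2), (79, 0, 0), (1167, 0, 0), (141, 0, 0), (176, 1, 1),
  (146, 0, 1), (807, 1, 1), (811, 0, 2), (818, 0, 1), (765, 1, 1), (1175, 1, 2), (160, 0, 0),
  (174, 1, 1), (8, 3, 16), (759, 1, 1), (166, 3, 4), (316, 2, 3), (948, 1, 0), (1112, 0, 1),
  (787, 1, 1), (819, 0, 1), (1030, 0, 1), (964, 3, 16), (546, 5, 0), (157, 0, 2), (315, 1, 1),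
  (947, 3, 1), (305, 0, 1), (106, 1, 1), (946, 1, 2), (212, 1, 0), (872, 2, 4), (888, 2, 6),
  (211, 0, 0), (109, 1, 1), (101, 2, 0), (1174, 0, 0), (214, 1, 2), (301, 1, 1), (159, 0, 0),
  (216, 1, 2), (303, 0, 0), (1159, 1, 1), (1156, 0, 0), (877, 3, 3), (539, 0, 0), (1085, 1, 2),
  (963, 2, 2), (1107, 2, 3), (1279, 0, 0), (537, 1, 1), (1337, 0, 2), (1106, 1, 1), (536, 1, 1),
  (1336, 1, 0), (548, 0, 1), (1099, 1, 1), (1082, 0, 0), (608, 1, 0), (1005, 1, 2), (1387, 3, 5),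
  (1103, 4, 0), (367, 2, 0), (547, 0, 1), (365, 0, 0), (814, 0, 1), (607, 0, 0), (366, 1, 0),
  (1121, 1, 1), (462, 0, 1), (717, 1, 2), (1108, 1, 1), (460, 0, 0), (1101, 0, 1), (183, 0, 2),
  (182, 0, 1), (791, 1, 2), (173, 3, 5), (179, 0, 0), (1456, 2, 1), (170, 1, 1), (953, 0, 1),
  (794, 1, 1), (1339, 3, 2), (168, 3, 4), (153, 0, 2), (21, 0, 1), (957, 2, 3), (152, 1, 2),
  (796, 3, 2), (16, 1, 1), (188, 1, 2), (152, 0, 2), (169, 2, 1), (230, 2, 5), (229, 1, 1),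
  (230, 1, 1), (979, 2, 4), (167, 1, 1), (614, 4, 0), (861, 1, 2), (803, 2, 0), (211, 2, 1),
  (238, 0, 1), (208, 2, 1), (896, 2, 4), (103, 0, 1), (111, 1, 1), (794, 3, 15), (552, 1, 1),
  (894, 0, 0), (978, 1, 1), (992, 3, 5), (558, 1, 2), (255, 3, 14), (1002, 1, 1), (1351, 5, 0),
  (1366, 3, 4), (27, 5, 0), (802, 0, 0), (416, 2, 0), (55, 2, 3), (110, 0, 2), (916, 1, 1),
  (433, 3, 4), (905, 0, 2), (961, 0, 0), (579, 1, 2), (554, 2, 2), (530, 0, 1), (175, 1, 1),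
  (168, 1, 1), (1366, 3, 5), (529, 0, 1), (553, 1, 1), (531, 0, 1), (506, 1, 1), (1466, 1, 1),
  (569, 2, 3), (505, 1, 1), (447, 0, 0), (338, 0, 2), (936, 0, 2), (555, 0, 1), (223, 1, 1),
  (551, 1, 1), (454, 2, 3), (556, 0, 2), (226, 0, 1), (799, 1, 0), (1150, 2, 0), (578, 0, 0),
  (1000, 1, 1), (457, 2, 3), (274, 3, 5), (1148, 1, 0), (1515, 0, 0), (1191, 1, 1), (740, 3, 4),
  (718, 1, 2), (463, 3, 5), (1147, 0, 0), (1187, 1, 0), (543, 0, 0), (1516, 1, 0), (600, 0, 0),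
  (1514, 0, 0), (741, 3, 4), (1102, 1, 1), (1002, 0, 0), (452, 1, 1), (185, 1, 1), (739, 3, 3),
  (561, 1, 1), (565, 4, 0), (300, 1, 1), (455, 3, 4), (599, 0, 0), (221, 0, 1), (453, 0, 2),
  (456, 2, 1), (741, 1, 0), (775, 3, 1), (1217, 0, 0), (1123, 1, 1), (998, 1, 1), (1000, 1, 2),
  (275, 1, 0), (44, 2, 0), (165, 1, 1), (775, 0, 0), (997, 1, 1), (139, 2, 4), (145, 3, 1),
  (222, 1, 1), (100, 3, 0), (595, 0, 0), (954, 2, 3), (447, 2, 0), (769, 3, 3), (51, 2, 4),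
  (181, 1, 1), (1385, 1, 1), (463, 1, 1), (774, 1, 1), (890, 0, 1), (1410, 0, 2), (140, 0, 1),
  (617, 1, 1), (220, 1, 1), (1470, 3, 4), (659, 1, 2), (1105, 1, 2), (1190, 1, 1), (507, 1, 1),
  (319, 2, 1), (138, 1, 2), (255, 1, 1), (797, 1, 1), (59, 0, 0), (798, 0, 2), (763, 3, 4),
  (444, 1, 1), (225, 0, 1), (144, 2, 2), (52, 0, 1), (901, 1, 1), (862, 2, 1), (149, 3, 4),
  (340, 0, 0), (57, 2, 4), (667, 1, 1), (143, 1, 1), (1403, 1, 1), (864, 0, 0), (51, 0, 1),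
  (785, 2, 4), (567, 1, 1), (1423, 0, 1), (52, 2, 4), (1324, 2, 4), (72, 2, 3), (372, 0, 1),
  (1476, 2, 2), (1405, 2, 1), (1049, 1, 2), (864, 4, 0), (1052, 1, 1), (785, 1, 1), (761, 0, 0),
  (428, 2, 3), (485, 2, 1), (875, 0, 1), (817, 1, 2), (76, 2, 5), (230, 2, 3), (287, 1, 1),
  (1105, 2, 1), (483, 2, 2), (1382, 0, 1), (1281, 1, 1), (1431, 2, 3), (784, 0, 1), (1342, 0, 2),
  (1379, 1, 1), (164, 0, 0), (71, 0, 2), (865, 1, 1), (546, 2, 3), (442, 1, 1), (1438, 0, 0),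
  (1130, 1, 2), (477, 3, 0), (1089, 1, 2), (743, 0, 0), (478, 1, 0), (986, 1, 1), (1380, 3, 3),
  (43, 0, 0), (33, 2, 3), (306, 0, 1), (120, 0, 0), (378, 0, 0), (574, 0, 0), (824, 1, 1),
  (204, 0, 0), (201, 1, 1), (628, 3, 3), (480, 0, 0), (1051, 1, 1), (550, 0, 2), (193, 0, 0),
  (371, 0, 0), (340, 3, 2), (805, 1, 2), (374, 0, 0), (1048, 2, 4), (475, 2, 0), (1216, 3, 0),
  (1360, 0, 0), (1151, 0, 0), (381, 3, 5), (57, 1, 1), (1364, 1, 1), (1472, 1, 1), (610, 1, 1),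
  (446, 3, 3), (968, 2, 3), (443, 1, 1), (1214, 0, 0), (1442, 0, 0), (1324, 1, 1), (1080, 0, 0),
  (958, 0, 2), (873, 0, 1), (903, 3, 4), (1041, 0, 1), (432, 1, 1), (1458, 0, 2), (308, 2, 2),
  (367, 0, 0), (1432, 1, 0), (75, 1, 1), (131, 2, 4), (1459, 0, 1), (430, 1, 1), (888, 0, 2),
  (754, 1, 2), (1029, 0, 0), (194, 0, 0), (278, 1, 0), (1078, 0, 0), (1471, 0, 2), (1091, 0, 0),
  (1061, 1, 2), (630, 0, 0), (1113, 0, 1), (474, 0, 0), (1464, 1, 1), (18, 1, 1), (1121, 3, 8),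
  (108, 0, 2), (1027, 1, 1), (1060, 1, 0), (325, 0, 1), (634, 1, 2), (629, 1, 1), (872, 0, 1),
  (1399, 2, 3), (273, 0, 2), (321, 2, 4), (732, 2, 3), (69, 0, 1), (321, 1, 1), (939, 0, 1),
  (413, 2, 0), (252, 2, 3), (119, 1, 2), (26, 3, 4), (1398, 1, 2), (641, 3, 1), (545, 1, 1),
  (148, 1, 1), (238, 0, 0), (82, 1, 2), (19, 0, 1), (1473, 1, 1), (111, 2, 2), (14, 0, 0),
  (637, 1, 1), (1213, 0, 0), (1323, 0, 1), (768, 2, 3), (644, 0, 0), (972, 2, 2), (860, 1, 2),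
  (363, 3, 1), (835, 0, 1), (10, 1, 1), (353, 0, 0), (1066, 1, 2), (1512, 2, 0), (868, 2, 2),
  (103, 0, 0), (28, 1, 0), (118, 1, 2), (1213, 2, 0), (1343, 0, 1), (203, 1, 1), (1335, 1, 1),
  (1460, 0, 1), (566, 0, 1), (642, 1, 0), (1378, 0, 2), (421, 0, 1), (669, 1, 2), (474, 0, 1),
  (668, 1, 1), (1367, 3, 4), (1474, 1, 1), (1393, 1, 1), (1125, 0, 1), (639, 1, 1), (81, 1, 0),
  (735, 3, 4), (1394, 1, 1), (320, 1, 1), (646, 2, 4), (1461, 2, 2), (412, 1, 0), (31, 0, 0),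
  (896, 1, 1), (648, 1, 2), (1345, 0, 1), (841, 2, 4), (840, 1, 1), (309, 0, 2), (1463, 1, 1),
  (427, 1, 1), (843, 1, 0), (956, 0, 2), (1079, 2, 12), (225, 3, 4), (733, 1, 1), (841, 0, 2),
  (350, 3, 0), (323, 1, 0), (486, 0, 0), (352, 0, 0), (949, 0, 0), (981, 3, 9), (938, 0, 1),
  (1075, 3, 0), (132, 1, 1), (1381, 0, 2), (1069, 1, 0), (441, 1, 1), (1147, 2, 0), (1368, 1, 1),
  (363, 0, 0), (1401, 0, 1), (353, 2, 11), (716, 1, 1), (1023, 1, 1), (99, 2, 0), (1511, 0, 0),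
  (30, 0, 0), (173, 1, 1), (150, 2, 1), (137, 0, 1), (1361, 3, 1), (1024, 1, 1), (73, 1, 1),
  (573, 0, 2), (970, 1, 1), (414, 0, 0), (1212, 0, 0), (238, 2, 12), (101, 3, 6), (191, 2, 0),
  (916, 0, 0), (845, 1, 0), (609, 2, 2), (1127, 2, 2), (843, 2, 7), (1211, 0, 0), (195, 2, 4),
  (1338, 1, 1), (1400, 0, 1), (97, 0, 0), (929, 0, 0), (570, 0, 2), (846, 1, 2), (357, 2, 4),
  (1398, 1, 1), (828, 3, 4), (376, 2, 6), (1222, 0, 0), (1199, 1, 2), (1079, 0, 1), (112, 1, 1),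
  (1251, 1, 2), (1145, 3, 1), (472, 0, 0), (202, 1, 1), (466, 1, 2), (1408, 2, 3), (171, 2, 3),
  (697, 1, 1), (966, 2, 4), (13, 1, 2), (1356, 2, 13), (837, 0, 0), (311, 2, 3), (425, 2, 3),
  (882, 0, 1), (1454, 1, 0), (493, 2, 3), (140, 0, 2), (99, 2, 3), (535, 2, 2), (498, 2, 4),
  (839, 1, 1), (985, 1, 1), (928, 3, 0), (1145, 0, 0), (1142, 0, 0), (856, 2, 1), (623, 1, 1),
  (499, 3, 4), (431, 0, 0), (1327, 1, 2), (408, 3, 2), (666, 1, 1), (928, 2, 4), (404, 2, 0),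
  (1005, 1, 1), (1076, 0, 1), (397, 2, 3), (1508, 3, 0), (1436, 1, 2), (472, 0, 1), (829, 0, 2),
  (383, 0, 0), (850, 3, 1), (1074, 0, 0), (935, 1, 2), (90, 0, 0), (1007, 1, 1), (1438, 2, 12),
  (1074, 2, 5), (753, 1, 2), (941, 3, 3), (832, 0, 1), (933, 1, 2), (834, 1, 1), (830, 1, 1),
  (498, 0, 2), (1019, 2, 1), (1374, 5, 0), (325, 1, 2), (386, 0, 0), (594, 0, 0), (191, 3, 11),
  (920, 3, 5), (1227, 0, 2), (920, 2, 3), (60, 0, 2), (993, 1, 1), (626, 1, 1), (1048, 1, 1),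
  (1421, 1, 1), (1328, 2, 11), (1442, 2, 5), (557, 0, 2), (919, 0, 2), (1009, 1, 1), (926, 2, 3),
  (468, 3, 1), (294, 2, 3), (1477, 0, 1), (827, 0, 2), (1359, 0, 0), (70, 3, 1), (979, 2, 3),
  (349, 0, 0), (930, 1, 2), (1328, 3, 3), (1198, 0, 0), (395, 1, 1), (122, 3, 9), (1420, 1, 1),
  (114, 1, 1), (1229, 3, 4), (923, 3, 4), (291, 2, 3), (886, 3, 4), (509, 2, 1), (426, 2, 3),
  (1506, 2, 1), (1235, 3, 1), (305, 1, 2), (307, 3, 4), (280, 1, 2), (134, 2, 1), (408, 0, 0),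
  (932, 3, 8), (884, 2, 1), (249, 3, 4), (56, 0, 1), (1357, 1, 0), (848, 0, 0), (393, 1, 1),
  (611, 1, 1), (409, 1, 0), (135, 1, 1), (898, 0, 2), (374, 2, 2), (1232, 1, 1), (577, 2, 9),
  (318, 1, 0), (1011, 1, 1), (318, 2, 10), (848, 2, 0), (1491, 2, 3), (112, 1, 2), (928, 1, 1),
  (804, 3, 5), (251, 1, 1), (1232, 3, 5), (425, 1, 1), (36, 2, 3), (847, 3, 6), (162, 1, 1),
  (61, 3, 4), (1481, 3, 16), (645, 1, 1), (1492, 0, 2), (423, 2, 2), (907, 1, 1), (1333, 1, 1),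
  (115, 1, 1), (673, 3, 3), (248, 3, 1), (35, 4, 0), (317, 1, 0), (906, 1, 1), (889, 0, 0),
  (1503, 0, 0), (195, 1, 1), (510, 2, 3), (885, 2, 2), (687, 3, 4), (1142, 2, 1), (1506, 0, 0),
  (1146, 0, 0), (915, 1, 1), (675, 0, 0), (900, 3, 4), (693, 3, 5), (1462, 3, 1), (1013, 1, 1),
  (1021, 3, 5), (385, 0, 0), (908, 0, 1), (1508, 1, 1), (1259, 0, 2), (821, 0, 1), (470, 1, 0),
  (922, 1, 1), (376, 1, 1), (1478, 0, 0), (470, 2, 0), (27, 2, 1), (389, 1, 1), (289, 3, 5),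
  (502, 4, 0), (1501, 2, 1), (1286, 2, 1), (431, 2, 4), (269, 3, 0), (624, 3, 1), (271, 0, 0),
  (1490, 3, 4), (575, 0, 1), (429, 4, 0), (1139, 2, 1), (899, 0, 1), (83, 1, 0), (1011, 1, 2),
  (272, 0, 0), (1124, 1, 0), (1424, 2, 1), (1334, 2, 3), (266, 2, 1), (672, 3, 1), (1245, 0, 0),
  (1498, 0, 0), (1254, 3, 4), (1123, 1, 0), (1297, 0, 0), (1350, 1, 0), (1234, 0, 2),
  (1267, 5, 0), (1257, 2, 3), (128, 1, 0), (573, 1, 2), (1205, 2, 0), (691, 1, 1), (727, 0, 1),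
  (1263, 0, 1), (850, 0, 0), (1359, 2, 4), (1256, 0, 1), (508, 4, 0), (1349, 0, 2), (514, 0, 0),
  (468, 0, 0), (42, 0, 1), (297, 1, 1), (203, 1, 2), (257, 5, 0), (500, 1, 1), (1233, 3, 10),
  (1201, 3, 14), (1277, 2, 4), (344, 1, 2), (1015, 0, 0), (736, 0, 2), (261, 3, 0), (1465, 3, 3),
  (577, 1, 1), (674, 0, 0), (923, 1, 1), (1288, 2, 2), (6, 4, 0), (1295, 2, 4), (962, 0, 0),
  (714, 0, 0), (258, 0, 0), (1127, 0, 0), (390, 1, 1), (387, 0, 1), (129, 0, 2), (690, 1, 1),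
  (1130, 1, 1), (1135, 0, 0), (1409, 1, 1), (626, 2, 4), (987, 1, 1), (1192, 0, 1), (439, 3, 2),
  (1301, 3, 14), (1406, 3, 3), (423, 2, 4), (737, 1, 1), (1014, 2, 1), (292, 0, 1), (126, 0, 0),
  (76, 1, 1), (1294, 3, 4), (1497, 3, 0), (1096, 1, 1), (714, 2, 0), (568, 0, 2), (1474, 0, 2),
  (1255, 2, 3), (25, 1, 1), (712, 0, 0), (712, 2, 9), (38, 1, 1), (1497, 2, 13), (1475, 2, 1),
  (37, 1, 1), (1441, 3, 5), (1289, 3, 3), (1258, 0, 1), (1156, 2, 4), (1261, 1, 1), (1014, 0, 0),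
  (921, 3, 5), (259, 0, 0), (40, 0, 1), (734, 3, 4), (729, 2, 1), (1133, 0, 0), (528, 0, 0),
  (1092, 2, 1), (738, 1, 1), (515, 1, 2), (1499, 0, 0), (1358, 1, 1), (644, 0, 1), (1451, 0, 0),
  (1376, 3, 0), (1285, 3, 5), (1097, 0, 2), (731, 3, 3), (731, 0, 0), (646, 2, 3), (1377, 2, 5),
  (193, 3, 1), (141, 0, 1), (1276, 1, 1), (1290, 3, 4), (1021, 1, 1), (41, 2, 3), (1287, 0, 2),
  (262, 3, 0), (726, 0, 0), (259, 2, 10), (695, 2, 4), (1040, 0, 1), (887, 1, 1), (1093, 2, 3),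
  (1430, 1, 1), (761, 1, 1), (696, 0, 2), (270, 3, 11), (1133, 3, 1), (1292, 3, 4), (571, 1, 1),
  (925, 0, 1), (39, 2, 2), (43, 2, 2), (1238, 1, 1), (267, 0, 0), (282, 1, 0), (1301, 0, 2),
  (518, 1, 1), (1094, 3, 4), (1432, 2, 4), (348, 0, 0), (349, 2, 1), (62, 1, 1), (988, 2, 3),
  (838, 2, 3), (686, 4, 0), (1295, 1, 1), (701, 2, 3), (991, 0, 2), (1427, 4, 0), (1496, 2, 0),
  (639, 1, 2), (989, 1, 1), (940, 0, 2), (282, 1, 1), (1048, 0, 0), (720, 0, 0), (250, 3, 1),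
  (959, 3, 1), (299, 4, 0), (1293, 2, 1), (1392, 2, 3), (527, 0, 0), (1022, 0, 2), (1493, 1, 2),
  (347, 3, 1), (1291, 3, 3), (820, 3, 3), (285, 0, 0), (85, 2, 6), (313, 0, 2), (1058, 3, 2),
  (527, 2, 13), (298, 0, 1), (837, 1, 1), (1274, 2, 2), (1503, 2, 4), (1275, 2, 3), (1277, 0, 2),
  (924, 3, 3), (627, 1, 1), (285, 2, 1), (1332, 2, 3), (312, 0, 2), (1309, 1, 0), (1307, 3, 16),
  (1054, 3, 2), (1362, 3, 1), (310, 2, 1), (1044, 0, 2), (1513, 0, 0), (1055, 3, 2), (1042, 2, 3),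
  (24, 3, 4), (715, 2, 11), (528, 2, 4), (314, 3, 4), (62, 3, 13), (1363, 3, 3), (1319, 3, 0),
  (10, 3, 7), (1308, 0, 0), (1095, 3, 1), (1312, 1, 0), (1315, 1, 0), (719, 1, 0), (713, 3, 14),
  (1310, 1, 1)]

set_option maxRecDepth 1000000 in
theorem check_eq_true : Table.check relator definitions scans 1519 1056 = true := by
  decide +kernel

section UpperBound

variable {G : Type*} [Group G]

/-- The value of a letter in a group with two chosen elements. -/
def Letter.eval (x y : G) : Letter → G
  | .x => x
  | .xInv => x⁻¹
  | .y => y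
  | .yInv => y⁻¹

theorem Letter.eval_inv (x y : G) (l : Letter) : l.inv.eval x y = (l.eval x y)⁻¹ := by
  cases l <;> simp [Letter.eval, Letter.inv]

theorem foldl_eval_smul {X : Type*} [MulAction G X] (x y : G) (w : List Letter) (p : X) :
    w.foldl (fun p l => (l.eval x y)⁻¹ • p) p = (w.map (Letter.eval x y)).prod⁻¹ • p := by
  induction w generalizing p with
  | nil => simp
  | cons l w ih => simp [ih, mul_smul]

/-- A closed coset enumeration over `⟨x⟩` bounds the order of a group generated by `x` and `y`. -/
theorem card_le_of_check {x y : G} (hxy : Subgroup.closure {x, y} = ⊤)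
    {rels : ℕ → List Letter} {cs : List ℕ} {ss : List (ℕ × ℕ × ℕ)} {N b n : ℕ}
    (h : Table.check rels cs ss N b = true)
    (hrels : ∀ i, ((rels i).map (Letter.eval x y)).prod = 1) (hn : 0 < n) (hx : x ^ n = 1) :
    Finite G ∧ Nat.card G ≤ b * n := by
  obtain ⟨S, hS, h1, hS'⟩ := Table.exists_invariant_of_check
    (γ := fun l (p : G ⧸ Subgroup.zpowers x) => (l.eval x y)⁻¹ • p) (p := ((1 : G) : G ⧸ _)) h
    (by simp [Letter.eval_inv])
    (fun i j p => by
      rw [foldl_eval_smul, List.map_append, List.prod_append, mul_eq_one_symm, inv_one, one_smul]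
      rw [← List.prod_append, ← List.map_append, List.take_append_drop, hrels])
    (by
      rw [MulAction.Quotient.smul_coe, smul_eq_mul, mul_one, QuotientGroup.eq]
      simp [Letter.eval])
  have hg : ∀ g : G, ∀ q ∈ S, g • q ∈ S ∧ g⁻¹ • q ∈ S := by
    intro g
    have hg : g ∈ Subgroup.closure {x, y} := hxy ▸ Subgroup.mem_top g
    induction hg using Subgroup.closure_induction with
    | mem g hg =>
      intro q hq
      obtain rfl | rfl := hg
      · exact ⟨by simpa [Letter.eval] using hS' q hq .xInv, hS' q hq .x⟩
      · exact ⟨by simpa [Letter.eval] using hS' q hq .yInv, hS' q hq .y⟩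
    | one => simp
    | mul g h _ _ hg hh =>
      intro q hq
      rw [mul_smul, mul_inv_rev, mul_smul]
      exact ⟨(hg _ (hh q hq).1).1, (hh _ (hg q hq).2).2⟩
    | inv g _ hg =>
      intro q hq
      rw [inv_inv]
      exact (hg q hq).symm
  have huniv : S = Set.univ := by
    refine Set.eq_univ_of_forall fun q => ?_
    obtain ⟨g, rfl⟩ := QuotientGroup.mk_surjective q
    simpa using (hg g _ h1).1
  rw [huniv, Set.encard_univ] at hS
  have hfin : Finite (G ⧸ Subgroup.zpowers x) := by
    rw [← ENat.card_lt_top]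
    exact hS.trans_lt (ENat.natCast_lt_top b)
  rw [ENat.card_eq_coe_natCard, Nat.cast_le] at hS
  have hcard := Subgroup.card_eq_card_quotient_mul_card_subgroup (Subgroup.zpowers x)
  rw [Nat.card_zpowers] at hcard
  refine ⟨Nat.finite_of_card_ne_zero ?_, ?_⟩
  · rw [hcard]
    exact mul_ne_zero Nat.card_pos.ne' (isOfFinOrder_iff_pow_eq_one.mpr ⟨n, hn, hx⟩).orderOf_pos.ne'
  · rw [hcard]
    exact Nat.mul_le_mul hS (orderOf_le_of_pow_eq_one hn hx)

end UpperBound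

end CosetEnumeration

theorem card_le_of_relators {G : Type*} [Group G] (φ : FreeGroup (Fin 2) →* G)
    (hφ : Function.Surjective φ) (hrel : ∀ r ∈ Hrels, φ r = 1) :
    Finite G ∧ Nat.card G ≤ 1056 * 31 := by
  simp only [Hrels, Set.mem_insert_iff, Set.mem_singleton_iff, forall_eq_or_imp, forall_eq,
    map_pow, map_mul, map_zpow] at hrel
  obtain ⟨hx, hy, h1, h2, h3, h4⟩ := hrel
  refine CosetEnumeration.card_le_of_check (x := φ (.of 0)) (y := φ (.of 1)) ?_
    CosetEnumeration.check_eq_true ?_ (by norm_num) hx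
  · rw [← Subgroup.map_top_of_surjective φ hφ, ← FreeGroup.closure_range_of,
      MonoidHom.map_closure]
    congr 1
    ext g
    simp [Fin.exists_fin_two, eq_comm]
  · replace h3 : (φ (.of 0) ^ 3 * (φ (.of 1))⁻¹ ^ 11) ^ 2 = 1 := by
      rwa [inv_pow, ← zpow_natCast (φ (.of 1)), ← zpow_neg]
    rintro (_ | _ | _ | _ | _ | i) <;>
      simp only [CosetEnumeration.relator, List.map_append, List.map_replicate, List.prod_append,
        List.prod_replicate, List.map_cons, List.map_nil, List.prod_cons, List.prod_nil,
        CosetEnumeration.Letter.eval]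
    · simpa only [pow_two, mul_assoc, mul_one] using h1
    · simpa only [pow_two, mul_assoc, mul_one] using h2
    · rwa [← mul_assoc, ← pow_two]
    · rwa [← mul_assoc, ← pow_two]
    · exact hx
    · exact hy

section SL

open Matrix

theorem of_fin_two_congr {R : Type*} {p q r s p' q' r' s' : R} (hp : p = p') (hq : q = q')
    (hr : r = r') (hs : s = s') : !![p, q; r, s] = !![p', q'; r', s'] := by
  rw [hp, hq, hr, hs]

variable {F : Type*} [Field F]

theorem exists_pow_five_eq (hF : Nat.card F = 32) (h2 : (2 : F) = 0) :
    ∃ a : F, a ^ 5 = a ^ 2 + 1 := by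
  have : Finite F := Nat.finite_of_card_ne_zero (by simp [hF])
  have := Fintype.ofFinite F
  by_contra! h
  let q : Polynomial F := .X ^ 27 + .X ^ 24 + .X ^ 22 + .X ^ 21 + .X ^ 18 + .X ^ 17 + .X ^ 16 +
    .X ^ 15 + .X ^ 14 + .X ^ 10 + .X ^ 9 + .X ^ 7 + .X ^ 6 + .X ^ 5 + .X ^ 3 + .X
  have hq : q.natDegree = 27 := by
    unfold q
    compute_degree!
  have h0 : q = 0 := by
    refine Polynomial.eq_zero_of_natDegree_lt_card_of_eval_eq_zero q
      Function.injective_id (fun c => ?_) ?_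
    · have hc : c ^ 32 = c := by
        rw [← hF, Nat.card_eq_fintype_card]
        exact FiniteField.pow_card c
      have h5 : c ^ 5 + c ^ 2 + 1 ≠ 0 := fun h5 => h c (by grind)
      have : (c ^ 5 + c ^ 2 + 1) * q.eval c = 0 := by
        simp only [q, Polynomial.eval_add, Polynomial.eval_pow, Polynomial.eval_X]
        grind
      exact (mul_eq_zero.mp this).resolve_left h5
    · rw [hq, ← Nat.card_eq_fintype_card, hF]
      norm_num
  simp [h0] at hq

theorem card_SL_two [Finite F] (n : ℕ) (hn : (Nat.card F - 1) * n =
    (Nat.card F ^ 2 - 1) * (Nat.card F ^ 2 - Nat.card F)) :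
    n ≤ Nat.card (SpecialLinearGroup (Fin 2) F) := by
  have := Fintype.ofFinite F
  have hdet : Nat.card (GeneralLinearGroup.det : GL (Fin 2) F →* Fˣ).range = Nat.card F - 1 := by
    rw [MonoidHom.range_eq_top.mpr GeneralLinearGroup.det_surjective, Subgroup.card_top,
      Nat.card_units]
  have hker := Subgroup.card_mul_index (GeneralLinearGroup.det : GL (Fin 2) F →* Fˣ).ker
  rw [Subgroup.index_ker, hdet, Matrix.card_GL_field, Fin.prod_univ_two,
    ← Nat.card_eq_fintype_card] at hker
  simp only [Fin.val_zero, Fin.val_one, pow_zero, pow_one] at hker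
  rw [← hn, mul_comm] at hker
  have hpos : 0 < Nat.card F - 1 := Nat.sub_pos_of_lt Finite.one_lt_card
  rw [← Nat.eq_of_mul_eq_mul_left hpos hker]
  refine Nat.card_le_card_of_injective (fun g => ⟨g.1.1, ?_⟩) fun g h hgh => ?_
  · exact congr(($(g.2) : F))
  · exact Subtype.ext (Units.ext congr(($hgh).1))

/-- A transvection subgroup is generated by conjugates of one transvection. -/
theorem mem_of_forall_sq_mul {F : Type*} [Field F] (hF : Nat.card F = 32) {s : Set F} {u b : F}
    (h0 : 0 ∈ s) (hu : u ^ 2 ≠ 1) (hu0 : u ≠ 0) (hb : b ≠ 0) (hbs : b ∈ s)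
    (hs : ∀ c ∈ s, u ^ 2 * c ∈ s) (c : F) : c ∈ s := by
  obtain rfl | hc := eq_or_ne c 0
  · exact h0
  have : Fact (Nat.Prime 31) := ⟨by norm_num⟩
  have hcard : Nat.card Fˣ = 31 := by rw [Nat.card_units, hF]
  have hu' : (Units.mk0 (u ^ 2) (pow_ne_zero 2 hu0)) ≠ 1 := fun h => hu congr(($h : F))
  have := Nat.finite_of_card_ne_zero (α := Fˣ) (by simp [hcard])
  obtain ⟨k, hk⟩ := mem_powers_of_prime_card hcard hu' (g' := Units.mk0 (c / b) (div_ne_zero hc hb))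
  have hk' : (u ^ 2) ^ k * b = c := by
    have : (u ^ 2) ^ k = c / b := congr(($hk : F))
    rw [this, div_mul_cancel₀ c hb]
  rw [← hk']
  clear hk' hk
  induction k with
  | zero => simpa using hbs
  | succ k ih => simpa [pow_succ', mul_assoc] using hs _ ih

/-- The image of `x`. -/
def matX (a : F) : Matrix (Fin 2) (Fin 2) F := !![a, 0; 0, a ^ 4 + a]

/-- The image of `y`. -/
def matY (a : F) : Matrix (Fin 2) (Fin 2) F :=
  !![a ^ 4 + a ^ 3 + 1, 1; a ^ 3 + a ^ 2 + a, a ^ 3 + 1]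

variable {a : F} (h2 : (2 : F) = 0) (ha : a ^ 5 = a ^ 2 + 1)

include h2 ha

theorem det_matX : (matX a).det = 1 := by
  rw [matX, det_fin_two_of]
  grind

theorem det_matY : (matY a).det = 1 := by
  rw [matY, det_fin_two_of]
  grind

theorem matY_pow_two : matY a ^ 2 =
    !![a ^ 3, a ^ 4; a ^ 4 + a ^ 3 + a + 1, a ^ 2 + 1] := by
  rw [pow_two, matY, mul_fin_two]
  apply of_fin_two_congr <;> grind

theorem matY_pow_four : matY a ^ 4 =
    !![a ^ 2 + a, a ^ 3 + a ^ 2 + a; a ^ 4 + a ^ 3 + a ^ 2 + a, a ^ 4 + a ^ 3 + a ^ 2 + 1] := by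
  rw [pow_add _ 2 2, matY_pow_two h2 ha, mul_fin_two]
  apply of_fin_two_congr <;> grind

theorem matY_pow_eight : matY a ^ 8 =
    !![a ^ 4 + 1, a ^ 4 + a ^ 2 + a; a ^ 4 + a ^ 3 + a, a ^ 4 + a + 1] := by
  rw [pow_add _ 4 4, matY_pow_four h2 ha, mul_fin_two]
  apply of_fin_two_congr <;> grind

theorem matY_pow_sixteen : matY a ^ 16 =
    !![a ^ 2 + a, a ^ 3 + 1; a ^ 4 + 1, a] := by
  rw [pow_add _ 8 8, matY_pow_eight h2 ha, mul_fin_two]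
  apply of_fin_two_congr <;> grind

theorem matY_pow_six : matY a ^ 6 =
    !![a + 1, a ^ 4 + a ^ 3 + a ^ 2; a ^ 4 + a ^ 3 + 1, a ^ 4] := by
  rw [pow_add _ 4 2, matY_pow_four h2 ha, matY_pow_two h2 ha, mul_fin_two]
  apply of_fin_two_congr <;> grind

theorem matY_pow_eleven : matY a ^ 11 =
    !![a ^ 3 + a, a ^ 3 + a ^ 2 + a + 1; a ^ 4, 1] := by
  rw [pow_succ, pow_add _ 8 2, matY_pow_eight h2 ha, matY_pow_two h2 ha, matY,
    mul_fin_two, mul_fin_two]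
  apply of_fin_two_congr <;> grind

theorem matY_pow_thirteen : matY a ^ 13 =
    !![a ^ 4 + a ^ 2 + a + 1, a ^ 2 + a + 1; a ^ 3 + a ^ 2 + a + 1, a ^ 3] := by
  rw [pow_succ, pow_add _ 8 4, matY_pow_eight h2 ha, matY_pow_four h2 ha, matY,
    mul_fin_two, mul_fin_two]
  apply of_fin_two_congr <;> grind

theorem matY_pow_thirty_one : matY a ^ 31 = 1 := by
  have h15 : matY a ^ 15 = !![a, a ^ 3 + 1; a ^ 4 + 1, a ^ 2 + a] := by
    rw [pow_succ, pow_add _ 8 6, matY_pow_eight h2 ha, matY_pow_six h2 ha, matY,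
      mul_fin_two, mul_fin_two]
    apply of_fin_two_congr <;> grind
  rw [pow_add _ 15 16, h15, matY_pow_sixteen h2 ha, mul_fin_two, one_fin_two]
  apply of_fin_two_congr <;> grind

/-- The image of `x` in `SL(2, F)`. -/
def slX : SpecialLinearGroup (Fin 2) F := ⟨matX a, det_matX h2 ha⟩

/-- The image of `y` in `SL(2, F)`. -/
def slY : SpecialLinearGroup (Fin 2) F := ⟨matY a, det_matY h2 ha⟩

omit h2 ha in
theorem coe_SL_mul (A B : SpecialLinearGroup (Fin 2) F) :
    ((A * B : SpecialLinearGroup (Fin 2) F) : Matrix (Fin 2) (Fin 2) F) = A.1 * B.1 := rfl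

omit h2 ha in
theorem coe_SL_pow (A : SpecialLinearGroup (Fin 2) F) (n : ℕ) :
    ((A ^ n : SpecialLinearGroup (Fin 2) F) : Matrix (Fin 2) (Fin 2) F) = A.1 ^ n := rfl

omit h2 ha in
theorem coe_SL_inv (A : SpecialLinearGroup (Fin 2) F) :
    ((A⁻¹ : SpecialLinearGroup (Fin 2) F) : Matrix (Fin 2) (Fin 2) F) = adjugate A.1 := rfl

omit ha in
theorem sq_eq_one_of_coe {A : SpecialLinearGroup (Fin 2) F} {p q r : F}
    (hA : (A : Matrix (Fin 2) (Fin 2) F) = !![p, q; r, p]) : A ^ 2 = 1 := by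
  have hdet := A.det_coe
  rw [hA, det_fin_two_of] at hdet
  have h : ((A ^ 2 : SpecialLinearGroup (Fin 2) F) : Matrix (Fin 2) (Fin 2) F) = 1 := by
    rw [coe_SL_pow, hA, pow_two, mul_fin_two, one_fin_two]
    apply of_fin_two_congr <;> grind
  exact Subtype.ext h

omit ha in
theorem coe_inv_of_coe {A : SpecialLinearGroup (Fin 2) F} {p q r s : F}
    (hA : (A : Matrix (Fin 2) (Fin 2) F) = !![p, q; r, s]) :
    ((A⁻¹ : SpecialLinearGroup (Fin 2) F) : Matrix (Fin 2) (Fin 2) F) = !![s, q; r, p] := by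
  rw [coe_SL_inv, hA, adjugate_fin_two_of]
  apply of_fin_two_congr <;> grind

omit h2 ha in
theorem matX_pow (n : ℕ) : matX a ^ n = !![a ^ n, 0; 0, (a ^ 4 + a) ^ n] := by
  induction n with
  | zero => simp [one_fin_two]
  | succ n ih =>
    rw [pow_succ, ih, matX, mul_fin_two]
    apply of_fin_two_congr <;> ring

theorem lift_eq_one_of_mem_Hrels (r : FreeGroup (Fin 2)) (hr : r ∈ Hrels) :
    FreeGroup.lift ![slX h2 ha, slY h2 ha] r = 1 := by
  have hX : (slX h2 ha : Matrix (Fin 2) (Fin 2) F) = matX a := rfl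
  have hY : (slY h2 ha : Matrix (Fin 2) (Fin 2) F) = matY a := rfl
  simp only [Hrels, Set.mem_insert_iff, Set.mem_singleton_iff] at hr
  obtain rfl | rfl | rfl | rfl | rfl | rfl := hr <;>
    simp only [map_pow, map_mul, map_zpow, FreeGroup.lift_apply_of, cons_val_zero, cons_val_one]
  · have ha31 : a ^ 31 = 1 := by grind
    have hinv : (a ^ 4 + a) * a = 1 := by grind
    have hinv31 : (a ^ 4 + a) ^ 31 = 1 := by
      rw [← mul_one ((a ^ 4 + a) ^ 31), ← ha31, ← mul_pow, hinv, one_pow, ha31]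
    refine Subtype.ext ?_
    change ((slX h2 ha ^ 31 : SpecialLinearGroup (Fin 2) F) : Matrix (Fin 2) (Fin 2) F) = 1
    rw [coe_SL_pow, hX, matX_pow, ha31, hinv31, one_fin_two]
  · refine Subtype.ext ?_
    change ((slY h2 ha ^ 31 : SpecialLinearGroup (Fin 2) F) : Matrix (Fin 2) (Fin 2) F) = 1
    rw [coe_SL_pow, hY, matY_pow_thirty_one h2 ha]
  · refine sq_eq_one_of_coe h2 (p := a ^ 3 + a + 1) (q := a ^ 2) (r := a ^ 4 + 1) ?_
    rw [coe_SL_mul, coe_SL_pow, hX, hY, matX_pow, matY,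
      mul_fin_two]
    apply of_fin_two_congr <;> grind
  · refine sq_eq_one_of_coe h2 (p := a ^ 4) (q := a ^ 2 + 1)
      (r := a ^ 4 + a ^ 3 + a ^ 2 + a + 1) ?_
    rw [coe_SL_mul, coe_SL_pow, hX, hY, matX,
      matY_pow_two h2 ha, mul_fin_two]
    apply of_fin_two_congr <;> grind
  · refine sq_eq_one_of_coe h2 (p := a ^ 3) (q := a ^ 4 + a ^ 2 + a + 1) (r := a) ?_
    have hY11 : ((slY h2 ha ^ 11 : SpecialLinearGroup (Fin 2) F) : Matrix (Fin 2) (Fin 2) F) =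
        !![a ^ 3 + a, a ^ 3 + a ^ 2 + a + 1; a ^ 4, 1] := matY_pow_eleven h2 ha
    rw [show (-11 : ℤ) = -((11 : ℕ) : ℤ) by rfl, _root_.zpow_neg, zpow_natCast, coe_SL_mul,
      coe_SL_pow, hX, matX_pow, coe_inv_of_coe h2 hY11, mul_fin_two]
    apply of_fin_two_congr <;> grind
  · refine sq_eq_one_of_coe h2 (p := a ^ 4 + a) (q := a ^ 4 + a ^ 3 + a ^ 2 + a + 1)
      (r := a ^ 2 + a) ?_
    rw [coe_SL_mul, coe_SL_pow, coe_SL_pow, hX, hY,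
      matX_pow, matY_pow_thirteen h2 ha, mul_fin_two]
    apply of_fin_two_congr <;> grind

theorem closure_slX_slY (hF : Nat.card F = 32) :
    Subgroup.closure {slX h2 ha, slY h2 ha} = ⊤ := by
  set H := Subgroup.closure {slX h2 ha, slY h2 ha} with hH
  have hXH : slX h2 ha ∈ H := Subgroup.subset_closure (by simp)
  have hYH : slY h2 ha ∈ H := Subgroup.subset_closure (by simp)
  have hX : (slX h2 ha : Matrix (Fin 2) (Fin 2) F) = !![a, 0; 0, a ^ 4 + a] := rfl
  have hX' := coe_inv_of_coe h2 hX
  have hY4 : ((slY h2 ha ^ 4 : SpecialLinearGroup (Fin 2) F) : Matrix (Fin 2) (Fin 2) F) =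
      !![a ^ 2 + a, a ^ 3 + a ^ 2 + a; a ^ 4 + a ^ 3 + a ^ 2 + a, a ^ 4 + a ^ 3 + a ^ 2 + 1] :=
    matY_pow_four h2 ha
  have hY6 : ((slY h2 ha ^ 6 : SpecialLinearGroup (Fin 2) F) : Matrix (Fin 2) (Fin 2) F) =
      !![a + 1, a ^ 4 + a ^ 3 + a ^ 2; a ^ 4 + a ^ 3 + 1, a ^ 4] := matY_pow_six h2 ha
  have hY6' := coe_inv_of_coe h2 hY6
  have hT01 (c : F) : (SpecialLinearGroup.transvection (zero_ne_one (α := Fin 2)) c :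
      Matrix (Fin 2) (Fin 2) F) = !![1, c; 0, 1] := by
    ext i j
    fin_cases i <;> fin_cases j <;> simp [SpecialLinearGroup.transvection_coe]
  have hT10 (c : F) : (SpecialLinearGroup.transvection (one_ne_zero (α := Fin 2)) c :
      Matrix (Fin 2) (Fin 2) F) = !![1, 0; c, 1] := by
    ext i j
    fin_cases i <;> fin_cases j <;> simp [SpecialLinearGroup.transvection_coe]
  have ha0 : a ≠ 0 := fun h => by grind
  have ha1 : a ^ 2 ≠ 1 := fun h => by grind
  have h01 (c : F) : SpecialLinearGroup.transvection (zero_ne_one (α := Fin 2)) c ∈ H := by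
    refine mem_of_forall_sq_mul hF (s := {c | SpecialLinearGroup.transvection _ c ∈ H}) (u := a)
      (b := a ^ 3 + 1) (by simp) ha1 ha0 (fun h => by grind) ?_ (fun c hc => ?_) c
    · have : (SpecialLinearGroup.transvection (zero_ne_one (α := Fin 2)) (a ^ 3 + 1)) =
          (slY h2 ha ^ 6)⁻¹ * (slX h2 ha)⁻¹ * slY h2 ha ^ 4 := by
        refine Subtype.ext ((hT01 _).trans (Eq.symm ?_))
        rw [coe_SL_mul, coe_SL_mul, hY6', hX', hY4, mul_fin_two,
          mul_fin_two]
        apply of_fin_two_congr <;> grind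
      rw [Set.mem_ofPred_eq, this]
      exact mul_mem (mul_mem (inv_mem (pow_mem hYH 6)) (inv_mem hXH)) (pow_mem hYH 4)
    · have : (SpecialLinearGroup.transvection (zero_ne_one (α := Fin 2)) (a ^ 2 * c)) =
          slX h2 ha * SpecialLinearGroup.transvection zero_ne_one c * (slX h2 ha)⁻¹ := by
        refine Subtype.ext ((hT01 _).trans (Eq.symm ?_))
        rw [coe_SL_mul, coe_SL_mul, hX', hX, hT01, mul_fin_two,
          mul_fin_two]
        apply of_fin_two_congr <;> grind
      rw [Set.mem_ofPred_eq, this]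
      exact mul_mem (mul_mem hXH hc) (inv_mem hXH)
  have h10 (c : F) : SpecialLinearGroup.transvection (one_ne_zero (α := Fin 2)) c ∈ H := by
    refine mem_of_forall_sq_mul hF (s := {c | SpecialLinearGroup.transvection _ c ∈ H}) (u := a)
      (b := a ^ 4 + 1) (by simp) ha1 ha0 (fun h => by grind) ?_ (fun c hc => ?_) c
    · have : (SpecialLinearGroup.transvection (one_ne_zero (α := Fin 2)) (a ^ 4 + 1)) =
          slY h2 ha ^ 4 * (slX h2 ha)⁻¹ * (slY h2 ha ^ 6)⁻¹ := by
        refine Subtype.ext ((hT10 _).trans (Eq.symm ?_))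
        rw [coe_SL_mul, coe_SL_mul, hY6', hX', hY4, mul_fin_two,
          mul_fin_two]
        apply of_fin_two_congr <;> grind
      rw [Set.mem_ofPred_eq, this]
      exact mul_mem (mul_mem (pow_mem hYH 4) (inv_mem hXH)) (inv_mem (pow_mem hYH 6))
    · have : (SpecialLinearGroup.transvection (one_ne_zero (α := Fin 2)) (a ^ 2 * c)) =
          (slX h2 ha)⁻¹ * SpecialLinearGroup.transvection one_ne_zero c * slX h2 ha := by
        refine Subtype.ext ((hT10 _).trans (Eq.symm ?_))
        rw [coe_SL_mul, coe_SL_mul, hX', hX, hT10, mul_fin_two,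
          mul_fin_two]
        apply of_fin_two_congr <;> grind
      rw [Set.mem_ofPred_eq, this]
      exact mul_mem (mul_mem (inv_mem hXH) hc) hXH
  refine eq_top_iff.mpr fun M _ => SL2.transvection_induction (· ∈ H) (fun i j hij c => ?_)
    (fun _ _ => mul_mem) M
  fin_cases i <;> fin_cases j
  exacts [(hij rfl).elim, h01 c, h10 c, (hij rfl).elim]

end SL

/-- H̄ ≅ SL(2, 32). -/
theorem Hbar_iso_SL2_32 :
    Nonempty (Hbar ≃* Matrix.SpecialLinearGroup (Fin 2) (GaloisField 2 5)) := by
  have hF : Nat.card (GaloisField 2 5) = 32 := GaloisField.card 2 5 (by norm_num)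
  have h2 : (2 : GaloisField 2 5) = 0 := CharTwo.two_eq_zero
  have : Finite (GaloisField 2 5) := Nat.finite_of_card_ne_zero (by simp [hF])
  obtain ⟨a, ha⟩ := exists_pow_five_eq hF h2
  let φ : Hbar →* Matrix.SpecialLinearGroup (Fin 2) (GaloisField 2 5) :=
    PresentedGroup.toGroup (lift_eq_one_of_mem_Hrels h2 ha)
  have hφ : Function.Surjective φ := by
    rw [← MonoidHom.range_eq_top, eq_top_iff, ← closure_slX_slY h2 ha hF, Subgroup.closure_le]
    rintro _ (rfl | rfl)
    exacts [⟨.of 0, PresentedGroup.toGroup.of _⟩, ⟨.of 1, PresentedGroup.toGroup.of _⟩]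
  obtain ⟨hfin, hcard⟩ := card_le_of_relators (PresentedGroup.mk Hrels)
    (PresentedGroup.mk_surjective Hrels) fun _ => PresentedGroup.one_of_mem
  have hSL := card_SL_two (F := GaloisField 2 5) (1056 * 31) (by norm_num [hF])
  exact ⟨MulEquiv.ofBijective φ
    ((Nat.bijective_iff_surjective_and_card φ).mpr
      ⟨hφ, (hcard.trans hSL).antisymm (Nat.card_le_card_of_surjective φ hφ)⟩)⟩
end

section
/- Let G be the group with presentation ⟨a, b | a^3 = 1, b^{31} = 1, (aba^{-1}b^2)^2 = 1, (ab^2a^{-1}b)^2 = 1, (ab^3a^{-1}b^{-11})^2 = 1, (ab^4a^{-1}b^{13})^2 = 1⟩. Then G is isomorphic to C_3 × SL(2, 32) × SL(2, 32), the direct product of a cyclic group of order 3 with two copies of the special linear group of degree 2 over the field with 32 elements. -/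
/-- The relators of
⟨a, b | a³ = b³¹ = (aba⁻¹b²)² = (ab²a⁻¹b)² = (ab³a⁻¹b⁻¹¹)² = (ab⁴a⁻¹b¹³)² = 1⟩. -/
def Grels : Set (FreeGroup (Fin 2)) :=
  {(FreeGroup.of 0) ^ 3, (FreeGroup.of 1) ^ 31,
   (FreeGroup.of 0 * FreeGroup.of 1 * (FreeGroup.of 0)⁻¹ * (FreeGroup.of 1) ^ 2) ^ 2,
   (FreeGroup.of 0 * (FreeGroup.of 1) ^ 2 * (FreeGroup.of 0)⁻¹ * FreeGroup.of 1) ^ 2,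
   (FreeGroup.of 0 * (FreeGroup.of 1) ^ 3 * (FreeGroup.of 0)⁻¹ * (FreeGroup.of 1) ^ (-11 : ℤ)) ^ 2,
   (FreeGroup.of 0 * (FreeGroup.of 1) ^ 4 * (FreeGroup.of 0)⁻¹ * (FreeGroup.of 1) ^ 13) ^ 2}

/-- The group G = ⟨a, b | a³ = b³¹ = (aba⁻¹b²)² = (ab²a⁻¹b)² = (ab³a⁻¹b⁻¹¹)² = (ab⁴a⁻¹b¹³)² = 1⟩. -/
abbrev Gp : Type := PresentedGroup Grels

/-! ### Words in the conjugates of an element -/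

/-- The conjugate `aⁱ b a⁻ⁱ`. -/
def conjPow {G : Type*} [Group G] (a b : G) (i : ℤ) : G := a ^ i * b * (a ^ i)⁻¹

/-- A word, given by its syllables: `(j, e)` stands for the `e`-th power of the `j`-th letter.
The letters are thought of as elements of exponent 31, indexed modulo 3. -/
abbrev SWord : Type := List (ℕ × ℕ)

namespace SWord

/-- The value of a word under an assignment of the letters. -/
def eval {G : Type*} [Group G] (c : ℕ → G) : SWord → G
  | [] => 1
  | s :: w => c s.1 ^ s.2 * eval c w

/-- Prepend a syllable to a reduced word, and reduce. -/
def push (s : ℕ × ℕ) : SWord → SWord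
  | [] => if s.2 % 31 = 0 then [] else [(s.1, s.2 % 31)]
  | t :: w =>
    if s.1 = t.1 then
      if (s.2 + t.2) % 31 = 0 then w else (s.1, (s.2 + t.2) % 31) :: w
    else if s.2 % 31 = 0 then t :: w else (s.1, s.2 % 31) :: t :: w

/-- Merge adjacent syllables of the same letter. -/
def reduce (w : SWord) : SWord := w.foldr push []

/-- The formal inverse of a word. -/
def inv (w : SWord) : SWord := (w.map fun s => (s.1, 30 * s.2)).reverse

/-- Replace each letter by the one `i` places after it. -/
def shift (i : ℕ) (w : SWord) : SWord := w.map fun s => (s.1 + i, s.2)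

/-- Exchange the letters 1 and 2. -/
def swap (w : SWord) : SWord := w.map fun s => (2 * s.1 % 3, s.2)

/-- Reduce the indices of the letters modulo 3. -/
def normalize (w : SWord) : SWord := w.map fun s => (s.1 % 3, s.2)

/-- The relator `(y ^ k * x ^ f) ^ 2`, where `x` is the letter `j` and `y` is the next one,
or its cyclic rotation `(x ^ f * y ^ k) ^ 2`. -/
def flipRelator (j k f s : ℕ) : SWord :=
  if s = 0 then [((j + 1) % 3, k), (j, f), ((j + 1) % 3, k), (j, f)]
  else [(j, f), ((j + 1) % 3, k), (j, f), ((j + 1) % 3, k)]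

/-- Check that a word can be turned into the empty word by a sequence of moves. The move
`(r, j, k, s)` rotates the word by `r` syllables and prepends a relator
`flipRelator j k f s` where `f` is the entry number `k` of the table `T`. -/
def kills (T : List ℕ) : SWord → List (ℕ × ℕ × ℕ × ℕ) → Bool
  | w, [] => w.isEmpty
  | w, (r, j, k, s) :: L =>
    T.getD k 0 != 0 &&
      kills T (reduce (flipRelator j k (T.getD k 0) s ++ (w.drop r ++ w.take r))) L

section eval

variable {G H : Type*} [Group G] [Group H] {c : ℕ → G}

@[simp] theorem eval_nil : eval c [] = 1 := rfl

@[simp] theorem eval_cons (s : ℕ × ℕ) (w : SWord) :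
    eval c (s :: w) = c s.1 ^ s.2 * eval c w := rfl

@[simp] theorem eval_append (v w : SWord) : eval c (v ++ w) = eval c v * eval c w := by
  induction v with
  | nil => simp
  | cons s v ih => simp [ih, mul_assoc]

theorem eval_map (φ : G →* H) (w : SWord) : eval (fun j => φ (c j)) w = φ (eval c w) := by
  induction w with
  | nil => simp
  | cons s w ih => simp [ih]

theorem commute_eval {g : G} (h : ∀ j, Commute g (c j)) (w : SWord) : Commute g (eval c w) := by
  induction w with
  | nil => exact Commute.one_right g
  | cons s w ih => exact ((h _).pow_right _).mul_right ih

theorem eval_mul {d : ℕ → G} (h : ∀ i j, Commute (c i) (d j)) (w : SWord) :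
    eval (fun j => c j * d j) w = eval c w * eval d w := by
  induction w with
  | nil => simp
  | cons s w ih =>
    have h1 : Commute (d s.1 ^ s.2) (eval c w) :=
      commute_eval (fun j => ((h j s.1).symm).pow_left _) w
    simp only [eval_cons, ih, (h s.1 s.1).mul_pow]
    rw [mul_assoc, ← mul_assoc (d s.1 ^ s.2), h1.eq]
    simp only [mul_assoc]

theorem pow_mod_31 {g : G} (hg : g ^ 31 = 1) (n : ℕ) : g ^ (n % 31) = g ^ n := by
  conv_rhs => rw [← Nat.div_add_mod n 31, pow_add, pow_mul, hg, one_pow, one_mul]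

theorem eval_push (hc : ∀ j, c j ^ 31 = 1) (s : ℕ × ℕ) (w : SWord) :
    eval c (push s w) = c s.1 ^ s.2 * eval c w := by
  have key : ∀ j n, n % 31 = 0 → c j ^ n = 1 := fun j n h => by
    rw [← pow_mod_31 (hc j), h, pow_zero]
  cases w with
  | nil =>
    rw [push]
    split_ifs with h
    · simp [key _ _ h]
    · simp [pow_mod_31 (hc _)]
  | cons t w =>
    rw [push]
    split_ifs with h1 h2 h3
    · rw [eval_cons, ← mul_assoc, ← h1, ← pow_add, key _ _ h2, one_mul]
    · rw [eval_cons, eval_cons, ← mul_assoc, ← h1, ← pow_add, pow_mod_31 (hc _)]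
    · rw [key _ _ h3, one_mul]
    · simp [pow_mod_31 (hc _)]

theorem eval_reduce (hc : ∀ j, c j ^ 31 = 1) (w : SWord) : eval c (reduce w) = eval c w := by
  induction w with
  | nil => rfl
  | cons s w ih => rw [eval_cons, ← ih]; exact eval_push hc s _

theorem eval_inv (hc : ∀ j, c j ^ 31 = 1) (w : SWord) : eval c (inv w) = (eval c w)⁻¹ := by
  induction w with
  | nil => simp [inv]
  | cons s w ih =>
    have h : c s.1 ^ (30 * s.2) = (c s.1 ^ s.2)⁻¹ := by
      rw [eq_inv_iff_mul_eq_one, ← pow_add, show 30 * s.2 + s.2 = 31 * s.2 by ring, pow_mul, hc,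
        one_pow]
    have h2 : inv (s :: w) = inv w ++ [(s.1, 30 * s.2)] := by simp [inv]
    rw [h2, eval_append, ih, eval_cons, eval_nil, mul_one, h, eval_cons, mul_inv_rev]

/-- If `(y ^ k * x ^ f) ^ 2 = 1` for all consecutive letters `x`, `y` and all `k` such that
`f`, the entry number `k` of `T`, is not zero, then words which pass the test are trivial. -/
theorem eval_eq_one_of_kills {T : List ℕ} (hc : ∀ j, c j ^ 31 = 1)
    (hT : ∀ j k, T.getD k 0 ≠ 0 → (c ((j + 1) % 3) ^ k * c j ^ T.getD k 0) ^ 2 = 1)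
    {L : List (ℕ × ℕ × ℕ × ℕ)} {w : SWord} (h : kills T w L = true) : eval c w = 1 := by
  induction L generalizing w with
  | nil =>
    rw [kills, List.isEmpty_iff] at h
    simp [h]
  | cons m L ih =>
    obtain ⟨r, j, k, s⟩ := m
    rw [kills, Bool.and_eq_true, bne_iff_ne] at h
    have h1 := ih h.2
    have h3 := hT j k h.1
    have h2 : eval c (flipRelator j k (T.getD k 0) s) = 1 := by
      unfold flipRelator
      split_ifs
      · simpa [pow_two, mul_assoc] using h3
      · have h4 := congrArg (fun g => c j ^ T.getD k 0 * g * (c j ^ T.getD k 0)⁻¹) h3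
        simpa [pow_two, mul_assoc] using h4
    rw [eval_reduce hc, eval_append, h2, one_mul, eval_append] at h1
    have h5 := congrArg (fun g => eval c (w.take r) * g * (eval c (w.take r))⁻¹) h1
    simp only [mul_assoc, mul_inv_cancel, mul_one] at h5
    rwa [← eval_append, List.take_append_drop] at h5

end eval

end SWord

section conjPow

variable {G H : Type*} [Group G] [Group H]

theorem conjPow_zero (a b : G) : conjPow a b 0 = b := by simp [conjPow]

theorem conjPow_eq_conj (a b : G) (i : ℤ) : conjPow a b i = MulAut.conj (a ^ i) b := rfl

theorem conjPow_add (a b : G) (i j : ℤ) : conjPow a b (i + j) = conjPow a (conjPow a b j) i := by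
  simp [conjPow, zpow_add, mul_assoc]

theorem conjPow_mul (a b c : G) (i : ℤ) :
    conjPow a (b * c) i = conjPow a b i * conjPow a c i := by simp [conjPow]

theorem conjPow_pow (a b : G) (i : ℤ) (n : ℕ) :
    conjPow a (b ^ n) i = conjPow a b i ^ n := by
  simp only [conjPow_eq_conj, map_pow]

theorem conjPow_inv_left (a b : G) (i : ℤ) : conjPow a⁻¹ b i = conjPow a b (-i) := by
  simp [conjPow]

theorem map_conjPow (φ : G →* H) (a b : G) (i : ℤ) :
    φ (conjPow a b i) = conjPow (φ a) (φ b) i := by simp [conjPow]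

theorem conjPow_emod_three {a : G} (ha : a ^ 3 = 1) (b : G) (i : ℤ) :
    conjPow a b (i % 3) = conjPow a b i := by
  have h : a ^ (i % 3) = a ^ i := by
    conv_rhs => rw [← Int.mul_ediv_add_emod i 3, zpow_add, zpow_mul]
    rw [show a ^ (3 : ℤ) = 1 from mod_cast ha, one_zpow, one_mul]
  rw [conjPow, h, conjPow]

theorem commute_conjPow_iff (a b c : G) (i j : ℤ) :
    Commute (conjPow a b i) (conjPow a c j) ↔ Commute b (conjPow a c (j - i)) := by
  have h : conjPow a c j = conjPow a (conjPow a c (j - i)) i := by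
    rw [← conjPow_add, add_sub_cancel]
  rw [h, conjPow_eq_conj, conjPow_eq_conj a (conjPow a c (j - i))]
  exact ⟨fun h => by simpa using h.map (MulAut.conj (a ^ i)).symm,
    fun h => h.map (MulAut.conj (a ^ i))⟩

namespace SWord

theorem eval_normalize {a : G} (ha : a ^ 3 = 1) (b : G) (w : SWord) :
    eval (fun j => conjPow a b j) (normalize w) = eval (fun j => conjPow a b j) w := by
  induction w with
  | nil => rfl
  | cons s w ih =>
    have h : normalize (s :: w) = (s.1 % 3, s.2) :: normalize w := rfl
    rw [h, eval_cons, eval_cons, ih]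
    rw [Int.natCast_mod, Nat.cast_ofNat, conjPow_emod_three ha]

theorem eval_shift (a b : G) (i : ℕ) (w : SWord) :
    eval (fun j => conjPow a b j) (shift i w) = conjPow a (eval (fun j => conjPow a b j) w) i := by
  induction w with
  | nil => simp [shift, conjPow]
  | cons s w ih =>
    have h : shift i (s :: w) = (s.1 + i, s.2) :: shift i w := rfl
    rw [h, eval_cons, eval_cons, ih, conjPow_mul, conjPow_pow]
    simp only [Nat.cast_add, add_comm (s.1 : ℤ), conjPow_add]

theorem eval_swap {a : G} (ha : a ^ 3 = 1) (b : G) (w : SWord) :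
    eval (fun j => conjPow a b j) (swap w) = eval (fun j => conjPow a⁻¹ b j) w := by
  induction w with
  | nil => rfl
  | cons s w ih =>
    have h : swap (s :: w) = (2 * s.1 % 3, s.2) :: swap w := rfl
    have h2 : conjPow a b (2 * s.1 % 3 : ℕ) = conjPow a⁻¹ b s.1 := by
      rw [conjPow_inv_left, ← conjPow_emod_three ha b (-s.1)]
      congr 1
      omega
    rw [h, eval_cons, eval_cons, ih, h2]

end SWord

end conjPow

/-! ### Flip relations -/

/-- The elements `a` and `b` satisfy `a ^ 3 = b ^ 31 = 1` and `(a b ^ k a⁻¹ b ^ f) ^ 2 = 1`, where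
`f` is the entry number `k` of `T`, whenever this entry is not zero. -/
structure IsFlipPair {G : Type*} [Group G] (T : List ℕ) (a b : G) : Prop where
  pow_three : a ^ 3 = 1
  pow_31 : b ^ 31 = 1
  flip : ∀ k, T.getD k 0 ≠ 0 → (conjPow a b 1 ^ k * b ^ T.getD k 0) ^ 2 = 1

/-- Set the entries number `k` and `31 - k` of a table to `f` and `31 - f`. -/
def setFlip (T : List ℕ) (k f : ℕ) : List ℕ := (T.set k f).set (31 - k) (31 - f)

/-- Add entries to a table, for which the corresponding relation passes the test. -/
def extendTable : List ℕ → List (ℕ × ℕ × List (ℕ × ℕ × ℕ × ℕ)) → Option (List ℕ)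
  | T, [] => some T
  | T, (k, f, L) :: M =>
    if k ≤ 31 ∧ f ≤ 31 ∧ SWord.kills T [(1, k), (0, f), (1, k), (0, f)] L = true then
      extendTable (setFlip T k f) M
    else none

namespace IsFlipPair

variable {G : Type*} [Group G] {a b : G} {T : List ℕ}

theorem conjPow_pow_31 (h : IsFlipPair T a b) (j : ℤ) : conjPow a b j ^ 31 = 1 := by
  rw [← conjPow_pow, h.pow_31]
  simp [conjPow]

theorem flip_conjPow (h : IsFlipPair T a b) (j k : ℕ) (hk : T.getD k 0 ≠ 0) :
    (conjPow a b ((j + 1) % 3 : ℕ) ^ k * conjPow a b j ^ T.getD k 0) ^ 2 = 1 := by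
  have h1 : conjPow a b (((j + 1) % 3 : ℕ) : ℤ) = conjPow a (conjPow a b 1) j := by
    rw [Int.natCast_mod, Nat.cast_ofNat, conjPow_emod_three h.pow_three, ← conjPow_add,
      Nat.cast_add, Nat.cast_one]
  have h2 := h.flip k hk
  simp only [h1, ← conjPow_pow, ← conjPow_mul] at h2 ⊢
  rw [h2]
  simp [conjPow]

theorem eval_eq_one (h : IsFlipPair T a b) (w : SWord) (L : List (ℕ × ℕ × ℕ × ℕ))
    (hw : SWord.kills T w.normalize.reduce L = true) :
    SWord.eval (fun j => conjPow a b j) w = 1 := by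
  rw [← SWord.eval_normalize h.pow_three, ← SWord.eval_reduce (fun j => h.conjPow_pow_31 j)]
  exact SWord.eval_eq_one_of_kills (fun j => h.conjPow_pow_31 j) h.flip_conjPow hw

theorem set (h : IsFlipPair T a b) {k f : ℕ} (hk : k ≤ 31) (hf : f ≤ 31)
    (hkf : (conjPow a b 1 ^ k * b ^ f) ^ 2 = 1) : IsFlipPair (setFlip T k f) a b := by
  refine ⟨h.pow_three, h.pow_31, fun i hi => ?_⟩
  have hneg : (conjPow a b 1 ^ (31 - k) * b ^ (31 - f)) ^ 2 = 1 := by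
    have h1 : ∀ g : G, g ^ 31 = 1 → ∀ n ≤ 31, g ^ (31 - n) = (g ^ n)⁻¹ := fun g hg n hn => by
      rw [eq_inv_iff_mul_eq_one, ← pow_add, Nat.sub_add_cancel hn, hg]
    rw [h1 _ (h.conjPow_pow_31 1) k hk, h1 _ h.pow_31 f hf]
    have h2 := congrArg (fun g => (b ^ f * g * (b ^ f)⁻¹)⁻¹) hkf
    simpa [pow_two, mul_assoc] using h2
  have key : (setFlip T k f).getD i 0 = T.getD i 0 ∨ (i = k ∧ (setFlip T k f).getD i 0 = f) ∨
      (i = 31 - k ∧ (setFlip T k f).getD i 0 = 31 - f) := by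
    simp only [setFlip, List.getD_eq_getElem?_getD, List.getElem?_set, List.length_set]
    split_ifs <;> simp_all
  rcases key with h1 | ⟨rfl, h1⟩ | ⟨rfl, h1⟩
  · rw [h1] at hi ⊢
    exact h.flip i hi
  · rwa [h1]
  · rwa [h1]

theorem extendTable (h : IsFlipPair T a b) {M : List (ℕ × ℕ × List (ℕ × ℕ × ℕ × ℕ))}
    {T' : List ℕ} (hM : extendTable T M = some T') : IsFlipPair T' a b := by
  induction M generalizing T with
  | nil =>
    rw [_root_.extendTable, Option.some_inj] at hM
    rwa [← hM]
  | cons m M ih =>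
    obtain ⟨k, f, L⟩ := m
    rw [_root_.extendTable] at hM
    split_ifs at hM with hL
    refine ih (h.set hL.1 hL.2.1 ?_) hM
    have h1 := SWord.eval_eq_one_of_kills (fun j => h.conjPow_pow_31 j) h.flip_conjPow hL.2.2
    simpa [pow_two, mul_assoc, conjPow_zero] using h1

end IsFlipPair

/-- The table of all known flip relations. -/
def flipTable : List ℕ :=
  [0, 2, 1, 20, 13, 17, 24, 25, 19, 15, 0, 28, 23, 4, 26, 9, 22, 5, 27, 8, 3, 0, 16, 12, 6, 7, 14,
  18, 11, 30, 29]

/-- Derivations of the entries of `flipTable` from those in the presentation. -/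
def flipDerivations : List (ℕ × ℕ × List (ℕ × ℕ × ℕ × ℕ)) :=
  [(5, 17,
    [(1, 0, 30, 0), (1, 0, 27, 0), (4, 0, 2, 1), (3, 0, 30, 1), (1, 0, 2, 1), (3, 0, 30, 1), (1,
    0, 2, 1), (3, 0, 30, 1), (1, 0, 2, 1), (3, 0, 30, 1), (1, 0, 2, 1), (3, 0, 30, 1), (1, 0, 2,
    1), (3, 0, 30, 1), (1, 0, 2, 1), (3, 0, 30, 1), (1, 0, 2, 1), (3, 0, 30, 1), (1, 0, 2, 1), (3,
    0, 30, 1), (1, 0, 2, 1), (3, 0, 30, 1), (1, 0, 2, 1), (3, 0, 30, 1), (1, 0, 2, 1), (3, 0, 30,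
    1), (1, 0, 2, 1), (3, 0, 30, 1), (1, 0, 2, 1), (4, 0, 28, 0), (1, 0, 2, 0), (2, 0, 30, 1), (5,
    0, 29, 1), (1, 0, 3, 1), (3, 0, 30, 1), (2, 0, 29, 0), (1, 0, 3, 0), (6, 0, 4, 1), (1, 0, 2,
    1), (2, 0, 4, 0), (2, 0, 29, 1), (3, 0, 29, 1), (1, 0, 1, 1), (2, 0, 29, 0), (5, 0, 27, 0),
    (4, 0, 27, 1), (1, 0, 1, 1), (2, 0, 28, 0), (4, 0, 3, 1), (1, 0, 30, 1), (4, 0, 27, 0), (1, 0,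
    2, 0), (2, 0, 2, 1), (3, 0, 27, 1), (7, 0, 2, 1), (2, 0, 28, 0), (1, 0, 1, 0), (2, 0, 29, 1),
    (3, 0, 1, 1), (1, 0, 29, 1), (3, 0, 1, 1), (1, 0, 29, 1), (3, 0, 1, 1), (1, 0, 29, 1), (3, 0,
    1, 1), (1, 0, 29, 1), (3, 0, 1, 1), (1, 0, 29, 1), (3, 0, 1, 1), (1, 0, 29, 1), (3, 0, 1, 1),
    (1, 0, 29, 1), (3, 0, 1, 1), (1, 0, 29, 1), (3, 0, 1, 1), (5, 0, 30, 1), (1, 0, 2, 1), (3, 0,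
    30, 1), (1, 0, 2, 1), (3, 0, 30, 1), (7, 0, 2, 1), (4, 0, 30, 0), (3, 0, 2, 0), (1, 0, 30, 0),
    (3, 0, 2, 0), (1, 0, 30, 0), (3, 0, 2, 0), (1, 0, 30, 0), (4, 0, 30, 1), (5, 0, 2, 1), (3, 0,
    30, 1), (1, 0, 2, 1), (3, 0, 30, 1), (1, 0, 2, 1), (2, 0, 3, 0), (3, 0, 27, 0), (1, 0, 1, 0),
    (3, 0, 1, 0), (1, 0, 29, 0), (3, 0, 29, 0), (2, 0, 1, 1), (1, 0, 29, 1), (3, 0, 1, 1), (1, 0,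
    29, 1), (3, 0, 1, 1), (1, 0, 29, 1), (3, 0, 1, 1), (2, 0, 2, 0), (1, 0, 28, 0), (4, 0, 27, 1),
    (1, 0, 2, 1), (2, 0, 1, 0), (5, 0, 3, 0), (1, 0, 30, 0), (2, 0, 29, 1), (2, 0, 1, 0), (5, 0,
    4, 0), (1, 0, 30, 0), (2, 0, 2, 1), (2, 0, 28, 0), (5, 0, 3, 0), (1, 0, 27, 0), (2, 0, 2, 1),
    (2, 0, 1, 0), (2, 0, 1, 1), (3, 0, 29, 1), (2, 0, 30, 0), (2, 0, 3, 1), (1, 0, 4, 1), (2, 0,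
    30, 0), (2, 0, 2, 1), (3, 0, 30, 1), (1, 0, 2, 1), (3, 0, 30, 1), (1, 0, 2, 1), (3, 0, 30, 1),
    (1, 0, 2, 1), (3, 0, 30, 1), (1, 0, 2, 1), (3, 0, 30, 1), (2, 0, 29, 0), (7, 0, 2, 0), (2, 0,
    1, 1), (2, 0, 29, 0), (1, 0, 1, 0), (3, 0, 29, 0), (1, 0, 1, 0), (3, 0, 29, 0), (2, 0, 1, 1),
    (1, 0, 29, 1), (3, 0, 1, 1), (1, 0, 29, 1), (5, 0, 28, 1), (2, 0, 4, 0), (5, 0, 29, 0), (4, 0,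
    1, 1), (5, 0, 1, 1), (1, 0, 29, 1), (6, 0, 29, 0), (1, 0, 1, 0), (3, 0, 29, 0), (1, 0, 1, 0),
    (3, 0, 29, 0), (1, 0, 1, 0), (3, 0, 29, 0), (1, 0, 1, 0), (3, 0, 29, 0), (1, 0, 1, 0), (3, 0,
    29, 0), (1, 0, 1, 0), (3, 0, 29, 0), (1, 0, 1, 0)]),
   (6, 24,
    [(1, 0, 3, 0), (3, 0, 27, 0), (6, 0, 30, 1), (3, 0, 2, 1), (1, 0, 2, 1), (2, 0, 30, 0), (3, 0,
    2, 0), (1, 0, 30, 0), (3, 0, 2, 0), (1, 0, 30, 0), (3, 0, 2, 0), (1, 0, 30, 0), (3, 0, 2, 0),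
    (1, 0, 30, 0), (3, 0, 2, 0), (1, 0, 30, 0), (3, 0, 2, 0), (1, 0, 30, 0), (3, 0, 2, 0), (1, 0,
    30, 0), (3, 0, 2, 0), (7, 0, 30, 0), (1, 0, 2, 0), (4, 0, 29, 1), (1, 0, 4, 1), (2, 0, 5, 0),
    (3, 0, 2, 0), (2, 0, 27, 1), (1, 0, 2, 1), (1, 0, 28, 1), (3, 0, 1, 1), (7, 0, 27, 1), (3, 0,
    2, 1), (2, 0, 3, 0), (1, 0, 26, 0), (2, 0, 4, 1), (2, 0, 30, 0), (3, 0, 3, 0), (2, 0, 29, 1),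
    (5, 0, 29, 1), (2, 0, 4, 0), (1, 0, 29, 0), (4, 0, 29, 1), (1, 0, 3, 1), (2, 0, 30, 0), (4, 0,
    30, 1), (2, 0, 2, 0), (1, 0, 30, 0), (3, 0, 2, 0), (3, 0, 2, 0), (2, 0, 30, 1), (1, 0, 2, 1),
    (3, 0, 30, 1), (1, 0, 2, 1), (3, 0, 30, 1), (1, 0, 2, 1), (3, 0, 30, 1), (1, 0, 2, 1), (3, 0,
    30, 1), (1, 0, 2, 1), (3, 0, 30, 1), (5, 0, 2, 1), (1, 0, 30, 1)]),
   (7, 25,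
    [(0, 0, 26, 1), (3, 0, 29, 1), (1, 0, 27, 1), (3, 0, 6, 1), (2, 0, 26, 0), (2, 0, 29, 1), (1,
    0, 27, 1), (6, 0, 3, 0), (1, 0, 6, 0)]),
   (8, 19,
    [(1, 0, 29, 0), (1, 0, 25, 0), (3, 0, 7, 0), (1, 0, 30, 0), (2, 0, 25, 1), (2, 0, 29, 0), (6,
    0, 26, 1), (1, 0, 7, 1)]),
   (9, 15,
    [(1, 0, 28, 0), (1, 0, 25, 0), (3, 0, 4, 0), (2, 0, 30, 1), (1, 0, 3, 1), (2, 0, 30, 0), (2,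
    0, 28, 1), (6, 0, 25, 0), (1, 0, 4, 0)]),
   (11, 28,
    [(0, 0, 26, 1), (1, 0, 3, 1), (3, 0, 2, 1), (2, 0, 22, 0), (2, 0, 3, 1), (2, 0, 26, 0), (1, 0,
    2, 0), (3, 0, 22, 0), (1, 0, 7, 0)]),
   (12, 23,
    [(0, 0, 24, 1), (3, 0, 26, 1), (1, 0, 28, 1), (3, 0, 8, 1), (1, 0, 2, 1), (2, 0, 8, 0), (5, 0,
    24, 0), (2, 0, 26, 1), (1, 0, 28, 1)]),
   (13, 4,
    [(1, 0, 29, 0), (3, 0, 11, 0), (1, 0, 22, 0), (2, 0, 22, 1), (2, 0, 29, 0), (2, 0, 11, 1), (3,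
    0, 22, 1), (1, 0, 27, 1)]),
   (14, 26,
    [(0, 0, 25, 1), (1, 0, 30, 1), (3, 0, 7, 1), (2, 0, 29, 0), (2, 0, 25, 1), (2, 0, 30, 0), (2,
    0, 19, 1), (1, 0, 7, 1)]),
   (15, 9,
    [(1, 0, 11, 0), (3, 0, 7, 0), (1, 0, 13, 0), (2, 0, 29, 1), (3, 0, 20, 1), (2, 0, 29, 0), (1,
    0, 13, 0), (3, 0, 11, 0), (1, 0, 7, 0)])]

theorem IsFlipPair.of_relators {G : Type*} [Group G] {a b : G} (ha : a ^ 3 = 1) (hb : b ^ 31 = 1)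
    (h1 : (conjPow a b 1 ^ 1 * b ^ 2) ^ 2 = 1) (h2 : (conjPow a b 1 ^ 2 * b ^ 1) ^ 2 = 1)
    (h3 : (conjPow a b 1 ^ 3 * b ^ 20) ^ 2 = 1) (h4 : (conjPow a b 1 ^ 4 * b ^ 13) ^ 2 = 1) :
    IsFlipPair flipTable a b := by
  have h0 : IsFlipPair (List.replicate 31 0) a b :=
    ⟨ha, hb, fun k hk => absurd (by
      rw [List.getD_eq_getElem?_getD, List.getElem?_replicate]
      split_ifs <;> rfl) hk⟩
  have h := (((h0.set (k := 1) (by simp) (by simp) h1).set (k := 2) (by simp) (by simp) h2).set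
    (k := 3) (by simp) (by simp) h3).set (k := 4) (by simp) (by simp) h4
  exact h.extendTable (M := flipDerivations) (by decide +kernel)

/-- The relations are symmetric in `a b a⁻¹` and `b`. -/
theorem IsFlipPair.inv {G : Type*} [Group G] {a b : G} (h : IsFlipPair flipTable a b) :
    IsFlipPair flipTable a⁻¹ b := by
  refine ⟨by rw [inv_pow, h.pow_three, inv_one], h.pow_31, fun k hk => ?_⟩
  have hT : ∀ k < 31, flipTable.getD k 0 ≠ 0 → flipTable.getD (flipTable.getD k 0) 0 = k := by
    decide +kernel
  have hk31 : k < 31 := by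
    by_contra hk31
    exact hk (List.getD_eq_default _ _ (not_lt.mp hk31))
  have h1 := h.flip (flipTable.getD k 0) (by
    rw [hT k hk31 hk]
    rintro rfl
    exact hk rfl)
  rw [hT k hk31 hk] at h1
  have h2 := congrArg (conjPow a · (-1)) h1
  simp only [conjPow_pow, conjPow_mul, ← conjPow_add] at h2
  rw [neg_add_cancel, conjPow_zero, conjPow_inv_left] at *
  have h3 := congrArg (fun g => conjPow a b (-1) ^ k * g * (conjPow a b (-1) ^ k)⁻¹) h2
  simpa [pow_two, mul_assoc, conjPow] using h3

/-! ### Groups generated by a torus, an involution and a root group -/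

section TorusAndInvolution

variable {A : Type*} [Group A] {X W e : A}

theorem commute_conjPow (h1 : Commute e (conjPow X e 1)) (h2 : Commute e (conjPow X e 2))
    (h5 : conjPow X e 5 = conjPow X e 2 * e) (i j : ℤ) :
    Commute (conjPow X e i) (conjPow X e j) := by
  have hs : ∀ n : ℤ, conjPow X e (n + 5) = conjPow X e (n + 2) * conjPow X e n := fun n => by
    rw [conjPow_add, h5, conjPow_mul, ← conjPow_add]
  have shiftc : ∀ {i j : ℤ} (k : ℤ), Commute (conjPow X e i) (conjPow X e j) → k = j - i →
      Commute e (conjPow X e k) := fun k h hk => by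
    rw [hk]
    exact (commute_conjPow_iff _ _ _ _ _).mp h
  have c25 : Commute (conjPow X e 2) (conjPow X e 5) := by
    rw [h5]
    exact (Commute.refl _).mul_right h2.symm
  have c15 : Commute (conjPow X e 1) (conjPow X e 5) := by
    rw [h5]
    exact ((commute_conjPow_iff X e e 1 2).mpr h1).mul_right h1.symm
  have hn : ∀ n : ℕ, Commute e (conjPow X e n) := by
    intro n
    induction n using Nat.strong_induction_on with
    | _ n ih =>
      match n, ih with
      | 0, _ => simp [conjPow_zero]
      | 1, _ => exact h1
      | 2, _ => exact h2
      | 3, _ => exact shiftc 3 c25 rfl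
      | 4, _ => exact shiftc 4 c15 rfl
      | n + 5, ih =>
        have h := (ih (n + 2) (by omega)).mul_right (ih n (by omega))
        push_cast at h ⊢
        rwa [hs]
  rw [commute_conjPow_iff]
  obtain ⟨n, hn' | hn'⟩ := (j - i).eq_nat_or_neg
  · rw [hn']
    exact hn n
  · refine shiftc (i := n) (j := 0) _ ?_ (by omega)
    rw [conjPow_zero]
    exact (hn n).symm

/-- The homomorphism from the group of order two given by an involution. -/
def involutionHom (g : A) (hg : g ^ 2 = 1) : Multiplicative (ZMod 2) →* A where
  toFun n := g ^ (Multiplicative.toAdd n).val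
  map_one' := by simp
  map_mul' m n := by
    rw [toAdd_mul, ZMod.val_add, ← pow_add]
    conv_rhs => rw [← Nat.div_add_mod ((Multiplicative.toAdd m).val +
      (Multiplicative.toAdd n).val) 2, pow_add, pow_mul, hg, one_pow, one_mul]

/-- Multiplication by a root of `T ^ 5 + T ^ 2 + 1` on the field with 32 elements, written
multiplicatively. -/
def shiftHom :
    (Fin 5 → Multiplicative (ZMod 2)) →* (Fin 5 → Multiplicative (ZMod 2)) where
  toFun v := ![v 4, v 0, v 1 * v 4, v 2, v 3]
  map_one' := by decide
  map_mul' v w := by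
    ext i
    fin_cases i <;> simp [mul_mul_mul_comm]

theorem exists_iterate_shiftHom (v : Fin 5 → Multiplicative (ZMod 2)) (hv : v ≠ 1) :
    ∃ i : Fin 31, shiftHom^[i] (Pi.mulSingle 0 (Multiplicative.ofAdd 1)) = v := by
  revert v
  decide +kernel

/-- The hypotheses give the root group: an elementary abelian subgroup of order at most 32 the
nontrivial elements of which are conjugates of `e` under powers of `X`. -/
theorem exists_rootGroup (he : e ^ 2 = 1) (h1 : Commute e (conjPow X e 1))
    (h2 : Commute e (conjPow X e 2)) (h5 : conjPow X e 5 = conjPow X e 2 * e) :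
    ∃ E : (Fin 5 → Multiplicative (ZMod 2)) →* A, e ∈ E.range ∧
      (∀ u ∈ E.range, ∀ n : ℤ, conjPow X u n ∈ E.range) ∧
      ∀ u ∈ E.range, u = 1 ∨ ∃ n : ℤ, u = conjPow X e n := by
  have he' : ∀ i : ℤ, conjPow X e i ^ 2 = 1 := fun i => by
    rw [← conjPow_pow, he]
    simp [conjPow]
  have hc := commute_conjPow h1 h2 h5
  let φ : Fin 5 → Multiplicative (ZMod 2) →* A := fun i =>
    involutionHom (conjPow X e (i : ℕ)) (he' _)
  have hφ : Pairwise fun i j => ∀ x y, Commute (φ i x) (φ j y) := fun i j _ x y =>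
    ((hc i j).pow_left _).pow_right _
  obtain ⟨E, hE⟩ : ∃ E : (Fin 5 → Multiplicative (ZMod 2)) →* A,
      ∀ i : Fin 5, E (Pi.mulSingle i (Multiplicative.ofAdd 1)) = conjPow X e (i : ℕ) :=
    ⟨MonoidHom.noncommPiCoprod φ hφ, fun i =>
      (MonoidHom.noncommPiCoprod_mulSingle (ϕ := φ) (hcomm := hφ) i _).trans (pow_one _)⟩
  have hE0 : E (Pi.mulSingle 0 (Multiplicative.ofAdd 1)) = e := by
    rw [hE]
    exact conjPow_zero X e
  have hshift : ∀ v, conjPow X (E v) 1 = E (shiftHom v) := by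
    have : (MulAut.conj (X ^ (1 : ℤ))).toMonoidHom.comp E = E.comp shiftHom := by
      refine MonoidHom.pi_ext fun i x => ?_
      obtain rfl | rfl : x = 1 ∨ x = Multiplicative.ofAdd 1 := by revert x; decide
      · simp
      · change conjPow X (E _) 1 = E _
        rw [hE, ← conjPow_add]
        fin_cases i
        · exact (hE 1).symm.trans (congrArg E (by decide))
        · exact (hE 2).symm.trans (congrArg E (by decide))
        · exact (hE 3).symm.trans (congrArg E (by decide))
        · exact (hE 4).symm.trans (congrArg E (by decide))
        · refine (h5.trans (congrArg₂ (· * ·) (hE 2).symm hE0.symm)).trans ?_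
          exact (map_mul E _ _).symm.trans (congrArg E (by decide))
    exact fun v => DFunLike.congr_fun this v
  have hiter : ∀ (n : ℕ) v, conjPow X (E v) n = E (shiftHom^[n] v) := by
    intro n v
    induction n with
    | zero => simp [conjPow_zero]
    | succ n ih =>
      rw [Nat.cast_succ, add_comm, conjPow_add, ih, hshift, Function.iterate_succ_apply']
  have hperiod : ∀ v, shiftHom^[31] v = v := by decide +kernel
  refine ⟨E, ⟨_, hE0⟩, ?_, ?_⟩
  · rintro _ ⟨v, rfl⟩ n
    have hn : ∃ m : ℕ, conjPow X (E v) n = conjPow X (E v) m := by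
      have h31 : ∀ m : ℕ, conjPow X (E v) ((31 * m : ℕ) : ℤ) = E v := fun m => by
        rw [hiter, Function.iterate_mul, Function.iterate_fixed (hperiod v)]
      refine ⟨(n + 31 * (n.natAbs : ℤ)).toNat, ?_⟩
      rw [Int.toNat_of_nonneg (by omega), conjPow_add]
      congr 1
      exact_mod_cast (h31 n.natAbs).symm
    obtain ⟨m, hm⟩ := hn
    exact ⟨_, by rw [hm, hiter]⟩
  · rintro _ ⟨v, rfl⟩
    by_cases hv : v = 1
    · exact Or.inl (by rw [hv, map_one])
    · obtain ⟨i, hi⟩ := exists_iterate_shiftHom v hv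
      exact Or.inr ⟨(i : ℕ), by rw [← hi, ← hiter, hE0]⟩

end TorusAndInvolution

section BruhatNormalForm

variable {A : Type*} [Group A] {X W e : A}

theorem mul_zpow_eq_zpow_mul_conjPow (X u : A) (n : ℤ) : u * X ^ n = X ^ n * conjPow X u (-n) := by
  simp [conjPow, mul_assoc]

theorem mul_zpow_eq_zpow_neg_mul (hWX : W * X * W⁻¹ = X⁻¹) (n : ℤ) : W * X ^ n = X ^ (-n) * W := by
  have h : MulAut.conj W (X ^ n) = X ^ (-n) := by
    rw [map_zpow, MulAut.conj_apply, hWX, inv_zpow, zpow_neg]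
  rw [← h, MulAut.conj_apply, inv_mul_cancel_right]

/-- A group generated by a torus of order 31, a suitable involution and a suitable root group
satisfies a Bruhat decomposition, so that it has at most `31 * 32 * 33` elements. -/
theorem finite_of_torus_involution_root (hX : X ^ 31 = 1) (hW : W ^ 2 = 1)
    (hWX : W * X * W⁻¹ = X⁻¹) (hWe : (W * e) ^ 3 = 1) (he : e ^ 2 = 1)
    (h1 : Commute e (conjPow X e 1)) (h2 : Commute e (conjPow X e 2))
    (h5 : conjPow X e 5 = conjPow X e 2 * e) (htop : Subgroup.closure {X, W, e} = ⊤) :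
    Finite A ∧ Nat.card A ≤ 32736 := by
  obtain ⟨E, heE, hconj, hcases⟩ := exists_rootGroup he h1 h2 h5
  let B : A → Prop := fun g => ∃ n : ℤ, ∃ u ∈ E.range, g = X ^ n * u
  let P : A → Prop := fun g => ∃ b, B b ∧ (g = b ∨ ∃ u ∈ E.range, g = b * W * u)
  have hW' : W⁻¹ = W := inv_eq_of_mul_eq_one_right (by rw [← pow_two, hW])
  have he' : e⁻¹ = e := inv_eq_of_mul_eq_one_right (by rw [← pow_two, he])
  have hbraid : W * e * W = e * W * e := by
    have h : W * e * W = (e * W * e)⁻¹ * (e * (W * e) ^ 3 * e⁻¹) := by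
      simp only [pow_succ, pow_zero, one_mul, mul_inv_rev]
      group
    rw [h, hWe, mul_one, mul_inv_cancel, mul_one, mul_inv_rev, mul_inv_rev, hW', he', mul_assoc]
  have hBX : ∀ b, B b → ∀ m : ℤ, B (b * X ^ m) := by
    rintro _ ⟨n, u, hu, rfl⟩ m
    exact ⟨n + m, _, hconj u hu (-m), by
      rw [mul_assoc, mul_zpow_eq_zpow_mul_conjPow, ← mul_assoc, zpow_add]⟩
  have hBe : ∀ b, B b → ∀ v ∈ E.range, B (b * v) := by
    rintro _ ⟨n, u, hu, rfl⟩ v hv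
    exact ⟨n, _, mul_mem hu hv, mul_assoc _ _ _⟩
  have hPX : ∀ g, P g → ∀ m : ℤ, P (g * X ^ m) := by
    rintro g ⟨b, hb, rfl | ⟨u, hu, rfl⟩⟩ m
    · exact ⟨_, hBX _ hb m, Or.inl rfl⟩
    · refine ⟨_, hBX b hb (-m), Or.inr ⟨_, hconj u hu (-m), ?_⟩⟩
      rw [mul_assoc _ u, mul_zpow_eq_zpow_mul_conjPow, ← mul_assoc, mul_assoc _ W,
        mul_zpow_eq_zpow_neg_mul hWX, ← mul_assoc]
  have hPe : ∀ g, P g → ∀ v ∈ E.range, P (g * v) := by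
    rintro g ⟨b, hb, rfl | ⟨u, hu, rfl⟩⟩ v hv
    · exact ⟨_, hBe _ hb v hv, Or.inl rfl⟩
    · exact ⟨b, hb, Or.inr ⟨_, mul_mem hu hv, mul_assoc _ _ _⟩⟩
  have hPW : ∀ g, P g → P (g * W) := by
    rintro g ⟨b, hb, rfl | ⟨u, hu, rfl⟩⟩
    · exact ⟨_, hb, Or.inr ⟨1, one_mem _, (mul_one _).symm⟩⟩
    · obtain rfl | ⟨k, rfl⟩ := hcases u hu
      · exact ⟨b, hb, Or.inl (by rw [mul_one, mul_assoc, ← pow_two, hW, mul_one])⟩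
      · have h4 : W * conjPow X e k * W = X ^ (-k) * e * X ^ (-k) * (W * conjPow X e (-k)) := by
          have h6 : X ^ (-k) * W = W * X ^ k := (mul_zpow_eq_zpow_neg_mul hWX k).symm
          calc W * conjPow X e k * W = W * X ^ k * e * (X ^ (-k) * W) := by
                simp [conjPow, mul_assoc]
            _ = X ^ (-k) * (W * e * W) * X ^ k := by
                rw [← h6]
                nth_rewrite 2 [h6]
                simp only [mul_assoc]
            _ = X ^ (-k) * e * (W * X ^ k) * (X ^ (-k) * e * X ^ k) := by
                rw [hbraid]
                simp [mul_assoc]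
            _ = _ := by
                rw [← h6]
                simp [conjPow, mul_assoc]
        refine ⟨_, hBX _ (hBe _ (hBX b hb (-k)) e heE) (-k),
          Or.inr ⟨conjPow X e (-k), hconj e heE _, ?_⟩⟩
        rw [mul_assoc b, mul_assoc b, h4]
        simp only [mul_assoc]
  have hP : ∀ g, P g := by
    intro g
    have hg : g ∈ Subgroup.closure {X, W, e} := htop ▸ Subgroup.mem_top g
    induction hg using Subgroup.closure_induction_right with
    | one => exact ⟨1, ⟨0, 1, one_mem _, by simp⟩, Or.inl rfl⟩
    | mul_right g _ y hy ih =>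
      obtain rfl | rfl | rfl := hy
      · simpa using hPX g ih 1
      · exact hPW g ih
      · exact hPe g ih _ heE
    | mul_inv_cancel g _ y hy ih =>
      obtain rfl | rfl | rfl := hy
      · simpa using hPX g ih (-1)
      · rw [hW']
        exact hPW g ih
      · exact hPe g ih _ (inv_mem heE)
  let V := Fin 5 → Multiplicative (ZMod 2)
  let f : Fin 31 × V × Option V → A := fun p =>
    X ^ (p.1 : ℕ) * E p.2.1 * p.2.2.elim 1 fun v => W * E v
  have hf : Function.Surjective f := by
    intro g
    have hmod : ∀ n : ℤ, ∃ i : Fin 31, X ^ (i : ℕ) = X ^ n := fun n =>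
      ⟨⟨(n % 31).toNat, by omega⟩, by
        rw [← zpow_natCast, Int.toNat_of_nonneg (by omega)]
        conv_rhs => rw [← Int.mul_ediv_add_emod n 31, zpow_add, zpow_mul]
        rw [show X ^ (31 : ℤ) = 1 from mod_cast hX, one_zpow, one_mul]⟩
    obtain ⟨_, ⟨n, _, ⟨v, rfl⟩, rfl⟩, hg⟩ := hP g
    obtain ⟨i, hi⟩ := hmod n
    obtain rfl | ⟨_, ⟨v', rfl⟩, rfl⟩ := hg
    · exact ⟨(i, v, none), by simp [f, hi]⟩
    · exact ⟨(i, v, some v'), by simp [f, hi, mul_assoc]⟩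
  refine ⟨Finite.of_surjective f hf, (Nat.card_le_card_of_surjective f hf).trans_eq ?_⟩
  simp [V]

end BruhatNormalForm

section CentralExtension

open scoped commutatorElement

variable {A Q : Type*} [Group A] [Group Q] {π : A →* Q} {X η w : A}

theorem conj_eq_conj_of_map_eq (hπ : ∀ z, π z = 1 → ∀ g, Commute z g) {g h : A}
    (hgh : π g = π h) (k : A) : g * k * g⁻¹ = h * k * h⁻¹ := by
  have h1 := (hπ (h⁻¹ * g) (by rw [map_mul, map_inv, hgh, inv_mul_cancel]) k).eq
  calc g * k * g⁻¹ = h * (h⁻¹ * g * k) * g⁻¹ := by group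
    _ = h * k * h⁻¹ := by rw [h1]; group

theorem commutator_eq_of_map_eq (hπ : ∀ z, π z = 1 → ∀ g, Commute z g) {g h : A}
    (hgh : π g = π h) (k : A) : ⁅g, k⁆ = ⁅h, k⁆ := by
  rw [commutatorElement_def, commutatorElement_def, conj_eq_conj_of_map_eq hπ hgh]

theorem eq_one_of_recurrence (β : ℤ → A) (h0 : β 0 = 1) (hsq : ∀ n, β n * β n = 1)
    (hneg : ∀ n, β (-n) = β n) (hrec : ∀ n, β (n + 5) = β (n + 2) * β n) :
    β 1 = 1 ∧ β 2 = 1 ∧ β 4 = 1 ∧ β (-8) = 1 := by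
  have h4 : β 4 = 1 := by
    rw [← hsq 1, ← hneg 1]
    nth_rewrite 1 [hneg 1]
    exact hrec (-1)
  have h3 : β 3 = β 2 := by
    rw [← hneg 2, ← one_mul (β (-2)), ← h0]
    exact hrec (-2)
  have h1 : β 1 = 1 := by
    have h : β 2 = β 1 * β 2 := by
      conv_rhs => rw [← hneg 1, ← h3, ← hneg 3]
      exact hrec (-3)
    exact mul_eq_right.mp h.symm
  have h2 : β 2 = 1 := by
    have h : β 1 = β 2 * β 4 := by
      rw [← hneg 2, ← hneg 4]
      exact hrec (-4)
    rw [← h1, h, h4, mul_one]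
  refine ⟨h1, h2, h4, ?_⟩
  rw [hneg, show (8 : ℤ) = 3 + 5 from rfl, hrec, h3, h2, mul_one, show (3 : ℤ) + 2 = 0 + 5 from rfl,
    hrec, zero_add, h2, h0, one_mul]

/-- The root group lifts to a central extension: if `η` satisfies the relations of
`exists_rootGroup` modulo central elements, then it has a modification satisfying them. -/
theorem exists_lift_root (hπ : ∀ z, π z = 1 → ∀ g, Commute z g) (hη : π η ^ 2 = 1)
    (h1 : Commute (π η) (conjPow (π X) (π η) 1)) (h2 : Commute (π η) (conjPow (π X) (π η) 2))
    (h5 : conjPow (π X) (π η) 5 = conjPow (π X) (π η) 2 * π η)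
    (h10 : conjPow (π X) (π η) 10 = π η * conjPow (π X) (π η) 4) :
    ∃ u : A, π u = π η ∧ u ^ 2 = 1 ∧ Commute u (conjPow X u 1) ∧ Commute u (conjPow X u 2) ∧
      conjPow X u 5 = conjPow X u 2 * u := by
  obtain ⟨d, hd⟩ : ∃ d, d = η * (conjPow X η 4)⁻¹ := ⟨_, rfl⟩
  obtain ⟨u, hu⟩ : ∃ u, u = conjPow X d (-10) := ⟨_, rfl⟩
  have hinv : π η⁻¹ = π η := by
    rw [map_inv]
    exact inv_eq_of_mul_eq_one_right (by rw [← pow_two, hη])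
  have hd' : conjPow X u 10 = d := by
    rw [hu, ← conjPow_add, add_neg_cancel, conjPow_zero]
  have hfix : ∀ z, π z = 1 → ∀ n, conjPow X z n = z := fun z hz n => by
    rw [conjPow, ← (hπ z hz _).eq, mul_inv_cancel_right]
  have hπu : ∀ n, π (conjPow X u n) = π (conjPow X η n) := by
    have h : π u = π η := by
      have h4 : (conjPow X η 4)⁻¹ = conjPow X η⁻¹ 4 := by simp [conjPow, mul_assoc]
      rw [hu, map_conjPow, hd, map_mul, h4, map_conjPow, hinv, ← h10, ← conjPow_add,
        neg_add_cancel, conjPow_zero]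
    intro n
    rw [map_conjPow, map_conjPow, h]
  have hπu0 : π u = π η := by simpa [conjPow_zero] using hπu 0
  have hcomm := commute_conjPow h1 h2 h5
  have hβ : ∀ n, π ⁅conjPow X u n, u⁆ = 1 := fun n => by
    rw [map_commutatorElement, hπu, hπu0, map_conjPow]
    exact commutatorElement_eq_one_iff_commute.mpr (by simpa [conjPow_zero] using hcomm n 0)
  have hmul : ∀ g h k : A, π ⁅h, k⁆ = 1 → ⁅g * h, k⁆ = ⁅g, k⁆ * ⁅h, k⁆ := fun g h k hz => by
    rw [← (hπ _ hz _).eq]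
    have := (hπ _ hz g).eq
    calc ⁅g * h, k⁆ = g * ⁅h, k⁆ * k * g⁻¹ * k⁻¹ := by simp only [commutatorElement_def]; group
      _ = ⁅h, k⁆ * ⁅g, k⁆ := by rw [← this]; simp only [commutatorElement_def]; group
  have hsq : ∀ n, ⁅conjPow X u n, u⁆ * ⁅conjPow X u n, u⁆ = 1 := fun n => by
    rw [← hmul _ _ _ (hβ n), commutator_eq_of_map_eq hπ (h := 1), commutatorElement_one_left]
    rw [map_mul, hπu, ← map_mul, ← conjPow_mul, map_conjPow, map_mul, ← pow_two, hη]
    simp [conjPow]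
  have hneg : ∀ n, ⁅conjPow X u (-n), u⁆ = ⁅conjPow X u n, u⁆ := fun n => by
    rw [← hfix _ (hβ (-n)) n, conjPow_eq_conj, map_commutatorElement, ← conjPow_eq_conj,
      ← conjPow_eq_conj, ← conjPow_add, add_neg_cancel, conjPow_zero, ← commutatorElement_inv]
    exact inv_eq_of_mul_eq_one_right (hsq n)
  have hrec : ∀ n, ⁅conjPow X u (n + 5), u⁆ = ⁅conjPow X u (n + 2), u⁆ * ⁅conjPow X u n, u⁆ :=
    fun n => by
    rw [← hmul _ _ _ (hβ n)]
    refine commutator_eq_of_map_eq hπ ?_ _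
    rw [map_mul, hπu, hπu, hπu, map_conjPow, map_conjPow, map_conjPow, conjPow_add, h5,
      conjPow_mul, ← conjPow_add]
  obtain ⟨b1, b2, b4, b8⟩ := eq_one_of_recurrence (fun n => ⁅conjPow X u n, u⁆)
    (by simp [conjPow_zero]) hsq hneg hrec
  have hc : ∀ {n : ℤ}, ⁅conjPow X u n, u⁆ = 1 → Commute u (conjPow X u n) := fun h =>
    (commutatorElement_eq_one_iff_commute.mp h).symm
  refine ⟨u, hπu0, ?_, hc b1, hc b2, ?_⟩
  · have hη4 : Commute η (conjPow X η 4) := by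
      have h := commutator_eq_of_map_eq hπ (hπu 4) u
      rw [b4, ← commutatorElement_inv, eq_comm, inv_eq_one, commutator_eq_of_map_eq hπ hπu0] at h
      exact commutatorElement_eq_one_iff_commute.mp h
    rw [hu, ← conjPow_pow, hd, hη4.inv_right.mul_pow, inv_pow, ← conjPow_pow,
      hfix (η ^ 2) (by rw [map_pow, hη]), mul_inv_cancel]
    simp [conjPow]
  · obtain ⟨c, hc5⟩ : ∃ c, conjPow X η 5 = conjPow X η 2 * η * c := ⟨_, by rw [mul_inv_cancel_left]⟩
    have hc1 : π c = 1 := by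
      have h := congrArg π hc5
      rwa [map_mul, map_mul, map_conjPow, map_conjPow, h5, left_eq_mul] at h
    have hd5 : conjPow X d 5 = conjPow X η 2 * d * (conjPow X η 2)⁻¹ * conjPow X d 2 := by
      have hη9 : conjPow X η (5 + 4) = conjPow X η (2 + 4) * conjPow X η 4 * c := by
        rw [add_comm, conjPow_add, hc5, conjPow_mul, conjPow_mul, ← conjPow_add, hfix c hc1,
          add_comm]
      have hdn : ∀ n, conjPow X d n = conjPow X η n * (conjPow X η (n + 4))⁻¹ := fun n => by
        rw [hd, conjPow_add]
        simp [conjPow, mul_assoc]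
      rw [hdn, hdn, hη9, hc5, hd]
      simp [mul_assoc]
    calc conjPow X u 5 = conjPow X (conjPow X d 5) (-10) := by
          rw [hu, ← conjPow_add, ← conjPow_add, add_comm]
      _ = conjPow X η (-8) * u * (conjPow X η (-8))⁻¹ * conjPow X u 2 := by
          rw [hd5, hu, ← conjPow_add]
          simp only [conjPow_eq_conj, map_mul, map_inv]
          simp only [← conjPow_eq_conj, ← conjPow_add]
          rfl
      _ = conjPow X u 2 * u := by
          rw [conj_eq_conj_of_map_eq hπ (hπu (-8)).symm, (hc b8).symm.eq, mul_inv_cancel_right,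
            (hc b2).eq]

/-- A group which satisfies the hypotheses of `finite_of_torus_involution_root` only modulo
central elements, but is the normal closure of its torus. -/
theorem finite_of_central_extension (hπ : ∀ z, π z = 1 → ∀ g, Commute z g)
    (hX : X ^ 31 = 1) (hwX : w * X * w⁻¹ = X⁻¹) (hw : π w ^ 2 = 1) (hwη : (π w * π η) ^ 3 = 1)
    (hη : π η ^ 2 = 1)
    (h1 : Commute (π η) (conjPow (π X) (π η) 1)) (h2 : Commute (π η) (conjPow (π X) (π η) 2))
    (h5 : conjPow (π X) (π η) 5 = conjPow (π X) (π η) 2 * π η)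
    (h10 : conjPow (π X) (π η) 10 = π η * conjPow (π X) (π η) 4)
    (hnc : Subgroup.normalClosure {X} = ⊤)
    (hgen : ∀ g, π g ∈ Subgroup.closure {π X, π w, π η}) :
    Finite A ∧ Nat.card A ≤ 32736 := by
  obtain ⟨u, hu, hu2, c1, c2, c5⟩ := exists_lift_root hπ hη h1 h2 h5 h10
  have hwi : (π w)⁻¹ = π w := inv_eq_of_mul_eq_one_right (by rw [← pow_two, hw])
  obtain ⟨n, hn⟩ : ∃ n, n = w * u * w⁻¹ := ⟨_, rfl⟩
  have hn2 : n * n = 1 := by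
    rw [hn, ← pow_two, ← MulAut.conj_apply, ← map_pow, hu2, map_one]
  obtain ⟨W, hW⟩ : ∃ W, W = u * n * u := ⟨_, rfl⟩
  have hWw : π W = π w := by
    have h : π w * (π η * (π w * (π η * (π w * π η)))) = 1 := by
      rw [← hwη]
      simp only [pow_succ, pow_zero, one_mul, mul_assoc]
    rw [← hwi, inv_eq_of_mul_eq_one_right h, hW, hn]
    simp only [map_mul, map_inv, hu, hwi, mul_assoc]
  have hWn : W * u = n * W := by
    rw [← mul_inv_eq_iff_eq_mul, conj_eq_conj_of_map_eq hπ hWw, hn]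
  have hbraid : n * W = u * n := by
    rw [← hWn, hW, mul_assoc, ← pow_two, hu2, mul_one]
  have hWW : W * W = 1 := by
    calc W * W = u * n * (u * u) * n * u := by rw [hW]; simp only [mul_assoc]
      _ = 1 := by rw [← pow_two, hu2, mul_one, mul_assoc u, hn2, mul_one, ← pow_two, hu2]
  refine finite_of_torus_involution_root hX (by rw [pow_two, hWW])
    (by rw [conj_eq_conj_of_map_eq hπ hWw, hwX]) ?_ hu2 c1 c2 c5 ?_
  · calc (W * u) ^ 3 = u * n * u * (n * (u * n)) := by
          rw [hWn, hbraid]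
          simp only [pow_succ, pow_zero, one_mul, mul_assoc]
      _ = 1 := by rw [← hW, ← hbraid, ← mul_assoc n, hn2, one_mul, hWW]
  · rw [eq_top_iff, ← hnc, Subgroup.normalClosure, Subgroup.closure_le]
    intro y hy
    obtain ⟨x, hx, hxy⟩ := Group.mem_conjugatesOfSet_iff.mp hy
    rw [Set.mem_singleton_iff.mp hx] at hxy
    obtain ⟨g, rfl⟩ := isConj_iff.mp hxy
    have hg : π g ∈ (Subgroup.closure {X, W, u}).map π := by
      rw [MonoidHom.map_closure, Set.image_insert_eq, Set.image_pair, hWw, hu]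
      exact hgen g
    obtain ⟨s, hs, hsg⟩ := hg
    rw [← conj_eq_conj_of_map_eq hπ hsg]
    have hXs := Subgroup.subset_closure (Set.mem_insert X {W, u})
    exact mul_mem (mul_mem hs hXs) (inv_mem hs)

end CentralExtension

/-! ### The relations of the two factors -/

namespace SWord

/-- The conjugate of a word by a power of the letter 0. -/
def conj (n : ℕ) (w : SWord) : SWord := (0, n) :: (w ++ [(0, 30 * n)])

/-- The commutator of two words. -/
def comm (v w : SWord) : SWord := v ++ (w ++ (inv v ++ inv w))

/-- A word for the fourth power of a generator of one of the tori. -/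
def torusWord : SWord := [(1, 2), (0, 5), (1, 15), (2, 4), (0, 15), (2, 5)]

/-- A word for an element of a root group. -/
def rootWord : SWord := [(1, 27), (0, 1), (1, 6)]

/-- A word for an involution normalizing the tori. -/
def weylWord : SWord := [(1, 2), (0, 5), (1, 15)]

/-- A word for an element conjugating the letter 0 into the letter 2 in one of the factors. -/
def linkWord : SWord := [(0, 29), (1, 30)]

variable {G : Type*} [Group G] {c : ℕ → G}

theorem eval_conj (hc : ∀ j, c j ^ 31 = 1) (n : ℕ) (w : SWord) :
    eval c (conj n w) = conjPow (c 0) (eval c w) n := by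
  have h : c 0 ^ (30 * n) = (c 0 ^ n)⁻¹ := by
    rw [eq_inv_iff_mul_eq_one, ← pow_add, show 30 * n + n = 31 * n by ring, pow_mul, hc, one_pow]
  simp [conj, conjPow, h, mul_assoc]

theorem commute_of_eval_comm (hc : ∀ j, c j ^ 31 = 1) {v w : SWord} (h : eval c (comm v w) = 1) :
    Commute (eval c v) (eval c w) := by
  rw [comm, eval_append, eval_append, eval_append, eval_inv hc, eval_inv hc, ← mul_inv_rev,
    ← mul_assoc, mul_inv_eq_one] at h
  exact h

theorem eval_eq_of_append_inv (hc : ∀ j, c j ^ 31 = 1) {v w : SWord}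
    (h : eval c (v ++ inv w) = 1) : eval c v = eval c w := by
  rwa [eval_append, eval_inv hc, mul_inv_eq_one] at h

end SWord

namespace IsFlipPair

open SWord

variable {G : Type*} [Group G] {a b : G}

theorem eval_root_sq (h : IsFlipPair flipTable a b) :
    eval (fun j => conjPow a b j) (rootWord ++ rootWord) = 1 :=
  h.eval_eq_one _
    [(1, 0, 29, 0)]
    (by decide +kernel)

theorem eval_root_comm_one (h : IsFlipPair flipTable a b) :
    eval (fun j => conjPow a b j) (comm rootWord (conj 1 rootWord)) = 1 :=
  h.eval_eq_one _
    [(0, 0, 4, 1), (1, 0, 8, 1), (2, 0, 19, 0), (16, 0, 6, 1), (2, 0, 13, 0), (13, 0, 24, 0), (2,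
    0, 6, 1), (2, 0, 6, 0), (1, 0, 19, 0), (12, 0, 3, 1), (9, 0, 6, 1), (3, 0, 9, 1), (1, 0, 13,
    1), (3, 0, 9, 1), (6, 0, 19, 0), (1, 0, 6, 0), (3, 0, 29, 0), (1, 0, 27, 0), (3, 0, 26, 0),
    (4, 0, 4, 1), (4, 0, 30, 0), (5, 0, 24, 0), (2, 0, 17, 1), (2, 0, 11, 0), (1, 0, 3, 0)]
    (by decide +kernel)

theorem eval_root_comm_two (h : IsFlipPair flipTable a b) :
    eval (fun j => conjPow a b j) (comm rootWord (conj 2 rootWord)) = 1 :=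
  h.eval_eq_one _
    [(4, 0, 4, 1), (2, 0, 5, 0), (15, 0, 22, 0), (10, 0, 27, 1), (2, 0, 9, 0), (13, 0, 26, 0),
    (10, 0, 27, 1), (2, 0, 28, 0), (1, 0, 7, 0), (3, 0, 14, 0), (1, 0, 25, 0), (1, 0, 16, 0), (3,
    0, 1, 0), (5, 0, 1, 0), (3, 0, 30, 0), (1, 0, 6, 0), (3, 0, 15, 0), (3, 0, 30, 0), (1, 0, 4,
    0), (3, 0, 3, 0), (2, 0, 17, 1), (1, 0, 24, 1)]
    (by decide +kernel)

theorem eval_root_five (h : IsFlipPair flipTable a b) :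
    eval (fun j => conjPow a b j)
      (conj 5 rootWord ++ SWord.inv (conj 2 rootWord ++ rootWord)) = 1 :=
  h.eval_eq_one _
    [(4, 0, 17, 0), (2, 0, 20, 1), (2, 0, 30, 0), (11, 0, 12, 0), (9, 0, 29, 0), (4, 0, 28, 1),
    (9, 0, 29, 1), (1, 0, 5, 1), (7, 0, 6, 1), (2, 0, 12, 0), (7, 0, 13, 0), (5, 0, 2, 0), (5, 0,
    2, 0), (5, 0, 13, 0), (1, 0, 30, 0), (6, 0, 2, 1), (1, 0, 30, 1)]
    (by decide +kernel)

theorem eval_root_ten (h : IsFlipPair flipTable a b) :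
    eval (fun j => conjPow a b j)
      (conj 10 rootWord ++ SWord.inv (rootWord ++ conj 4 rootWord)) = 1 :=
  h.eval_eq_one _
    [(9, 0, 6, 1), (2, 0, 19, 0), (1, 0, 6, 0), (12, 0, 27, 1), (1, 0, 29, 1), (1, 0, 9, 1), (2,
    0, 28, 0), (2, 0, 14, 1), (3, 0, 20, 1), (2, 0, 1, 0), (4, 0, 11, 1), (5, 0, 4, 1), (2, 0, 3,
    0), (2, 0, 17, 1), (1, 0, 24, 1)]
    (by decide +kernel)

theorem eval_weyl_sq (h : IsFlipPair flipTable a b) :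
    eval (fun j => conjPow a b j) (weylWord ++ weylWord) = 1 :=
  h.eval_eq_one _
    [(1, 0, 14, 0)]
    (by decide +kernel)

theorem eval_weyl_root (h : IsFlipPair flipTable a b) :
    eval (fun j => conjPow a b j)
      (weylWord ++ (rootWord ++ (weylWord ++ (rootWord ++ (weylWord ++ rootWord))))) = 1 :=
  h.eval_eq_one _
    [(3, 0, 29, 0), (10, 0, 23, 1), (11, 0, 20, 1), (2, 0, 9, 0), (2, 0, 30, 1), (2, 0, 22, 0),
    (2, 0, 25, 1), (1, 0, 15, 1), (3, 0, 22, 1), (2, 0, 20, 0), (4, 0, 2, 1), (6, 0, 18, 0), (1,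
    0, 2, 0), (3, 0, 20, 0), (2, 0, 16, 1), (3, 0, 26, 1), (1, 0, 20, 1), (3, 0, 16, 1), (1, 0,
    24, 1)]
    (by decide +kernel)

theorem eval_bruhat (h : IsFlipPair flipTable a b) :
    eval (fun j => conjPow a b j)
      (SWord.inv [(1, 1)] ++
        (0, 23) :: (rootWord ++ (0, 4) :: (weylWord ++ (rootWord ++ [(0, 6)])))) = 1 :=
  h.eval_eq_one _
    [(8, 0, 20, 1), (2, 0, 18, 0), (2, 0, 7, 1), (5, 0, 25, 1), (1, 0, 12, 1), (3, 0, 25, 1), (1,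
    0, 2, 1), (3, 0, 4, 1), (6, 0, 19, 0), (3, 0, 5, 0), (1, 0, 28, 0), (3, 0, 20, 0), (4, 0, 6,
    1), (2, 0, 8, 0), (5, 0, 5, 0), (2, 0, 12, 1), (2, 0, 3, 0), (2, 0, 3, 1), (1, 0, 16, 1)]
    (by decide +kernel)

theorem eval_torus_mul_swap (h : IsFlipPair flipTable a b) :
    eval (fun j => conjPow a b j) (torusWord ++ (swap torusWord ++ [(0, 27)])) = 1 :=
  h.eval_eq_one _
    [(0, 0, 29, 1), (11, 0, 26, 1), (2, 0, 16, 0), (2, 0, 17, 1), (2, 0, 16, 0), (2, 2, 18, 0),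
    (9, 0, 13, 0), (2, 0, 16, 1), (4, 2, 6, 0), (2, 2, 20, 1), (1, 2, 13, 1), (3, 2, 29, 1), (1,
    2, 11, 1), (2, 2, 30, 0), (3, 2, 17, 0), (2, 2, 5, 1), (9, 2, 15, 1), (1, 2, 11, 1), (3, 0, 1,
    0), (4, 0, 15, 1), (1, 0, 18, 1), (2, 0, 19, 0), (6, 0, 26, 1), (1, 0, 11, 1), (6, 0, 18, 0),
    (1, 0, 25, 0)]
    (by decide +kernel)

theorem eval_torus_comm (h : IsFlipPair flipTable a b) :
    eval (fun j => conjPow a b j) (comm torusWord [(0, 1)]) = 1 :=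
  h.eval_eq_one _
    [(12, 0, 2, 1), (1, 0, 13, 1), (3, 0, 14, 1), (1, 0, 2, 1), (4, 2, 16, 1), (4, 2, 17, 0), (7,
    2, 13, 0), (5, 2, 17, 0), (5, 2, 13, 0), (1, 2, 16, 0)]
    (by decide +kernel)

theorem eval_torus_comm_one (h : IsFlipPair flipTable a b) :
    eval (fun j => conjPow a b j) (comm torusWord (shift 1 (swap torusWord))) = 1 :=
  h.eval_eq_one _
    [(21, 0, 1, 0), (2, 0, 28, 1), (1, 0, 27, 1), (2, 0, 8, 0), (3, 0, 7, 0), (1, 0, 16, 0), (3,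
    0, 29, 0), (19, 0, 17, 0), (1, 0, 18, 0), (17, 1, 4, 1), (1, 1, 1, 1), (3, 1, 26, 1), (3, 2,
    18, 0), (16, 2, 17, 0), (1, 2, 29, 0), (13, 1, 9, 0), (2, 2, 16, 0), (12, 1, 26, 1), (4, 2,
    17, 0), (13, 1, 1, 0), (2, 2, 29, 0), (11, 1, 8, 0), (2, 1, 27, 1), (1, 1, 7, 1), (3, 1, 28,
    1), (1, 2, 20, 0), (2, 2, 13, 1), (2, 2, 12, 0), (13, 2, 6, 0), (7, 1, 4, 1), (12, 0, 9, 0),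
    (4, 1, 1, 0), (3, 2, 5, 1), (12, 1, 26, 1), (2, 1, 9, 0), (2, 1, 4, 1), (1, 1, 20, 1), (2, 1,
    7, 0), (3, 1, 20, 0), (2, 1, 18, 1), (1, 1, 2, 1), (15, 1, 2, 0), (2, 1, 11, 1), (1, 1, 2, 1),
    (3, 1, 18, 1), (1, 1, 20, 1), (3, 1, 24, 1), (1, 1, 16, 1), (14, 2, 16, 1), (13, 1, 25, 0),
    (3, 0, 9, 0), (13, 1, 15, 1), (1, 1, 9, 1), (3, 1, 7, 1), (1, 1, 16, 1), (3, 1, 8, 1), (2, 2,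
    16, 1), (10, 1, 8, 1), (2, 1, 1, 0), (2, 0, 9, 0), (2, 0, 14, 1), (3, 1, 14, 0), (2, 2, 5, 0),
    (9, 1, 16, 1), (1, 0, 26, 0), (2, 0, 25, 1), (3, 0, 11, 1), (1, 0, 18, 1), (3, 0, 2, 1), (1,
    0, 20, 1), (3, 0, 9, 1), (1, 0, 4, 1), (3, 0, 18, 1), (1, 0, 16, 1), (3, 0, 28, 1), (11, 0,
    30, 1), (9, 0, 12, 1), (1, 0, 6, 1), (3, 0, 13, 1), (11, 0, 20, 1), (6, 0, 11, 0), (1, 0, 24,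
    0), (3, 0, 11, 0), (2, 1, 15, 0), (5, 0, 29, 1), (3, 2, 16, 0), (3, 0, 27, 1), (9, 2, 20, 1),
    (2, 2, 24, 0), (1, 2, 18, 0), (11, 1, 1, 0), (0, 2, 29, 0), (9, 1, 17, 0), (2, 2, 26, 0), (1,
    2, 22, 0), (9, 0, 26, 1), (9, 2, 29, 0), (1, 2, 18, 0), (4, 2, 19, 1), (1, 2, 11, 1), (3, 2,
    1, 1), (11, 2, 2, 1), (1, 2, 28, 1), (3, 1, 17, 0), (1, 1, 24, 0), (3, 1, 3, 0), (1, 1, 4, 0),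
    (3, 1, 30, 0), (1, 1, 28, 0), (3, 1, 16, 0), (1, 1, 18, 0), (3, 1, 4, 0), (1, 1, 9, 0), (3, 1,
    20, 0), (1, 1, 2, 0), (3, 1, 18, 0), (2, 0, 28, 0), (2, 0, 1, 1), (1, 0, 27, 1), (3, 0, 3, 1),
    (1, 0, 6, 1), (3, 0, 22, 1), (1, 0, 16, 1), (3, 0, 24, 1), (8, 0, 20, 1), (5, 0, 20, 0), (1,
    2, 28, 1), (2, 1, 29, 1), (1, 1, 8, 1), (5, 1, 23, 1), (1, 1, 6, 1), (2, 1, 19, 0), (2, 1, 13,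
    1), (2, 1, 30, 0), (6, 1, 2, 1), (1, 1, 30, 1)]
    (by decide +kernel)

theorem eval_torus_comm_two (h : IsFlipPair flipTable a b) :
    eval (fun j => conjPow a b j) (comm torusWord (shift 2 (swap torusWord))) = 1 :=
  h.eval_eq_one _
    [(10, 2, 22, 0), (3, 2, 17, 0), (1, 2, 18, 0), (3, 2, 29, 0), (19, 2, 8, 0), (2, 2, 7, 1), (1,
    2, 27, 1), (3, 2, 28, 1), (18, 2, 1, 1), (15, 1, 30, 0), (2, 1, 27, 1), (2, 1, 30, 0), (1, 1,
    5, 0), (2, 1, 30, 1), (3, 1, 27, 1), (2, 1, 30, 0), (5, 0, 2, 1), (1, 0, 13, 1), (2, 0, 2, 0),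
    (17, 0, 2, 1), (2, 0, 14, 0), (1, 0, 13, 0), (3, 0, 2, 0), (1, 0, 16, 0), (13, 1, 9, 0), (2,
    1, 27, 1), (2, 0, 13, 1), (3, 2, 9, 0), (1, 0, 20, 1), (2, 0, 13, 0), (3, 0, 6, 0), (14, 0,
    12, 0), (10, 2, 16, 1), (5, 1, 8, 0), (1, 1, 27, 0), (15, 1, 28, 1), (1, 1, 7, 1), (1, 1, 16,
    1), (2, 0, 9, 1), (1, 1, 18, 0), (12, 2, 16, 1), (4, 1, 29, 1), (1, 1, 17, 1), (3, 1, 16, 1),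
    (3, 0, 14, 0), (1, 1, 18, 1), (2, 1, 28, 0), (2, 1, 6, 1), (3, 1, 28, 1), (2, 1, 4, 0), (1, 1,
    30, 0), (15, 1, 30, 1), (2, 1, 3, 0), (1, 1, 30, 0), (3, 1, 4, 0), (1, 1, 28, 0), (3, 1, 25,
    0), (1, 1, 9, 0), (14, 0, 9, 0), (1, 2, 16, 1), (12, 1, 24, 1), (2, 1, 22, 0), (1, 1, 16, 0),
    (3, 1, 6, 0), (1, 1, 9, 0), (3, 1, 12, 0), (2, 0, 9, 0), (3, 2, 5, 1), (12, 2, 16, 1), (11, 1,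
    29, 0), (11, 1, 12, 0), (7, 0, 14, 0), (0, 1, 5, 0), (2, 1, 9, 1), (2, 2, 17, 1), (2, 2, 24,
    0), (3, 2, 3, 0), (1, 2, 4, 0), (3, 2, 30, 0), (1, 2, 28, 0), (3, 2, 16, 0), (1, 2, 18, 0),
    (3, 2, 4, 0), (1, 2, 9, 0), (3, 2, 20, 0), (11, 2, 2, 0), (2, 2, 3, 1), (3, 1, 22, 0), (10, 2,
    25, 0), (2, 2, 3, 1), (8, 2, 8, 0), (1, 2, 7, 0), (3, 2, 27, 0), (11, 2, 28, 0), (1, 2, 1, 0),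
    (5, 2, 13, 0), (10, 0, 9, 1), (2, 0, 25, 0), (11, 0, 28, 0), (1, 0, 4, 0), (10, 1, 29, 1), (0,
    0, 1, 1), (10, 0, 17, 0), (0, 1, 26, 0), (4, 0, 15, 1), (9, 2, 17, 0), (9, 0, 1, 1), (2, 0,
    23, 0), (10, 0, 4, 0), (2, 0, 3, 1), (2, 0, 29, 0), (11, 0, 30, 0), (3, 1, 26, 1), (9, 0, 20,
    0), (2, 1, 25, 0), (2, 1, 11, 1), (1, 1, 18, 1), (3, 1, 2, 1), (1, 1, 20, 1), (3, 1, 9, 1),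
    (1, 1, 4, 1), (3, 1, 18, 1), (1, 1, 16, 1), (3, 1, 28, 1), (1, 1, 30, 1), (3, 1, 4, 1), (2, 2,
    20, 1), (2, 2, 29, 0), (1, 2, 13, 0), (3, 2, 11, 0), (1, 2, 7, 0), (3, 2, 15, 0), (1, 2, 9,
    0), (3, 2, 25, 0), (8, 2, 28, 0), (0, 0, 20, 0), (1, 2, 28, 1), (5, 1, 1, 0), (3, 1, 19, 0),
    (2, 1, 1, 1), (2, 1, 15, 0), (4, 1, 7, 1), (5, 1, 28, 1), (1, 1, 28, 1), (6, 1, 18, 0), (1, 1,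
    6, 0)]
    (by decide +kernel)

theorem eval_weyl_torus (h : IsFlipPair flipTable a b) :
    eval (fun j => conjPow a b j)
      (weylWord ++ (torusWord ++ (SWord.inv weylWord ++ torusWord))) = 1 :=
  h.eval_eq_one _
    [(1, 0, 14, 0), (2, 2, 16, 1)]
    (by decide +kernel)

theorem eval_link_torus (h : IsFlipPair flipTable a b) :
    eval (fun j => conjPow a b j)
      (linkWord ++ (torusWord ++ (SWord.inv linkWord ++ SWord.inv (shift 2 torusWord)))) = 1 :=
  h.eval_eq_one _
    [(7, 0, 30, 1), (8, 0, 14, 0), (1, 0, 16, 0), (3, 0, 26, 0), (1, 0, 20, 0), (3, 0, 26, 0), (1,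
    0, 16, 0), (3, 0, 14, 0), (1, 0, 1, 0), (13, 2, 17, 0), (7, 2, 14, 0), (1, 2, 2, 0), (4, 2,
    19, 1), (1, 2, 18, 1), (2, 2, 11, 0), (3, 2, 25, 0), (3, 1, 15, 1), (1, 1, 11, 1), (3, 1, 5,
    1), (10, 1, 5, 1), (0, 0, 14, 1), (10, 1, 29, 1), (1, 0, 30, 0), (2, 0, 17, 1), (3, 0, 15, 1),
    (10, 0, 13, 1), (2, 0, 4, 0), (2, 0, 12, 1), (11, 0, 14, 1), (9, 2, 14, 0), (2, 2, 18, 1),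
    (10, 2, 15, 1), (4, 2, 1, 1), (7, 2, 29, 1), (3, 1, 17, 0), (1, 1, 19, 0), (3, 1, 27, 0), (1,
    1, 16, 0), (3, 1, 16, 0), (3, 0, 18, 1), (6, 0, 1, 0), (1, 2, 29, 1), (2, 0, 9, 1), (2, 0, 8,
    0), (1, 0, 14, 0), (3, 0, 5, 0), (1, 0, 12, 0), (2, 1, 8, 0), (1, 1, 24, 0), (2, 1, 6, 1), (3,
    1, 1, 1), (2, 1, 13, 0), (1, 1, 17, 0)]
    (by decide +kernel)

end IsFlipPair

/-! ### The two factors -/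

namespace IsFlipPair

open SWord

variable {G : Type*} [Group G] {a b : G}

/-- A power of a generator of the torus of one of the factors, up to an element of order 2. -/
def torusBase (a b : G) : G := eval (fun j => conjPow a b j) torusWord

/-- A generator of the torus of one of the factors. -/
def torus (a b : G) : G := torusBase a b ^ 256

theorem conjPow_eq_or_eq_or_eq (ha : a ^ 3 = 1) (c : G) (i : ℤ) :
    conjPow a c i = c ∨ conjPow a c i = conjPow a c 1 ∨ conjPow a c i = conjPow a c 2 := by
  have h : i % 3 = 0 ∨ i % 3 = 1 ∨ i % 3 = 2 := by omega
  rw [← conjPow_emod_three ha]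
  obtain h | h | h := h <;> simp [h, conjPow_zero]

theorem torusBase_mul (h : IsFlipPair flipTable a b) :
    torusBase a b * torusBase a⁻¹ b = b ^ 4 := by
  have h1 := h.eval_torus_mul_swap
  rw [eval_append, eval_append, eval_swap h.pow_three, ← mul_assoc, eval_cons, eval_nil, mul_one,
    Nat.cast_zero, conjPow_zero, mul_eq_one_iff_eq_inv] at h1
  refine h1.trans (inv_eq_of_mul_eq_one_right ?_)
  rw [← pow_add, h.pow_31]

theorem commute_torusBase_zero (h : IsFlipPair flipTable a b) :
    Commute (torusBase a b) (torusBase a⁻¹ b) := by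
  have h1 := commute_of_eval_comm (fun j => h.conjPow_pow_31 j) h.eval_torus_comm
  rw [eval_cons, eval_nil, mul_one, pow_one, Nat.cast_zero, conjPow_zero] at h1
  have h2 : torusBase a⁻¹ b = (torusBase a b)⁻¹ * b ^ 4 := by
    rw [← h.torusBase_mul, inv_mul_cancel_left]
  rw [h2]
  exact (Commute.refl _).inv_right.mul_right (Commute.pow_right h1 4)

theorem commute_torusBase (h : IsFlipPair flipTable a b) (i j : ℤ) :
    Commute (conjPow a (torusBase a b) i) (conjPow a (torusBase a⁻¹ b) j) := by
  rw [commute_conjPow_iff]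
  obtain h1 | h1 | h1 := conjPow_eq_or_eq_or_eq h.pow_three (torusBase a⁻¹ b) (j - i)
  · rw [h1]
    exact h.commute_torusBase_zero
  · have h2 := commute_of_eval_comm (fun j => h.conjPow_pow_31 j) h.eval_torus_comm_one
    rw [eval_shift, eval_swap h.pow_three] at h2
    rw [h1]
    exact h2
  · have h2 := commute_of_eval_comm (fun j => h.conjPow_pow_31 j) h.eval_torus_comm_two
    rw [eval_shift, eval_swap h.pow_three] at h2
    rw [h1]
    exact h2

theorem conj_weyl_torusBase (h : IsFlipPair flipTable a b) :
    eval (fun j => conjPow a b j) weylWord * torusBase a b *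
      (eval (fun j => conjPow a b j) weylWord)⁻¹ = (torusBase a b)⁻¹ := by
  have h1 := h.eval_weyl_torus
  rw [eval_append, eval_append, eval_append, eval_inv fun j => h.conjPow_pow_31 j, ← mul_assoc,
    ← mul_assoc, mul_eq_one_iff_eq_inv] at h1
  exact h1

theorem torusBase_pow (h : IsFlipPair flipTable a b) : torusBase a b ^ 62 = 1 := by
  have hvu := h.torusBase_mul
  have h31 : torusBase a b ^ 31 * torusBase a⁻¹ b ^ 31 = 1 := by
    rw [← h.commute_torusBase_zero.mul_pow, hvu, ← pow_mul, mul_comm 4, pow_mul, h.pow_31, one_pow]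
  have he : ∀ j : ℤ, Commute (torusBase a b ^ 31) (conjPow a b j) := fun j => by
    have h1 : Commute (torusBase a b ^ 31) (conjPow a (torusBase a b) j) := by
      rw [eq_inv_of_mul_eq_one_left h31]
      have h2 := h.commute_torusBase j 0
      rw [conjPow_zero] at h2
      exact (h2.pow_right 31).inv_right.symm
    have h2 : Commute (torusBase a b ^ 31) (conjPow a (torusBase a⁻¹ b) j) := by
      have h2 := h.commute_torusBase 0 j
      rw [conjPow_zero] at h2
      exact h2.pow_left 31
    have h3 : conjPow a b j =
        (conjPow a (torusBase a b) j * conjPow a (torusBase a⁻¹ b) j) ^ 8 := by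
      rw [← conjPow_mul, hvu, ← conjPow_pow, ← pow_mul, ← pow_mod_31 h.pow_31, pow_one]
    rw [h3]
    exact (h1.mul_right h2).pow_right 8
  have h1 := congrArg (· ^ 31) h.conj_weyl_torusBase
  simp only [conj_pow, inv_pow] at h1
  rw [← (commute_eval (fun j => he j) weylWord).eq, mul_inv_cancel_right,
    ← mul_eq_one_iff_eq_inv, ← pow_add] at h1
  exact h1

theorem torus_pow_31 (h : IsFlipPair flipTable a b) : torus a b ^ 31 = 1 := by
  rw [torus, ← pow_mul, show 256 * 31 = 62 * 128 by rfl, pow_mul, h.torusBase_pow, one_pow]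

theorem torus_mul (h : IsFlipPair flipTable a b) : torus a b * torus a⁻¹ b = b := by
  rw [torus, torus, ← h.commute_torusBase_zero.mul_pow, h.torusBase_mul, ← pow_mul,
    ← pow_mod_31 h.pow_31, pow_one]

theorem commute_torus (h : IsFlipPair flipTable a b) (i j : ℤ) :
    Commute (conjPow a (torus a b) i) (conjPow a (torus a⁻¹ b) j) := by
  rw [torus, torus, conjPow_pow, conjPow_pow]
  exact ((h.commute_torusBase i j).pow_left _).pow_right _

/-- Words in the conjugates of `b` split into the two factors. -/
theorem eval_torus_mul (h : IsFlipPair flipTable a b) (w : SWord) :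
    eval (fun j => conjPow a b j) w =
      eval (fun j => conjPow a (torus a b) j) w * eval (fun j => conjPow a (torus a⁻¹ b) j) w := by
  rw [← eval_mul fun i j => h.commute_torus i j]
  simp only [← conjPow_mul, h.torus_mul]

/-- One of the two factors of the group generated by the conjugates of `b`. -/
def factor (a b : G) : Subgroup G := Subgroup.closure (Set.range (conjPow a (torus a b)))

theorem conjPow_torus_mem (a b : G) (j : ℤ) : conjPow a (torus a b) j ∈ factor a b :=
  Subgroup.subset_closure ⟨j, rfl⟩

theorem commute_conjPow_torus_of_mem (h : IsFlipPair flipTable a b) {g : G}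
    (hg : g ∈ factor a b) (j : ℤ) : Commute g (conjPow a (torus a⁻¹ b) j) := by
  have h1 : factor a b ≤ Subgroup.centralizer {conjPow a (torus a⁻¹ b) j} := by
    rw [factor, Subgroup.closure_le]
    rintro _ ⟨i, rfl⟩
    exact Subgroup.mem_centralizer_singleton_iff.mpr (h.commute_torus i j).eq
  exact Subgroup.mem_centralizer_singleton_iff.mp (h1 hg)

theorem conj_eval_of_mem (h : IsFlipPair flipTable a b) {g : G} (hg : g ∈ factor a b)
    (w : SWord) :
    eval (fun j => conjPow a b j) w * g * (eval (fun j => conjPow a b j) w)⁻¹ =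
      eval (fun j => conjPow a (torus a b) j) w * g *
        (eval (fun j => conjPow a (torus a b) j) w)⁻¹ := by
  have h1 := (commute_eval (fun j => h.commute_conjPow_torus_of_mem hg j) w).symm.mul_inv_cancel
  rw [h.eval_torus_mul, mul_inv_rev, ← mul_assoc, mul_assoc _ _ g, mul_assoc _ (_ * g), h1]

theorem torus_mem (a b : G) : torus a b ∈ factor a b := by
  simpa [conjPow_zero] using conjPow_torus_mem a b 0

theorem conj_weyl_torus (h : IsFlipPair flipTable a b) :
    eval (fun j => conjPow a (torus a b) j) weylWord * torus a b *
      (eval (fun j => conjPow a (torus a b) j) weylWord)⁻¹ = (torus a b)⁻¹ := by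
  rw [← h.conj_eval_of_mem (torus_mem a b), torus, ← conj_pow, h.conj_weyl_torusBase, inv_pow]

theorem conj_link_torus (h : IsFlipPair flipTable a b) :
    eval (fun j => conjPow a (torus a b) j) linkWord * torus a b *
      (eval (fun j => conjPow a (torus a b) j) linkWord)⁻¹ = conjPow a (torus a b) 2 := by
  have h1 := h.eval_link_torus
  rw [eval_append, eval_append, eval_append, eval_inv fun j => h.conjPow_pow_31 j,
    eval_inv fun j => h.conjPow_pow_31 j, eval_shift, ← mul_assoc, ← mul_assoc,
    mul_inv_eq_one] at h1
  rw [← h.conj_eval_of_mem (torus_mem a b), torus, ← conj_pow, conjPow_pow]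
  exact congrArg (· ^ 256) h1

theorem finite_factor (h : IsFlipPair flipTable a b) :
    Finite (factor a b) ∧ Nat.card (factor a b) ≤ 32736 := by
  let c : ℕ → factor a b := fun j => ⟨conjPow a (torus a b) j, conjPow_torus_mem a b j⟩
  let π := QuotientGroup.mk' (Subgroup.center (factor a b))
  have hπ : ∀ z, π z = 1 → ∀ g, Commute z g := fun z hz g => by
    have hz' : z ∈ Subgroup.center (factor a b) := (QuotientGroup.eq_one_iff z).mp hz
    exact (Subgroup.mem_center_iff.mp hz' g).symm
  have hG : ∀ j : ℤ, conjPow a (torus a b) j ^ 31 = 1 := fun j => by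
    rw [← conjPow_pow, h.torus_pow_31]
    simp [conjPow]
  have hc : ∀ j, c j ^ 31 = 1 := fun j => Subtype.ext (hG j)
  have hq : ∀ j, π (c j) ^ 31 = 1 := fun j => by rw [← map_pow, hc, map_one]
  have hval : ∀ w, ((eval c w : factor a b) : G) =
      eval (fun j => conjPow a (torus a b) j) w := fun w => (eval_map (factor a b).subtype w).symm
  have hrel : ∀ w, eval (fun j => conjPow a b j) w = 1 → eval (fun j => π (c j)) w = 1 := by
    intro w hw
    rw [h.eval_torus_mul] at hw
    rw [eval_map, ← MonoidHom.mem_ker, QuotientGroup.ker_mk', Subgroup.mem_center_iff]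
    intro g
    refine Subtype.ext ?_
    change (g : G) * (eval c w : factor a b) = (eval c w : factor a b) * (g : G)
    rw [hval, eq_inv_of_mul_eq_one_left hw]
    exact (commute_eval (fun j => h.commute_conjPow_torus_of_mem g.2 j) w).inv_right.eq
  have hcj : ∀ j : ℤ, ∃ k < 3, conjPow a (torus a b) j = conjPow a (torus a b) (k : ℕ) := by
    intro j
    obtain h1 | h1 | h1 := conjPow_eq_or_eq_or_eq h.pow_three (torus a b) j
    · exact ⟨0, by simp, h1.trans (conjPow_zero _ _).symm⟩
    · exact ⟨1, by simp, h1⟩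
    · exact ⟨2, by simp, h1⟩
  have hlink : c 2 = eval c linkWord * c 0 * (eval c linkWord)⁻¹ := by
    refine Subtype.ext ?_
    have h1 := h.conj_link_torus.symm
    rw [← hval] at h1
    simpa [c, conjPow_zero] using h1
  have hgen : ∀ S : Subgroup (factor a b), c 0 ∈ S → c 1 ∈ S → c 2 ∈ S → S = ⊤ := by
    intro S h0 h1 h2
    have hle : factor a b ≤ S.map (factor a b).subtype := by
      conv_lhs => rw [factor]
      rw [Subgroup.closure_le]
      rintro _ ⟨j, rfl⟩
      obtain ⟨k, hk, hjk⟩ := hcj j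
      rw [hjk]
      interval_cases k
      · exact ⟨_, h0, rfl⟩
      · exact ⟨_, h1, rfl⟩
      · exact ⟨_, h2, rfl⟩
    refine (Subgroup.eq_top_iff' S).mpr fun g => ?_
    obtain ⟨g', hg', hgg'⟩ := hle g.2
    rwa [← Subtype.ext hgg']
  refine finite_of_central_extension (X := c 0) (η := eval c rootWord) (w := eval c weylWord) hπ
    (hc 0) ?_ ?_ ?_ ?_ ?_ ?_ ?_ ?_ ?_ ?_
  · refine Subtype.ext ?_
    have h1 := h.conj_weyl_torus
    rw [← hval] at h1
    simpa [c, conjPow_zero] using h1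
  · rw [← eval_map, pow_two, ← eval_append]
    exact hrel _ h.eval_weyl_sq
  · rw [← eval_map, ← eval_map, ← eval_append]
    have h1 := hrel _ h.eval_weyl_root
    simpa only [eval_append, pow_succ, pow_zero, one_mul, mul_assoc] using h1
  · rw [← eval_map, pow_two, ← eval_append]
    exact hrel _ h.eval_root_sq
  · rw [← eval_map]
    have h1 := commute_of_eval_comm hq (hrel _ h.eval_root_comm_one)
    rwa [eval_conj hq] at h1
  · rw [← eval_map]
    have h1 := commute_of_eval_comm hq (hrel _ h.eval_root_comm_two)
    rwa [eval_conj hq] at h1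
  · rw [← eval_map]
    have h1 := eval_eq_of_append_inv hq (hrel _ h.eval_root_five)
    rwa [eval_append, eval_conj hq, eval_conj hq] at h1
  · rw [← eval_map]
    have h1 := eval_eq_of_append_inv hq (hrel _ h.eval_root_ten)
    rwa [eval_append, eval_conj hq, eval_conj hq] at h1
  · have h0 : c 0 ∈ Subgroup.normalClosure {c 0} := Subgroup.subset_normalClosure rfl
    refine hgen _ h0 ?_ ?_
    · have h1 : c 1 = (eval c (shift 1 linkWord))⁻¹ * c 0 * (eval c (shift 1 linkWord))⁻¹⁻¹ := by
        refine Subtype.ext ?_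
        have h2 := congrArg (conjPow a · 1) h.conj_link_torus
        have h3 : conjPow a (torus a b) (1 + 2) = torus a b := by
          rw [← conjPow_emod_three h.pow_three]
          exact conjPow_zero _ _
        have h4 := eval_shift a (torus a b) 1 linkWord
        rw [Nat.cast_one] at h4
        simp only [conjPow_eq_conj a _ 1, map_mul, map_inv] at h2
        simp only [← conjPow_eq_conj, ← conjPow_add, h3] at h2
        rw [← h4, ← hval] at h2
        change conjPow a (torus a b) 1 = ((eval c (shift 1 linkWord) : factor a b) : G)⁻¹ *
          conjPow a (torus a b) 0 * ((eval c (shift 1 linkWord) : factor a b) : G)⁻¹⁻¹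
        rw [conjPow_zero, inv_inv, mul_assoc, eq_inv_mul_iff_mul_eq]
        exact mul_inv_eq_iff_eq_mul.mp h2
      rw [h1]
      exact Subgroup.normalClosure_normal.conj_mem _ h0 _
    · rw [hlink]
      exact Subgroup.normalClosure_normal.conj_mem _ h0 _
  · intro g
    let T := Subgroup.closure {π (c 0), π (eval c weylWord), π (eval c rootWord)}
    let S := T.comap π
    have h0 : c 0 ∈ S := Subgroup.subset_closure (Set.mem_insert _ _)
    have hw : eval c weylWord ∈ S :=
      Subgroup.subset_closure (Set.mem_insert_of_mem _ (Set.mem_insert _ _))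
    have hr : eval c rootWord ∈ S :=
      Subgroup.subset_closure (Set.mem_insert_of_mem _ (Set.mem_insert_of_mem _ rfl))
    have h1 : c 1 ∈ S := by
      have h2 := hrel _ h.eval_bruhat
      rw [eval_append, eval_inv hq, inv_mul_eq_one, eval_cons, eval_nil, mul_one, pow_one,
        eval_map] at h2
      change π (c 1) ∈ T
      rw [h2]
      change _ ∈ S
      simp only [eval_cons, eval_append, eval_nil, mul_one]
      exact mul_mem (pow_mem h0 _) (mul_mem hr (mul_mem (pow_mem h0 _)
        (mul_mem hw (mul_mem hr (pow_mem h0 _)))))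
    have hl : eval c linkWord ∈ S := mul_mem (pow_mem h0 _) (mul_mem (pow_mem h1 _) (one_mem _))
    have hS := hgen S h0 h1 (by rw [hlink]; exact mul_mem (mul_mem hl h0) (inv_mem hl))
    exact (hS ▸ Subgroup.mem_top g : g ∈ S)

end IsFlipPair

/-! ### The order of the group -/

namespace IsFlipPair

variable {G : Type*} [Group G] {a b : G}

theorem conjPow_mem_factor {s : G} (hs : s ∈ factor a b) (i : ℤ) :
    conjPow a s i ∈ factor a b := by
  have h : factor a b ≤ (factor a b).comap (MulAut.conj (a ^ i)).toMonoidHom := by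
    conv_lhs => rw [factor]
    rw [Subgroup.closure_le]
    rintro _ ⟨j, rfl⟩
    change conjPow a (conjPow a (torus a b) j) i ∈ factor a b
    rw [← conjPow_add]
    exact conjPow_torus_mem a b _
  exact h hs

theorem exists_eq_mul (h : IsFlipPair flipTable a b) (hab : Subgroup.closure {a, b} = ⊤) (g : G) :
    ∃ s ∈ factor a b, ∃ t ∈ factor a⁻¹ b, ∃ i : ℤ, g = s * t * a ^ i := by
  have hcomm : ∀ s ∈ factor a b, Commute s (torus a⁻¹ b) := fun s hs => by
    have h1 := h.commute_conjPow_torus_of_mem hs 0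
    rwa [conjPow_zero] at h1
  have ha : ∀ r, (∃ s ∈ factor a b, ∃ t ∈ factor a⁻¹ b, ∃ i : ℤ, r = s * t * a ^ i) → ∀ n : ℤ,
      ∃ s ∈ factor a b, ∃ t ∈ factor a⁻¹ b, ∃ i : ℤ, a ^ n * r = s * t * a ^ i := by
    rintro _ ⟨s, hs, t, ht, i, rfl⟩ n
    refine ⟨conjPow a s n, conjPow_mem_factor hs n, conjPow a t n, ?_, n + i, ?_⟩
    · have h1 := conjPow_mem_factor ht (-n)
      rwa [conjPow_inv_left, neg_neg] at h1
    · simp [conjPow, zpow_add, mul_assoc]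
  have hb : ∀ r, (∃ s ∈ factor a b, ∃ t ∈ factor a⁻¹ b, ∃ i : ℤ, r = s * t * a ^ i) → ∀ n : ℤ,
      ∃ s ∈ factor a b, ∃ t ∈ factor a⁻¹ b, ∃ i : ℤ, b ^ n * r = s * t * a ^ i := by
    rintro _ ⟨s, hs, t, ht, i, rfl⟩ n
    refine ⟨torus a b ^ n * s, mul_mem (zpow_mem (torus_mem a b) n) hs,
      torus a⁻¹ b ^ n * t, mul_mem (zpow_mem (torus_mem a⁻¹ b) n) ht, i, ?_⟩
    have h1 : b ^ n = torus a b ^ n * torus a⁻¹ b ^ n := by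
      rw [← (hcomm _ (torus_mem a b)).mul_zpow, h.torus_mul]
    simp only [h1, mul_assoc, ((hcomm s hs).zpow_right n).left_comm]
  have hg : g ∈ Subgroup.closure {a, b} := hab ▸ Subgroup.mem_top g
  induction hg using Subgroup.closure_induction_left with
  | one => exact ⟨1, one_mem _, 1, one_mem _, 0, by simp⟩
  | mul_left x hx y _ ih =>
    obtain rfl | rfl := hx
    · simpa using ha y ih 1
    · simpa using hb y ih 1
  | inv_mul_cancel x hx y _ ih =>
    obtain rfl | rfl := hx
    · simpa using ha y ih (-1)
    · simpa using hb y ih (-1)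

theorem finite_and_card_le (h : IsFlipPair flipTable a b) (hab : Subgroup.closure {a, b} = ⊤) :
    Finite G ∧ Nat.card G ≤ 3 * (32736 * 32736) := by
  obtain ⟨h1, h1'⟩ := h.finite_factor
  obtain ⟨h2, h2'⟩ := h.inv.finite_factor
  let f : Fin 3 × factor a b × factor a⁻¹ b → G := fun p => p.2.1 * p.2.2 * a ^ (p.1 : ℕ)
  have hf : Function.Surjective f := by
    intro g
    obtain ⟨s, hs, t, ht, i, rfl⟩ := h.exists_eq_mul hab g
    have hi : a ^ (i % 3).toNat = a ^ i := by
      rw [← zpow_natCast, Int.toNat_of_nonneg (by omega), ← zpow_mod_orderOf,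
        ← zpow_mod_orderOf a i,
        Int.emod_emod_of_dvd]
      exact_mod_cast orderOf_dvd_of_pow_eq_one h.pow_three
    refine ⟨(⟨(i % 3).toNat, by omega⟩, ⟨s, hs⟩, ⟨t, ht⟩), ?_⟩
    change s * t * a ^ (i % 3).toNat = _
    rw [hi]
  refine ⟨Finite.of_surjective f hf, (Nat.card_le_card_of_surjective f hf).trans ?_⟩
  rw [Nat.card_prod, Nat.card_prod, Nat.card_fin]
  gcongr

end IsFlipPair

/-! ### The special linear group over the field with 32 elements -/

section SLTwo

open Matrix hiding transvection
open Matrix.SpecialLinearGroup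
open scoped MatrixGroups

theorem exists_pow_five_eq_of_pow {R : Type*} [CommRing R] [IsDomain R] [CharP R 2] {g : R}
    (hg : g ^ 31 = 1) (hg1 : g ≠ 1) : ∃ t : R, t ^ 5 = t ^ 2 + 1 := by
  have h2 : (2 : R) = 0 := CharTwo.two_eq_zero
  rw [← sub_ne_zero] at hg1
  have h : (g - 1) * ((g ^ 5 + g ^ 2 + 1) * (g ^ 5 + g ^ 3 + 1) *
      (g ^ 5 + g ^ 3 + g ^ 2 + g + 1) * (g ^ 5 + g ^ 4 + g ^ 2 + g + 1) *
      (g ^ 5 + g ^ 4 + g ^ 3 + g + 1) * (g ^ 5 + g ^ 4 + g ^ 3 + g ^ 2 + 1)) = 0 := by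
    clear hg1
    grind
  simp only [mul_eq_zero, hg1, false_or] at h
  obtain ((((h | h) | h) | h) | h) | h := h
  · exact ⟨g, by grind⟩
  · exact ⟨g ^ 15, by grind⟩
  · exact ⟨g ^ 5, by grind⟩
  · exact ⟨g ^ 7, by grind⟩
  · exact ⟨g ^ 3, by grind⟩
  · exact ⟨g ^ 11, by grind⟩

theorem exists_pow_five_eq_s19 {F : Type*} [Field F] [Fintype F] [CharP F 2]
    (hF : Fintype.card F = 32) : ∃ t : F, t ^ 5 = t ^ 2 + 1 := by
  classical
  obtain ⟨g, hg⟩ : ∃ g : F, g ∉ ({0, 1} : Finset F) := by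
    by_contra! h
    have h1 : Fintype.card F ≤ Finset.card ({0, 1} : Finset F) :=
      Finset.card_le_card fun x _ => h x
    have h2 := Finset.card_le_two (a := (0 : F)) (b := 1)
    omega
  obtain ⟨hg0, hg1⟩ : g ≠ 0 ∧ g ≠ 1 := by simpa using hg
  have h31 := FiniteField.pow_card_sub_one_eq_one g hg0
  rw [hF] at h31
  exact exists_pow_five_eq_of_pow h31 hg1

theorem le_card_SL_two {F : Type*} [Field F] [Fintype F] (hF : Fintype.card F = 32) :
    32736 ≤ Nat.card SL(2, F) := by
  let f : (Fˣ × F × F) ⊕ (Fˣ × F) → SL(2, F) := fun p => p.elim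
    (fun p => ⟨!![(p.1 : F), p.2.1; p.2.2, (p.1 : F)⁻¹ * (1 + p.2.1 * p.2.2)], by
      rw [det_fin_two_of, mul_inv_cancel_left₀ p.1.ne_zero]; ring⟩)
    (fun p => ⟨!![0, (p.1 : F); -(p.1 : F)⁻¹, p.2], by
      rw [det_fin_two_of, mul_neg, mul_inv_cancel₀ p.1.ne_zero]; ring⟩)
  have hf : Function.Injective f := by
    have hij : ∀ {A B : SL(2, F)}, A = B → ∀ i j, A i j = B i j := by rintro A _ rfl _ _; rfl
    rintro (⟨u, b, c⟩ | ⟨b, d⟩) (⟨u', b', c'⟩ | ⟨b', d'⟩) h <;> replace h := hij h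
    · obtain rfl : u = u' := Units.ext (h 0 0)
      obtain rfl : b = b' := h 0 1
      obtain rfl : c = c' := h 1 0
      rfl
    · exact absurd (h 0 0) u.ne_zero
    · exact absurd (h 0 0).symm u'.ne_zero
    · obtain rfl : b = b' := Units.ext (h 0 1)
      obtain rfl : d = d' := h 1 1
      rfl
  have h := Nat.card_le_card_of_injective f hf
  simp only [Nat.card_sum, Nat.card_prod, Nat.card_units, Nat.card_eq_fintype_card (α := F),
    hF] at h
  exact h

theorem isSimpleGroup_SL_two {F : Type*} [Field F] [Fintype F] [CharP F 2]
    (hF : Fintype.card F = 32) : IsSimpleGroup SL(2, F) := by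
  have h : Subgroup.center SL(2, F) = ⊥ := by
    refine (Subgroup.eq_bot_iff_forall _).mpr fun A hA => ?_
    obtain ⟨r, hr, hrA⟩ := mem_center_iff.mp hA
    have h1 : r = 1 := by
      rw [← sub_eq_zero, ← sq_eq_zero_iff, CharTwo.sub_eq_add, CharTwo.add_sq]
      rw [Fintype.card_fin] at hr
      rw [hr, one_pow, CharTwo.add_self_eq_zero]
    refine Subtype.ext ?_
    rw [← hrA, h1, map_one, coe_one]
  have h1 : IsSimpleGroup PSL(2, F) := ProjectiveSpecialLinearGroup.rank_two_simple (by
    rw [Nat.card_eq_fintype_card, hF]; norm_num)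
  exact ((QuotientGroup.quotientMulEquivOfEq h).trans
    QuotientGroup.quotientBot).symm.isSimpleGroup

section generation

variable {F : Type*} [Field F]

theorem coe_transvection_zero_one (c : F) :
    (transvection zero_ne_one c : SL(2, F)).1 = !![1, c; 0, 1] := by
  ext i j
  fin_cases i <;> fin_cases j <;> simp [transvection_coe]

theorem coe_transvection_one_zero (c : F) :
    (transvection one_ne_zero c : SL(2, F)).1 = !![1, 0; c, 1] := by
  ext i j
  fin_cases i <;> fin_cases j <;> simp [transvection_coe]

theorem coe_diag2_pow {d : F} (hd : d ≠ 0) (n : ℕ) :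
    (diag2 d hd ^ n).1 = !![d ^ n, 0; 0, d⁻¹ ^ n] := by
  rw [coe_pow, diag2_coe, diagonal_pow]
  ext i j
  fin_cases i <;> fin_cases j <;> simp

theorem transvection_mem_of_upper_triangular {P : Subgroup SL(2, F)} {d : F} (hd : d ≠ 0)
    (hP : diag2 d hd ∈ P) {B : SL(2, F)} (hB : B ∈ P) (hB0 : B 1 0 = 0) :
    transvection zero_ne_one ((d ^ 2 - 1) * (B 0 0 * B 0 1)) ∈ P := by
  have h : transvection zero_ne_one ((d ^ 2 - 1) * (B 0 0 * B 0 1)) =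
      diag2 d hd * B * (diag2 d hd)⁻¹ * B⁻¹ := by
    refine Subtype.ext ?_
    have hdet := B.2
    rw [det_fin_two] at hdet
    rw [coe_transvection_zero_one, coe_mul, coe_mul, coe_mul, coe_inv, coe_inv, diag2_coe',
      eta_fin_two B.1]
    simp only [adjugate_fin_two_of, mul_fin_two]
    ext i j
    fin_cases i <;> fin_cases j <;> simp <;> grind
  rw [h]
  exact mul_mem (mul_mem (mul_mem hP hB) (inv_mem hP)) (inv_mem hB)

theorem transvection_mem_of_diag2_mem {P : Subgroup SL(2, F)} {d : F} (hd : d ≠ 0)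
    (hP : diag2 d hd ∈ P) {c : F} (hc : transvection zero_ne_one c ∈ P) :
    transvection zero_ne_one (d ^ 2 * c) ∈ P := by
  have h : transvection zero_ne_one (d ^ 2 * c) =
      diag2 d hd * transvection zero_ne_one c * (diag2 d hd)⁻¹ := by
    refine Subtype.ext ?_
    rw [coe_transvection_zero_one, coe_mul, coe_mul, coe_inv, coe_transvection_zero_one,
      diag2_coe']
    simp only [adjugate_fin_two_of, mul_fin_two]
    ext i j
    fin_cases i <;> fin_cases j <;> simp <;> grind
  rw [h]
  exact mul_mem (mul_mem hP hc) (inv_mem hP)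

theorem eq_top_of_transvection_mem {P : Subgroup SL(2, F)}
    (hP : ∀ c, transvection zero_ne_one c ∈ P) {A : SL(2, F)} (hA : A ∈ P) (hA0 : A 1 0 ≠ 0) :
    P = ⊤ := by
  have hdet := A.2
  rw [det_fin_two] at hdet
  obtain ⟨W, hW⟩ : ∃ W : SL(2, F), W.1 = !![0, -(A 1 0)⁻¹; A 1 0, 0] := by
    refine ⟨⟨_, ?_⟩, rfl⟩
    rw [det_fin_two_of, neg_mul, inv_mul_cancel₀ hA0]
    ring
  have hWP : W ∈ P := by
    have h : W = transvection zero_ne_one (-(A 0 0 * (A 1 0)⁻¹)) * A *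
        transvection zero_ne_one (-(A 1 1 * (A 1 0)⁻¹)) := by
      refine Subtype.ext ?_
      rw [hW, coe_mul, coe_mul, coe_transvection_zero_one, coe_transvection_zero_one,
        eta_fin_two A.1]
      simp only [mul_fin_two]
      ext i j
      fin_cases i <;> fin_cases j <;> simp <;> grind
    rw [h]
    exact mul_mem (mul_mem (hP _) hA) (hP _)
  have hL : ∀ c, transvection one_ne_zero c ∈ P := fun c => by
    have h : transvection one_ne_zero c =
        W * transvection zero_ne_one (-((A 1 0)⁻¹ ^ 2 * c)) * W⁻¹ := by
      refine Subtype.ext ?_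
      rw [coe_mul, coe_mul, coe_inv, hW, coe_transvection_zero_one, coe_transvection_one_zero]
      simp only [adjugate_fin_two_of, mul_fin_two]
      ext i j
      fin_cases i <;> fin_cases j <;> simp <;> grind
    rw [h]
    exact mul_mem (mul_mem hWP (hP _)) (inv_mem hWP)
  refine (Subgroup.eq_top_iff' P).mpr fun M => ?_
  refine SL2.transvection_induction (· ∈ P) (fun i j hij c => ?_) (fun _ _ => mul_mem) M
  fin_cases i <;> fin_cases j
  · exact absurd rfl hij
  · exact hP c
  · exact hL c
  · exact absurd rfl hij

theorem eq_top_of_diag2_mem [Fintype F] [CharP F 2] (hF : Fintype.card F = 32)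
    {P : Subgroup SL(2, F)} {d : F} (hd : d ≠ 0) (hd1 : d ≠ 1) (hP : diag2 d hd ∈ P)
    {A B : SL(2, F)} (hA : A ∈ P) (hA0 : A 1 0 ≠ 0) (hB : B ∈ P) (hB0 : B 1 0 = 0)
    (hB1 : B 0 1 ≠ 0) : P = ⊤ := by
  refine eq_top_of_transvection_mem (fun c => ?_) hA hA0
  have hl : B 0 0 ≠ 0 := fun h => by
    have hdet := B.2
    rw [det_fin_two] at hdet
    simp [h, hB0] at hdet
  have hd2 : d ^ 2 ≠ 1 := by
    rw [← sub_ne_zero, show d ^ 2 - 1 = (d - 1) ^ 2 by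
      rw [CharTwo.sub_eq_add, CharTwo.sub_eq_add, CharTwo.add_sq, one_pow]]
    exact pow_ne_zero 2 (sub_ne_zero.mpr hd1)
  have h0 := transvection_mem_of_upper_triangular hd hP hB hB0
  have hc0 : (d ^ 2 - 1) * (B 0 0 * B 0 1) ≠ 0 :=
    mul_ne_zero (sub_ne_zero.mpr hd2) (mul_ne_zero hl hB1)
  generalize (d ^ 2 - 1) * (B 0 0 * B 0 1) = c0 at h0 hc0
  have hk : ∀ k : ℕ, transvection zero_ne_one ((d ^ 2) ^ k * c0) ∈ P := fun k => by
    induction k with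
    | zero => simpa using h0
    | succ k ih =>
      rw [pow_succ', mul_assoc]
      exact transvection_mem_of_diag2_mem hd hP ih
  by_cases hc : c = 0
  · rw [hc, transvection_coeff_zero]
    exact one_mem P
  · have : Fact (Nat.Prime 31) := ⟨by norm_num⟩
    have hcard : Nat.card Fˣ = 31 := by
      rw [Nat.card_units, Nat.card_eq_fintype_card, hF]
    obtain ⟨k, hk'⟩ := mem_powers_of_prime_card (g := (Units.mk0 d hd) ^ 2)
      (g' := Units.mk0 c hc / Units.mk0 c0 hc0) hcard
      fun h => hd2 (by simpa using congrArg Units.val h)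
    have h1 : (d ^ 2) ^ k * c0 = c := by
      have h2 := congrArg Units.val hk'
      simp only [Units.val_pow_eq_pow_val, Units.val_mk0, Units.val_div_eq_div_val] at h2
      rw [h2, div_mul_cancel₀ _ hc0]
    rw [← h1]
    exact hk k

end generation

section representation

variable {F : Type*} [Field F] [CharP F 2]

/-- An element of trace 1, hence of order 3, whose upper right entry is 1. -/
def traceOne (p : F) : SL(2, F) :=
  ⟨!![p, 1; p * (p + 1) + 1, p + 1], by
    rw [det_fin_two_of, CharTwo.sub_eq_add, one_mul, ← add_assoc, CharTwo.add_self_eq_zero,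
      zero_add]⟩

theorem coe_traceOne (p : F) : (traceOne p).1 = !![p, 1; p * (p + 1) + 1, p + 1] := rfl

theorem pow_three_eq_one_of_trace {M : SL(2, F)} (hM : M 0 0 + M 1 1 = 1) : M ^ 3 = 1 := by
  refine Subtype.ext ?_
  have h2 : (2 : F) = 0 := CharTwo.two_eq_zero
  have hdet := M.2
  rw [det_fin_two] at hdet
  rw [coe_pow, pow_three, eta_fin_two M.1, coe_one, one_fin_two]
  simp only [mul_fin_two]
  ext i j
  fin_cases i <;> fin_cases j <;> simp <;> grind

theorem sq_eq_one_of_trace {M : SL(2, F)} (hM : M 0 0 + M 1 1 = 0) : M ^ 2 = 1 := by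
  refine Subtype.ext ?_
  have h2 : (2 : F) = 0 := CharTwo.two_eq_zero
  have hdet := M.2
  rw [det_fin_two] at hdet
  rw [coe_pow, pow_two, eta_fin_two M.1, coe_one, one_fin_two]
  simp only [mul_fin_two]
  ext i j
  fin_cases i <;> fin_cases j <;> simp <;> grind

theorem pow_three_ne_one_of_trace {M : SL(2, F)} (hM : M 0 0 + M 1 1 ≠ 1) (hM' : M 0 1 ≠ 0) :
    M ^ 3 ≠ 1 := fun h => by
  have h2 : (2 : F) = 0 := CharTwo.two_eq_zero
  have hdet := M.2
  rw [det_fin_two] at hdet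
  have h01 := congrFun (congrFun (congrArg Subtype.val h) 0) 1
  rw [coe_pow, pow_three, eta_fin_two M.1, coe_one, one_fin_two] at h01
  simp only [mul_fin_two, of_apply, cons_val', cons_val_zero, cons_val_one, cons_val_fin_one]
    at h01
  have h3 : M 0 1 * (M 0 0 + M 1 1 - 1) ^ 2 = 0 := by grind
  rcases mul_eq_zero.mp h3 with h4 | h4
  · exact hM' h4
  · exact hM (sub_eq_zero.mp (pow_eq_zero_iff two_ne_zero |>.mp h4))

theorem traceOne_pow_three (p : F) : traceOne p ^ 3 = 1 := by
  refine pow_three_eq_one_of_trace ?_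
  change p + (p + 1) = 1
  rw [← add_assoc, CharTwo.add_self_eq_zero, zero_add]

theorem conj_diag2_pow_mul_diag2_pow_sq {p q d : F} (hd : d ≠ 0) (hp : p ^ 2 + p = q) {k f : ℕ}
    (h : (q * d ^ k + (q + 1) * d⁻¹ ^ k) * d ^ f +
      ((q + 1) * d ^ k + q * d⁻¹ ^ k) * d⁻¹ ^ f = 0) :
    (traceOne p * diag2 d hd ^ k * (traceOne p)⁻¹ * diag2 d hd ^ f) ^ 2 = 1 := by
  refine sq_eq_one_of_trace ?_
  have h2 : (2 : F) = 0 := CharTwo.two_eq_zero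
  change (traceOne p * diag2 d hd ^ k * (traceOne p)⁻¹ * diag2 d hd ^ f).1 0 0 +
    (traceOne p * diag2 d hd ^ k * (traceOne p)⁻¹ * diag2 d hd ^ f).1 1 1 = 0
  rw [coe_mul, coe_mul, coe_mul, coe_inv, coe_diag2_pow, coe_diag2_pow, coe_traceOne]
  simp only [adjugate_fin_two_of, mul_fin_two, of_apply, cons_val', cons_val_zero, cons_val_one,
    cons_val_fin_one]
  refine Eq.trans ?_ h
  generalize d ^ k = x1, d⁻¹ ^ k = x2, d ^ f = x3, d⁻¹ ^ f = x4
  grind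

theorem exists_mem_of_traceOne_mem {P : Subgroup SL(2, F)} {p q d : F} (hd : d ≠ 0)
    (hp : p ^ 2 + p = q) (hA : traceOne p ∈ P) (hP : diag2 d hd ∈ P)
    (h0 : 1 + q * d⁻¹ ^ 2 + (q + 1) * d ^ 2 = 0) (h1 : 1 + (q + 1) * d⁻¹ ^ 2 + q * d ^ 2 ≠ 0) :
    ∃ B ∈ P, B 1 0 = 0 ∧ B 0 1 ≠ 0 := by
  have h2 : (2 : F) = 0 := CharTwo.two_eq_zero
  have hdd : d * d⁻¹ = 1 := mul_inv_cancel₀ hd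
  have key : (traceOne p * (diag2 d hd * traceOne p * (diag2 d hd)⁻¹) * traceOne p).1 =
      !![p, 1; p * (p + 1) + 1, p + 1] *
      (!![d, 0; 0, d⁻¹] * !![p, 1; p * (p + 1) + 1, p + 1] * !![d⁻¹, 0; 0, d]) *
      !![p, 1; p * (p + 1) + 1, p + 1] := by
    rw [coe_mul, coe_mul, coe_mul, coe_mul, coe_inv, diag2_coe', coe_traceOne]
    simp only [adjugate_fin_two_of, neg_zero]
  simp only [mul_fin_two] at key
  refine ⟨_, mul_mem (mul_mem hA (mul_mem (mul_mem hP hA) (inv_mem hP))) hA, ?_, fun h => h1 ?_⟩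
  · refine (congrFun (congrFun key 1) 0).trans ?_
    simp only [of_apply, cons_val', cons_val_zero, cons_val_one, cons_val_fin_one]
    generalize d⁻¹ = s at *
    grind
  · rw [← h]
    refine Eq.trans ?_ (congrFun (congrFun key 0) 1).symm
    simp only [of_apply, cons_val', cons_val_zero, cons_val_one, cons_val_fin_one]
    generalize d⁻¹ = s at *
    grind

end representation

section epimorphism

theorem IsSimpleGroup.map_mem_of_map_mem {X S : Type*} [Group X] [Group S] [IsSimpleGroup S]
    (f : S →* X) (g : X →* S) (hfg : ∀ r s, f (g r * s * (g r)⁻¹) = r * f s * r⁻¹)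
    {R : Subgroup X} (hR : R.map g = ⊤) {s : S} (hs : s ≠ 1) (hsR : f s ∈ R) (u : S) :
    f u ∈ R := by
  have hN : (R.comap f).Normal := by
    refine ⟨fun n hn v => ?_⟩
    obtain ⟨r, hr, rfl⟩ : v ∈ R.map g := hR ▸ Subgroup.mem_top v
    rw [Subgroup.mem_comap, hfg]
    exact mul_mem (mul_mem hr hn) (inv_mem hr)
  rcases hN.eq_bot_or_eq_top with h | h
  · exact absurd (Subgroup.mem_bot.mp (h ▸ hsR : s ∈ (⊥ : Subgroup S))) hs
  · exact (h ▸ Subgroup.mem_top u : u ∈ R.comap f)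

theorem exists_hom_of_relators {H : Type*} [Group H] {a b : H} (ha : a ^ 3 = 1)
    (hb : b ^ 31 = 1) (h1 : (a * b ^ 1 * a⁻¹ * b ^ 2) ^ 2 = 1)
    (h2 : (a * b ^ 2 * a⁻¹ * b ^ 1) ^ 2 = 1) (h3 : (a * b ^ 3 * a⁻¹ * b ^ 20) ^ 2 = 1)
    (h4 : (a * b ^ 4 * a⁻¹ * b ^ 13) ^ 2 = 1) :
    ∃ φ : Gp →* H, φ (PresentedGroup.of 0) = a ∧ φ (PresentedGroup.of 1) = b := by
  have hb' : (b ^ 11)⁻¹ = b ^ 20 := inv_eq_of_mul_eq_one_right (by rw [← pow_add, hb])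
  rw [pow_one] at h1 h2
  refine ⟨PresentedGroup.toGroup (f := ![a, b]) fun r hr => ?_, ?_, ?_⟩
  · simp only [Grels, Set.mem_insert_iff, Set.mem_singleton_iff] at hr
    rcases hr with rfl | rfl | rfl | rfl | rfl | rfl <;> simp [*]
  · simp
  · simp

variable {F : Type*} [Field F]

theorem ne_zero_of_pow_five_eq {t : F} (ht : t ^ 5 = t ^ 2 + 1) : t ≠ 0 := by
  rintro rfl
  simp at ht

theorem ne_one_of_pow_five_eq {t : F} (ht : t ^ 5 = t ^ 2 + 1) : t ≠ 1 := by
  rintro rfl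
  simp at ht

variable [CharP F 2]

theorem inv_eq_of_pow_five_eq {t : F} (ht : t ^ 5 = t ^ 2 + 1) : t⁻¹ = t ^ 4 + t := by
  have h2 : (2 : F) = 0 := CharTwo.two_eq_zero
  refine inv_eq_of_mul_eq_one_right ?_
  grind

theorem pow_thirtyone_eq_one {t : F} (ht : t ^ 5 = t ^ 2 + 1) : t ^ 31 = 1 := by
  have h2 : (2 : F) = 0 := CharTwo.two_eq_zero
  grind

theorem trace_relators {t s p q : F} (ht : t ^ 5 = t ^ 2 + 1) (hs : s = t ^ 4 + t)
    (hp : p = t ^ 4 + t ^ 2 + t) (hq : p ^ 2 + p = q) :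
    ((q * t ^ 1 + (q + 1) * s ^ 1) * t ^ 2 + ((q + 1) * t ^ 1 + q * s ^ 1) * s ^ 2 = 0 ∧
      (q * t ^ 2 + (q + 1) * s ^ 2) * t ^ 1 + ((q + 1) * t ^ 2 + q * s ^ 2) * s ^ 1 = 0) ∧
    (q * t ^ 3 + (q + 1) * s ^ 3) * t ^ 20 + ((q + 1) * t ^ 3 + q * s ^ 3) * s ^ 20 = 0 ∧
      (q * t ^ 4 + (q + 1) * s ^ 4) * t ^ 13 + ((q + 1) * t ^ 4 + q * s ^ 4) * s ^ 13 = 0 := by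
  have h2 : (2 : F) = 0 := CharTwo.two_eq_zero
  refine ⟨⟨?_, ?_⟩, ?_, ?_⟩ <;> grind

theorem eq_top_of_traceOne_mem [Fintype F] (hF : Fintype.card F = 32) {t p q : F}
    (ht : t ^ 5 = t ^ 2 + 1) (hp : p ^ 2 + p = q)
    (hq : q = (t ^ 4 + t ^ 2 + t) ^ 2 + (t ^ 4 + t ^ 2 + t)) {P : Subgroup SL(2, F)}
    (hA : traceOne p ∈ P) (hP : diag2 t (ne_zero_of_pow_five_eq ht) ∈ P) : P = ⊤ := by
  have h2 : (2 : F) = 0 := CharTwo.two_eq_zero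
  have h0 := ne_zero_of_pow_five_eq ht
  have h21 : diag2 (t ^ 21) (pow_ne_zero 21 h0) ∈ P := by
    convert pow_mem hP 21
    refine Subtype.ext ?_
    rw [coe_diag2_pow, diag2_coe', inv_pow]
  have hs := inv_eq_of_pow_five_eq ht
  have hi : (t ^ 21)⁻¹ ^ 2 = (t ^ 4 + t) ^ 11 := by
    rw [← hs, inv_pow, inv_pow, ← pow_mul, show 21 * 2 = 31 + 11 by rfl, pow_add,
      pow_thirtyone_eq_one ht, one_mul]
  have hi' : (t ^ 21) ^ 2 = t ^ 11 := by
    rw [← pow_mul, show 21 * 2 = 31 + 11 by rfl, pow_add, pow_thirtyone_eq_one ht, one_mul]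
  obtain ⟨B, hB, hB0, hB1⟩ := exists_mem_of_traceOne_mem (pow_ne_zero 21 h0) hp hA h21
    (by rw [hi, hi']; clear hi hi'; subst hq; grind)
    (by
      rw [hi, hi', show 1 + (q + 1) * (t ^ 4 + t) ^ 11 + q * t ^ 11 = t ^ 3 + t + 1 by
        clear hi hi'; subst hq; grind]
      intro h
      apply h0
      grind)
  refine eq_top_of_diag2_mem hF h0 (ne_one_of_pow_five_eq ht) hP hA ?_ hB hB0 hB1
  change p * (p + 1) + 1 ≠ 0
  intro h
  apply h0
  grind

theorem exists_surjective_hom [Fintype F] (hF : Fintype.card F = 32) :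
    ∃ φ : Gp →* Multiplicative (ZMod 3) × SL(2, F) × SL(2, F), Function.Surjective φ := by
  obtain ⟨t, ht⟩ := exists_pow_five_eq_s19 hF
  have : IsSimpleGroup SL(2, F) := isSimpleGroup_SL_two hF
  have h2 : (2 : F) = 0 := CharTwo.two_eq_zero
  have ht0 := ne_zero_of_pow_five_eq ht
  have ht1 := ne_one_of_pow_five_eq ht
  have hs := inv_eq_of_pow_five_eq ht
  have hx : diag2 t ht0 ^ 31 = 1 := by
    refine Subtype.ext ?_
    rw [coe_diag2_pow, inv_pow, pow_thirtyone_eq_one ht, inv_one, coe_one, one_fin_two]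
  have hx1 : diag2 t ht0 ≠ 1 := fun h => ht1 (by
    simpa [diag2_coe'] using congrFun (congrFun (congrArg Subtype.val h) 0) 0)
  obtain ⟨p, hp⟩ : ∃ p, p = t ^ 4 + t ^ 2 + t := ⟨_, rfl⟩
  obtain ⟨q, hq⟩ : ∃ q, p ^ 2 + p = q := ⟨_, rfl⟩
  have hq' : (p + 1) ^ 2 + (p + 1) = q := by grind
  have hqt : q = (t ^ 4 + t ^ 2 + t) ^ 2 + (t ^ 4 + t ^ 2 + t) := by rw [← hq, hp]
  obtain ⟨⟨r1, r2⟩, r3, r4⟩ := trace_relators ht hs hp hq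
  have hrel {k f : ℕ} (h : (q * t ^ k + (q + 1) * t⁻¹ ^ k) * t ^ f +
      ((q + 1) * t ^ k + q * t⁻¹ ^ k) * t⁻¹ ^ f = 0) :
      (((Multiplicative.ofAdd (1 : ZMod 3), traceOne p, traceOne (p + 1)) :
        Multiplicative (ZMod 3) × SL(2, F) × SL(2, F)) * (1, diag2 t ht0, diag2 t ht0) ^ k *
        (Multiplicative.ofAdd (1 : ZMod 3), traceOne p, traceOne (p + 1))⁻¹ *
        (1, diag2 t ht0, diag2 t ht0) ^ f) ^ 2 = 1 := by
    simp only [Prod.pow_mk, Prod.mk_mul_mk, Prod.inv_mk,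
      conj_diag2_pow_mul_diag2_pow_sq ht0 hq h, conj_diag2_pow_mul_diag2_pow_sq ht0 hq' h]
    simp
  obtain ⟨φ, ha, hb⟩ := exists_hom_of_relators
    (a := ((Multiplicative.ofAdd (1 : ZMod 3), traceOne p, traceOne (p + 1)) :
      Multiplicative (ZMod 3) × SL(2, F) × SL(2, F)))
    (b := (1, diag2 t ht0, diag2 t ht0))
    (by
      rw [Prod.pow_mk, Prod.pow_mk, traceOne_pow_three, traceOne_pow_three]
      rfl)
    (by rw [Prod.pow_mk, Prod.pow_mk, hx, one_pow]; rfl)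
    (hrel r1) (hrel r2) (hrel r3) (hrel r4)
  have ha' := ha ▸ MonoidHom.mem_range.mpr ⟨_, rfl⟩
  have hb' := hb ▸ MonoidHom.mem_range.mpr ⟨_, rfl⟩
  refine ⟨φ, ?_⟩
  rw [← MonoidHom.range_eq_top]
  generalize φ.range = R at ha' hb'
  let f1 : SL(2, F) →* Multiplicative (ZMod 3) × SL(2, F) × SL(2, F) :=
    (MonoidHom.inr _ _).comp (MonoidHom.inl _ _)
  let f2 : SL(2, F) →* Multiplicative (ZMod 3) × SL(2, F) × SL(2, F) :=
    (MonoidHom.inr _ _).comp (MonoidHom.inr _ _)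
  let g1 : Multiplicative (ZMod 3) × SL(2, F) × SL(2, F) →* SL(2, F) :=
    (MonoidHom.fst _ _).comp (MonoidHom.snd _ _)
  let g2 : Multiplicative (ZMod 3) × SL(2, F) × SL(2, F) →* SL(2, F) :=
    (MonoidHom.snd _ _).comp (MonoidHom.snd _ _)
  have hg1 : R.map g1 = ⊤ := eq_top_of_traceOne_mem hF ht hq hqt ⟨_, ha', rfl⟩ ⟨_, hb', rfl⟩
  have hg2 : R.map g2 = ⊤ := eq_top_of_traceOne_mem hF ht hq' hqt ⟨_, ha', rfl⟩ ⟨_, hb', rfl⟩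
  have hM (p : F) : (traceOne p * diag2 t ht0 ^ 2).1 =
      !![p * t ^ 2, t⁻¹ ^ 2; (p * (p + 1) + 1) * t ^ 2, (p + 1) * t⁻¹ ^ 2] := by
    rw [coe_mul, coe_diag2_pow, coe_traceOne, mul_fin_two]
    simp
  have hM1 : (traceOne p * diag2 t ht0 ^ 2) ^ 3 ≠ 1 := by
    refine pow_three_ne_one_of_trace ?_ ?_
    · rw [hM]
      change p * t ^ 2 + (p + 1) * t⁻¹ ^ 2 ≠ 1
      rw [hs]
      intro h
      apply ht0
      clear hM hqt hs
      grind
    · rw [hM]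
      exact pow_ne_zero 2 (inv_ne_zero ht0)
  have hM2 : (traceOne (p + 1) * diag2 t ht0 ^ 2) ^ 3 = 1 := by
    refine pow_three_eq_one_of_trace ?_
    rw [hM]
    change (p + 1) * t ^ 2 + (p + 1 + 1) * t⁻¹ ^ 2 = 1
    rw [hs]
    clear hM hqt hs
    grind
  have hf1 : ∀ u, f1 u ∈ R := by
    refine IsSimpleGroup.map_mem_of_map_mem f1 g1 (fun r s => ?_) hg1 hM1 ?_
    · ext <;> simp [f1, g1]
    · convert pow_mem (mul_mem ha' (pow_mem hb' 2)) 3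
      simp only [Prod.pow_mk, Prod.mk_mul_mk, hM2]
      rfl
  have hf2 : ∀ u, f2 u ∈ R := by
    refine IsSimpleGroup.map_mem_of_map_mem f2 g2 (fun r s => ?_) hg2 hx1 ?_
    · ext <;> simp [f2, g2]
    · convert mul_mem hb' (hf1 (diag2 t ht0)⁻¹)
      simp [f1, f2]
  have hc : ((Multiplicative.ofAdd (1 : ZMod 3), 1, 1) :
      Multiplicative (ZMod 3) × SL(2, F) × SL(2, F)) ∈ R := by
    convert mul_mem (mul_mem ha' (hf1 (traceOne p)⁻¹)) (hf2 (traceOne (p + 1))⁻¹) <;>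
    simp [f1, f2]
  refine (Subgroup.eq_top_iff' R).mpr fun ⟨c, u, v⟩ => ?_
  have h : (c, u, v) = ((Multiplicative.ofAdd (1 : ZMod 3), 1, 1) :
      Multiplicative (ZMod 3) × SL(2, F) × SL(2, F)) ^ c.toAdd.val * f1 u * f2 v := by
    have hcc : Multiplicative.ofAdd (1 : ZMod 3) ^ c.toAdd.val = c := by
      rw [← ofAdd_nsmul, nsmul_one, ZMod.natCast_zmod_val]
      rfl
    simp [f1, f2, hcc]
  rw [h]
  exact mul_mem (mul_mem (pow_mem hc _) (hf1 u)) (hf2 v)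

end epimorphism

end SLTwo

theorem isFlipPair_of : IsFlipPair flipTable (PresentedGroup.of 0 : Gp) (PresentedGroup.of 1) := by
  have hb : (PresentedGroup.of 1 : Gp) ^ 31 = 1 :=
    PresentedGroup.one_of_mem (rels := Grels) (by simp [Grels])
  have hconj (k : ℕ) : conjPow (PresentedGroup.of 0 : Gp) (PresentedGroup.of 1) 1 ^ k =
      PresentedGroup.of 0 * PresentedGroup.of 1 ^ k * (PresentedGroup.of 0)⁻¹ := by
    rw [conjPow, zpow_one, conj_pow]
  have hb' : (PresentedGroup.of 1 : Gp) ^ 20 = (PresentedGroup.of 1) ^ (-11 : ℤ) := by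
    rw [zpow_neg]
    exact eq_inv_of_mul_eq_one_left ((pow_add _ 20 11).symm.trans hb)
  refine IsFlipPair.of_relators ?_ hb ?_ ?_ ?_ ?_
  · exact PresentedGroup.one_of_mem (rels := Grels) (by simp [Grels])
  · rw [hconj, pow_one]
    exact PresentedGroup.one_of_mem (rels := Grels) (by simp [Grels])
  · rw [hconj, pow_one]
    exact PresentedGroup.one_of_mem (rels := Grels) (by simp [Grels])
  · rw [hconj, hb']
    exact PresentedGroup.one_of_mem (rels := Grels) (by simp [Grels])
  · rw [hconj]
    exact PresentedGroup.one_of_mem (rels := Grels) (by simp [Grels])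

theorem closure_pair_of :
    Subgroup.closure {(PresentedGroup.of 0 : Gp), PresentedGroup.of 1} = ⊤ := by
  rw [← PresentedGroup.closure_range_of Grels]
  congr 1
  ext g
  simp [Fin.exists_fin_two, eq_comm]

/-- G ≅ C₃ × SL(2, 32) × SL(2, 32). -/
theorem Gp_iso_C3_SL2_SL2 :
    Nonempty (Gp ≃* Multiplicative (ZMod 3) ×
      Matrix.SpecialLinearGroup (Fin 2) (GaloisField 2 5) ×
      Matrix.SpecialLinearGroup (Fin 2) (GaloisField 2 5)) := by
  have : Fintype (GaloisField 2 5) := Fintype.ofFinite _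
  have hF : Fintype.card (GaloisField 2 5) = 32 := by
    rw [← Nat.card_eq_fintype_card, GaloisField.card 2 5 (by norm_num)]
    norm_num
  obtain ⟨φ, hφ⟩ := exists_surjective_hom hF
  obtain ⟨_, hle⟩ := isFlipPair_of.finite_and_card_le closure_pair_of
  have hSL := le_card_SL_two hF
  refine ⟨MulEquiv.ofBijective φ
    ((Nat.bijective_iff_surjective_and_card φ).mpr ⟨hφ, le_antisymm ?_ ?_⟩)⟩
  · rw [Nat.card_prod, Nat.card_prod]
    refine hle.trans (Nat.mul_le_mul ?_ (Nat.mul_le_mul hSL hSL))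
    simp
  · exact Nat.card_le_card_of_surjective φ hφ
end
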